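/- Let p and q be prime numbers with p ≡ 5 (mod 8) and q ≡ 3 (mod 8) (the Legendre symbol (p/q) may be 1 or −1), and let m be the natural number with 2^m equal to the 2-class number of ℚ(√(−pq)). For every integer n ≥ 1, let L_n = ℚ(√p, √q, ζ_{2^{n+2}}) where ζ_{2^{n+2}} is a primitive 2^{n+2}-th root of unity. Then the 2-class group of L_n is cyclic of order 2^{n+m−1}, i.e. isomorphic to ℤ/2^{n+m−1}ℤ. -/

import Mathlib

/-- The class number of a subfield `K` of `ℂ` (the cardinality of the class
group of its ring of integers). -/
noncomputable def classNum (K : IntermediateField ℚ ℂ) : ℕ :=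
  Nat.card (ClassGroup (integralClosure ℤ K))

/-- The 2-class number of a subfield `K` of `ℂ`: the largest power of `2`
dividing its class number. -/
noncomputable def twoClassNum (K : IntermediateField ℚ ℂ) : ℕ :=
  2 ^ ((classNum K).factorization 2)

/-- The 2-class group of a subfield `K` of `ℂ` (i.e. the 2-Sylow subgroup of
the class group of its ring of integers) is cyclic of order `N`. -/
def TwoClassGroupIsCyclicOfOrder (K : IntermediateField ℚ ℂ) (N : ℕ) : Prop :=
  ∀ P : Sylow 2 (ClassGroup (integralClosure ℤ K)),
    Nonempty (P ≃* Multiplicative (ZMod N))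

set_option linter.unusedSectionVars false

section

/-- Every ideal of `R` whose square is principal is itself principal. -/
def SquarePrincipal (R : Type*) [CommRing R] : Prop :=
  ∀ (I : Ideal R) (x : R), I ^ 2 = Ideal.span {x} → ∃ y, I = Ideal.span {y}

/-- A quadratic extension of domains `f : R → S` with involution `g`, étale and with `2` invertible:
`R` is the fixed ring of `g`, and the differences `y - g y` generate the unit ideal. -/
structure QuadraticEtale {R S : Type*} [CommRing R] [CommRing S] (f : R →+* S) (g : S →+* S) :
    Prop where
  inj : Function.Injective f
  invol : ∀ x, g (g x) = x
  fixed : ∀ r, g (f r) = f r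
  descend : ∀ x, g x = x → ∃ r, f r = x
  etale : ∃ y₁ y₂ r₁ r₂ : S, r₁ * (y₁ - g y₁) + r₂ * (y₂ - g y₂) = 1
  two_unit : ∃ h : R, 2 * h = 1

namespace QuadraticEtale

variable {R S : Type*} [CommRing R] [IsDomain R] [CommRing S] [IsDomain S]
  {f : R →+* S} {g : S →+* S}

theorem exists_trace (H : QuadraticEtale f g) (x : S) : ∃ r, f r = x + g x :=
  H.descend _ (by rw [map_add, H.invol, add_comm])

theorem exists_norm (H : QuadraticEtale f g) (x : S) : ∃ r, f r = x * g x :=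
  H.descend _ (by rw [map_mul, H.invol, mul_comm])

theorem exists_sub_ne_zero (H : QuadraticEtale f g) : ∃ w, w - g w ≠ 0 := by
  obtain ⟨y₁, y₂, r₁, r₂, h⟩ := H.etale
  by_contra! hc
  simp [hc] at h

theorem map_comap_of_invariant (H : QuadraticEtale f g) (I : Ideal S)
    (hI : ∀ x ∈ I, g x ∈ I) : (I.comap f).map f = I := by
  refine le_antisymm Ideal.map_comap_le fun x hx => ?_
  obtain ⟨y₁, y₂, r₁, r₂, h⟩ := H.etale
  have tr : ∀ y ∈ I, y + g y ∈ (I.comap f).map f := fun y hy => by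
    obtain ⟨r, hr⟩ := H.exists_trace y
    rw [← hr]
    refine Ideal.mem_map_of_mem f ?_
    rw [Ideal.mem_comap, hr]
    exact I.add_mem hy (hI y hy)
  have key : ∀ y, x * (y - g y) ∈ (I.comap f).map f := fun y => by
    have e : x * (y - g y) = (x * y + g (x * y)) - g y * (x + g x) := by
      rw [map_mul]; ring
    rw [e]
    exact Ideal.sub_mem _ (tr _ (I.mul_mem_right _ hx)) (Ideal.mul_mem_left _ _ (tr _ hx))
  have e : x = r₁ * (x * (y₁ - g y₁)) + r₂ * (x * (y₂ - g y₂)) := by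
    linear_combination (-x) * h
  rw [e]
  exact Ideal.add_mem _ (Ideal.mul_mem_left _ _ (key _)) (Ideal.mul_mem_left _ _ (key _))

theorem comap_map (H : QuadraticEtale f g) (I : Ideal R) : (I.map f).comap f = I := by
  refine le_antisymm (fun r hr => ?_) Ideal.le_comap_map
  have key : ∀ x ∈ I.map f, ∀ y, ∃ d ∈ I, f d = y * x + g (y * x) := fun x hx => by
    refine Submodule.span_induction (p := fun x _ => ∀ y, ∃ d ∈ I, f d = y * x + g (y * x))
      ?_ ?_ ?_ ?_ hx
    · rintro _ ⟨d, hd, rfl⟩ y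
      obtain ⟨t, ht⟩ := H.exists_trace y
      exact ⟨t * d, I.mul_mem_left _ hd, by rw [map_mul, map_mul, H.fixed, ht]; ring⟩
    · exact fun y => ⟨0, I.zero_mem, by simp⟩
    · rintro a b _ _ ha hb y
      obtain ⟨d, hd, h⟩ := ha y
      obtain ⟨e, he, h'⟩ := hb y
      exact ⟨d + e, I.add_mem hd he, by rw [map_add, h, h', mul_add, map_add]; ring⟩
    · rintro a b _ hb y
      simpa [mul_assoc] using hb (y * a)
  obtain ⟨d, hd, h⟩ := key _ hr 1
  obtain ⟨t, ht⟩ := H.two_unit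
  have : r = t * d := by
    apply H.inj
    have ht' : (2 : S) * f t = 1 := by simpa only [map_mul, map_ofNat, map_one] using congrArg f ht
    rw [map_mul, h, one_mul, H.fixed]
    linear_combination (-f r) * ht'
  exact this ▸ I.mul_mem_left _ hd

theorem eq_span_of_map_eq_span (H : QuadraticEtale f g) (I : Ideal R) (r : R)
    (h : I.map f = Ideal.span {f r}) : I = Ideal.span {r} := by
  rw [← H.comap_map I, h, ← H.comap_map (Ideal.span {r}), Ideal.map_span, Set.image_singleton]

theorem exists_unit_of_norm_eq_one (H : QuadraticEtale f g) (hR : SquarePrincipal R) (y : S)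
    (hy : y * g y = 1) : ∃ e, IsUnit e ∧ y * g e = e := by
  obtain ⟨z, hz0, hz⟩ : ∃ z, z ≠ 0 ∧ y * g z = z := by
    by_cases h1 : 1 + y = 0
    · obtain ⟨w, hw⟩ := H.exists_sub_ne_zero
      refine ⟨w - g w, hw, ?_⟩
      rw [map_sub, H.invol]
      linear_combination (g w - w) * h1
    · refine ⟨1 + y, h1, ?_⟩
      rw [map_add, map_one]
      linear_combination hy
  have hgz : g z = g y * z := by linear_combination (-g z) * hy + g y * hz
  have hinv : ∀ x ∈ Ideal.span {z}, g x ∈ Ideal.span {z} := by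
    intro x hx
    obtain ⟨a, rfl⟩ := Ideal.mem_span_singleton'.1 hx
    exact Ideal.mem_span_singleton'.2 ⟨g a * g y, by rw [map_mul, hgz]; ring⟩
  set I := (Ideal.span {z}).comap f with hI
  have hIm : I.map f = Ideal.span {z} := H.map_comap_of_invariant _ hinv
  obtain ⟨t, ht⟩ := H.exists_norm z
  have hsq : I ^ 2 = Ideal.span {t} := by
    apply H.eq_span_of_map_eq_span
    rw [Ideal.map_pow, hIm, Ideal.span_singleton_pow, Ideal.span_singleton_eq_span_singleton, ht]
    refine ⟨⟨g y, y, by rw [mul_comm]; exact hy, hy⟩, ?_⟩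
    rw [hgz, sq]; simp only [Units.val_mk]; ring
  obtain ⟨c, hc⟩ := hR I t hsq
  have hzc : Ideal.span {f c} = Ideal.span {z} := by
    rw [← hIm, hc, Ideal.map_span, Set.image_singleton]
  obtain ⟨e, he⟩ := Ideal.span_singleton_eq_span_singleton.1 hzc
  refine ⟨e, e.isUnit, ?_⟩
  have hfc : f c ≠ 0 := by
    rintro h0
    rw [h0, zero_mul] at he
    exact hz0 he.symm
  apply mul_left_cancel₀ hfc
  rw [← he, map_mul, H.fixed] at hz
  linear_combination hz

theorem squarePrincipal (H : QuadraticEtale f g) (hR : SquarePrincipal R)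
    (hN : ∀ (u : R) (s : S) (t : R), IsUnit u → t ≠ 0 → s * g s = f (u * t ^ 2) →
      ∃ e, e * g e = f u) : SquarePrincipal S := by
  intro I s hs
  by_cases hs0 : s = 0
  · refine ⟨0, ?_⟩
    rw [hs0, Ideal.span_singleton_eq_bot.2 rfl, sq] at hs
    rw [Ideal.span_singleton_eq_bot.2 rfl]
    exact (mul_self_eq_zero (M₀ := Ideal S)).1 hs
  have ginj : Function.Injective g := fun a b h => by rw [← H.invol a, h, H.invol]
  have mapmap : ∀ A : Ideal S, (A.map g).map g = A := fun A => by
    rw [Ideal.map_map]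
    convert Ideal.map_id A
    exact RingHom.ext H.invol
  have inv_of : ∀ A : Ideal S, A.map g = A → ∃ B : Ideal R, B.map f = A := fun A hA =>
    ⟨_, H.map_comap_of_invariant A fun x hx => by
      rw [← hA]; exact Ideal.mem_map_of_mem g hx⟩
  obtain ⟨B, hB⟩ := inv_of (I * I.map g) (by rw [Ideal.map_mul, mapmap, mul_comm])
  obtain ⟨n, hn⟩ := H.exists_norm s
  have hgs : (I.map g) ^ 2 = Ideal.span {g s} := by
    rw [← Ideal.map_pow, hs, Ideal.map_span, Set.image_singleton]
  have hB2 : B ^ 2 = Ideal.span {n} := by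
    apply H.eq_span_of_map_eq_span
    rw [Ideal.map_pow, hB, mul_pow, hs, hgs, Ideal.span_singleton_mul_span_singleton, hn]
  obtain ⟨t, ht⟩ := hR B n hB2
  rw [ht, Ideal.span_singleton_pow, Ideal.span_singleton_eq_span_singleton] at hB2
  obtain ⟨u, hu⟩ := hB2
  have hn0 : n ≠ 0 := by
    rintro rfl
    rw [map_zero] at hn
    rcases mul_eq_zero.1 hn.symm with h | h
    · exact hs0 h
    · exact hs0 (ginj (by rw [h, map_zero]))
  have ht0 : t ≠ 0 := by rintro rfl; apply hn0; rw [← hu]; ring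
  obtain ⟨e, he⟩ := hN u s t u.isUnit ht0 (by rw [← hn, ← hu, mul_comm])
  have heu : IsUnit e := isUnit_of_mul_isUnit_left (y := g e) (by rw [he]; exact u.isUnit.map f)
  obtain ⟨e, rfl⟩ := heu
  -- normalise the generator so that its norm is `t ^ 2`
  obtain ⟨s', hs's⟩ : ∃ s', s = s' * e := ⟨s * ↑e⁻¹, by rw [mul_assoc, Units.inv_mul, mul_one]⟩
  have hs'2 : I ^ 2 = Ideal.span {s'} := by
    rw [hs, hs's, Ideal.span_singleton_mul_right_unit e.isUnit]
  have hs'N : s' * g s' = f t ^ 2 := by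
    have hfu : f (u : R) ≠ 0 := (u.isUnit.map f).ne_zero
    apply mul_right_cancel₀ hfu
    rw [← map_pow, ← map_mul, hu, hn, hs's, map_mul, ← he]; ring
  have hs'0 : s' ≠ 0 := by rintro rfl; exact hs0 (by rw [hs's, zero_mul])
  obtain ⟨z, hz0, hz⟩ : ∃ z, z ≠ 0 ∧ s' * g z = f t * z := by
    by_cases h1 : f t + s' = 0
    · obtain ⟨w, hw⟩ := H.exists_sub_ne_zero
      refine ⟨w - g w, hw, ?_⟩
      rw [map_sub, H.invol]
      linear_combination (g w - w) * h1
    · refine ⟨f t + s', h1, ?_⟩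
      rw [map_add, H.fixed]
      linear_combination hs'N
  have hII : I * I.map g = Ideal.span {f t} := by
    rw [← hB, ht, Ideal.map_span, Set.image_singleton]
  have hJ : (Ideal.span {g z} * I).map g = Ideal.span {g z} * I := by
    rw [Ideal.map_mul, Ideal.map_span, Set.image_singleton, H.invol]
    apply (Ideal.span_singleton_mul_right_inj hs'0).1
    calc Ideal.span {s'} * (Ideal.span {z} * I.map g)
        = Ideal.span {z} * (I * (I * I.map g)) := by rw [← hs'2]; ring
      _ = (Ideal.span {f t} * Ideal.span {z}) * I := by rw [hII]; ring
      _ = (Ideal.span {s'} * Ideal.span {g z}) * I := by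
        rw [Ideal.span_singleton_mul_span_singleton, Ideal.span_singleton_mul_span_singleton, hz]
      _ = _ := by ring
  obtain ⟨C, hC⟩ := inv_of _ hJ
  obtain ⟨k, hk⟩ := H.exists_norm z
  have hC2 : C ^ 2 = Ideal.span {t * k} := by
    apply H.eq_span_of_map_eq_span
    rw [Ideal.map_pow, hC, mul_pow, hs'2, Ideal.span_singleton_pow,
      Ideal.span_singleton_mul_span_singleton, map_mul, hk]
    congr 2
    linear_combination g z * hz
  obtain ⟨c, hc⟩ := hR C _ hC2
  have hgz0 : g z ≠ 0 := fun h => hz0 (ginj (by rw [h, map_zero]))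
  rw [hc, Ideal.map_span, Set.image_singleton] at hC
  obtain ⟨a, ha, hac⟩ := Ideal.mem_span_singleton_mul.1
    (hC ▸ Ideal.mem_span_singleton_self (f c) : f c ∈ Ideal.span {g z} * I)
  refine ⟨a, (Ideal.span_singleton_mul_right_inj hgz0).1 ?_⟩
  rw [← hC, Ideal.span_singleton_mul_span_singleton, hac]

end QuadraticEtale

end

section

theorem index_range_two_of_finite (T : Type*) [AddCommGroup T] [Finite T] :
    (nsmulAddMonoidHom 2 : T →+ T).range.index = Nat.card (nsmulAddMonoidHom 2 : T →+ T).ker := by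
  have h1 := AddSubgroup.index_mul_card (nsmulAddMonoidHom 2 : T →+ T).range
  have h2 := AddSubgroup.index_mul_card (nsmulAddMonoidHom 2 : T →+ T).ker
  rw [AddSubgroup.index_ker, mul_comm, ← h1] at h2
  exact (Nat.eq_of_mul_eq_mul_right Nat.card_pos h2).symm

theorem index_range_two_prod (n : ℕ) (T : Type*) [AddCommGroup T] [Finite T] :
    (nsmulAddMonoidHom 2 : (Fin n →₀ ℤ) × T →+ _).range.index =
      2 ^ n * Nat.card (nsmulAddMonoidHom 2 : (Fin n →₀ ℤ) × T →+ _).ker := by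
  have hk : Nat.card (nsmulAddMonoidHom 2 : (Fin n →₀ ℤ) × T →+ _).ker =
      Nat.card (nsmulAddMonoidHom 2 : T →+ T).ker := by
    refine Nat.card_congr ⟨fun x => ⟨x.1.2, congrArg Prod.snd x.2⟩,
      fun x => ⟨(0, x.1), Prod.ext (by simp) x.2⟩, fun x => ?_, fun x => rfl⟩
    ext1
    refine Prod.ext ?_ rfl
    have h : 2 • x.1.1 = 0 := congrArg Prod.fst x.2
    exact ((smul_eq_zero_iff_right two_ne_zero).1 h).symm
  rw [hk, ← index_range_two_of_finite]
  have hr : (nsmulAddMonoidHom 2 : (Fin n →₀ ℤ) × T →+ _).range =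
      (nsmulAddMonoidHom 2 : (Fin n →₀ ℤ) →+ _).range.prod
        (nsmulAddMonoidHom 2 : T →+ _).range := by
    ext ⟨x, y⟩
    constructor
    · rintro ⟨⟨a, b⟩, h⟩
      exact ⟨⟨a, congrArg Prod.fst h⟩, ⟨b, congrArg Prod.snd h⟩⟩
    · rintro ⟨⟨a, h⟩, ⟨b, h'⟩⟩
      exact ⟨(a, b), Prod.ext h h'⟩
  rw [hr, AddSubgroup.index_prod]
  congr 1
  let φ : (Fin n →₀ ℤ) →+ (Fin n → ZMod 2) :=
    { toFun := fun v i => (v i : ZMod 2)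
      map_zero' := by ext; simp
      map_add' := fun a b => by ext; simp }
  have hφ : (nsmulAddMonoidHom 2 : (Fin n →₀ ℤ) →+ _).range = φ.ker := by
    ext v
    constructor
    · rintro ⟨a, rfl⟩
      rw [AddMonoidHom.mem_ker]
      ext i
      have : ((2 : ℕ) : ZMod 2) = 0 := rfl
      simp only [nsmulAddMonoidHom_apply, φ, AddMonoidHom.coe_mk, ZeroHom.coe_mk,
        Finsupp.smul_apply, Pi.zero_apply, nsmul_eq_mul, Int.cast_mul, Int.cast_natCast, this,
        zero_mul]
    · intro h
      have h' : ∀ i, (2 : ℤ) ∣ v i := fun i =>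
        (ZMod.intCast_zmod_eq_zero_iff_dvd (v i) 2).1 (congrFun h i)
      choose w hw using h'
      refine ⟨Finsupp.equivFunOnFinite.symm w, ?_⟩
      ext i
      simp [hw i]
  have hs : Function.Surjective φ := fun v => by
    refine ⟨Finsupp.equivFunOnFinite.symm fun i => (v i).val, ?_⟩
    ext i
    simp [φ]
  rw [hφ, AddSubgroup.index_ker, AddMonoidHom.range_eq_top.2 hs]
  simp

theorem index_range_two (A : Type*) [AddCommGroup A] [Module.Finite ℤ A] :
    (nsmulAddMonoidHom 2 : A →+ A).range.index =
      2 ^ Module.finrank ℤ A * Nat.card (nsmulAddMonoidHom 2 : A →+ A).ker := by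
  have : AddGroup.FG A := Module.Finite.iff_addGroup_fg.1 inferInstance
  obtain ⟨n, ι, _, p, hp, e, ⟨f⟩⟩ := AddCommGroup.equiv_free_prod_directSum_zmod A
  have : ∀ i, NeZero (p i ^ e i) := fun i => ⟨pow_ne_zero _ (hp i).ne_zero⟩
  have : Finite (DirectSum ι fun i => ZMod (p i ^ e i)) := by
    classical exact Finite.of_equiv _ (DirectSum.addEquivProd fun i => ZMod (p i ^ e i)).symm.toEquiv
  have h := index_range_two_prod n (DirectSum ι fun i => ZMod (p i ^ e i))
  have hn : Module.finrank ℤ A = n := by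
    let ψ : A →ₗ[ℤ] (Fin n →₀ ℤ) :=
      ((AddMonoidHom.fst _ _).comp f.toAddMonoidHom).toIntLinearMap
    have hψ : Function.Surjective ψ := fun v => ⟨f.symm (v, 0), by simp [ψ]⟩
    have hle : LinearMap.ker ψ ≤ Submodule.torsion ℤ A := fun x hx => by
      obtain ⟨k, hk, hk0⟩ := isOfFinAddOrder_iff_nsmul_eq_zero.1
        (isOfFinAddOrder_of_finite (f x).2)
      refine (Submodule.mem_torsion_iff x).2
        ⟨⟨(k : ℤ), mem_nonZeroDivisors_of_ne_zero (by exact_mod_cast hk.ne')⟩, f.injective ?_⟩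
      have hx1 : (f x).1 = 0 := hx
      change f ((k : ℤ) • x) = f 0
      rw [natCast_zsmul, map_nsmul, map_zero]
      exact Prod.ext (by rw [Prod.smul_fst, hx1, smul_zero]; rfl) hk0
    rw [← finrank_quotient_eq_of_le_torsion hle,
      (ψ.quotKerEquivOfSurjective hψ).finrank_eq, Module.finrank_finsupp_self, Fintype.card_fin]
  have hc : Nat.card (nsmulAddMonoidHom 2 : A →+ A).ker = Nat.card
      (nsmulAddMonoidHom 2 :
        ((Fin n →₀ ℤ) × DirectSum ι fun i => ZMod (p i ^ e i)) →+ _).ker := by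
    refine Nat.card_congr (f.toEquiv.subtypeEquiv fun x => ?_)
    change 2 • x = 0 ↔ 2 • f x = 0
    rw [← map_nsmul, map_eq_zero_iff f f.injective]
  have hr : (nsmulAddMonoidHom 2 : A →+ A).range = ((nsmulAddMonoidHom 2 :
        ((Fin n →₀ ℤ) × DirectSum ι fun i => ZMod (p i ^ e i)) →+ _).range).comap
        (f : A →+ _) := by
    ext x
    constructor
    · rintro ⟨a, rfl⟩
      exact ⟨f a, (map_nsmul f 2 a).symm⟩
    · rintro ⟨b, hb⟩
      refine ⟨f.symm b, f.injective ?_⟩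
      rw [← show _ = f x from hb]
      simp
  rw [hr, AddSubgroup.index_comap_of_surjective _ f.surjective, h, hn, hc]

/-- Norm index bound: for an involution `g` on a finitely generated abelian group with trivial
`H¹`, a rank inequality between the invariants and the anti-invariants, and a unique element of
order two, the norms have index at most two among the invariants. -/
theorem norm_or_norm_of_rank_le {A : Type*} [AddCommGroup A] [Module.Finite ℤ A] (g : A →+ A)
    (hg : ∀ x, g (g x) = x) (hH : ∀ x, x + g x = 0 → ∃ e, x + g e = e)
    (a₀ a₁ : Submodule ℤ A) (ha₀ : ∀ x, x ∈ a₀ ↔ g x = x) (ha₁ : ∀ x, x ∈ a₁ ↔ x + g x = 0)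
    (hr : Module.finrank ℤ a₀ ≤ Module.finrank ℤ a₁ + 1)
    (ε : A) (hε0 : ε ≠ 0) (hε : ∀ x, 2 • x = 0 ↔ x = 0 ∨ x = ε) (hgε : g ε = ε)
    (u₀ : A) (hu₀ : g u₀ = u₀) (hu₀n : ∀ e, e + g e ≠ u₀) (u : A) (hu : g u = u) :
    ∃ e, e + g e = u ∨ e + g e = u + u₀ := by
  let D : AddSubgroup A → AddSubgroup A := fun B => B.map (nsmulAddMonoidHom 2)
  let P : A →+ A := AddMonoidHom.id A + g
  let Q : A →+ A := AddMonoidHom.id A - g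
  have hP : ∀ x, P x = x + g x := fun x => rfl
  have hQ : ∀ x, Q x = x - g x := fun x => rfl
  have mem_D : ∀ B x, x ∈ D B ↔ ∃ b ∈ B, 2 • b = x := fun B x => Iff.rfl
  have gP : ∀ x, g (P x) = P x := fun x => by rw [hP, map_add, hg, add_comm]
  set b₀ := a₀.toAddSubgroup with hb₀
  set b₁ := a₁.toAddSubgroup with hb₁
  have mem₀ : ∀ x, x ∈ b₀ ↔ g x = x := ha₀
  have mem₁ : ∀ x, x ∈ b₁ ↔ x + g x = 0 := ha₁
  have hQr : Q.range = b₁ := by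
    ext x
    rw [mem₁]
    constructor
    · rintro ⟨e, rfl⟩
      rw [hQ, map_sub, hg]; abel
    · intro hx
      obtain ⟨e, he⟩ := hH x hx
      exact ⟨e, by rw [hQ]; nth_rewrite 1 [← he]; abel⟩
  have hcP : (D b₀).comap P = b₀ ⊔ b₁ := by
    ext x
    rw [AddSubgroup.mem_comap, mem_D, AddSubgroup.mem_sup]
    constructor
    · rintro ⟨b, hb, h⟩
      refine ⟨b, hb, x - b, ?_, by abel⟩
      rw [mem₀] at hb
      rw [mem₁, map_sub, hb]
      rw [hP, two_nsmul] at h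
      rw [show x - b + (g x - b) = (x + g x) - (b + b) by abel, h, sub_self]
    · rintro ⟨b, hb, c, hc, rfl⟩
      refine ⟨b, hb, ?_⟩
      rw [mem₀] at hb
      rw [mem₁] at hc
      rw [hP, map_add, hb, two_nsmul, show b + c + (b + g c) = b + b + (c + g c) by abel, hc,
        add_zero]
  have hcQ : (D b₁).comap Q = b₀ ⊔ b₁ := by
    ext x
    rw [AddSubgroup.mem_comap, mem_D, AddSubgroup.mem_sup]
    constructor
    · rintro ⟨b, hb, h⟩
      refine ⟨x - b, ?_, b, hb, by abel⟩
      rw [mem₁] at hb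
      rw [mem₀, map_sub, eq_neg_of_add_eq_zero_right hb]
      rw [hQ, two_nsmul] at h
      rw [eq_sub_iff_add_eq, sub_neg_eq_add, add_assoc, h]; abel
    · rintro ⟨b, hb, c, hc, rfl⟩
      refine ⟨c, hc, ?_⟩
      rw [mem₀] at hb
      rw [mem₁] at hc
      rw [hQ, map_add, hb, eq_neg_of_add_eq_zero_right hc, two_nsmul]; abel
  have hle1 : D b₀ ≤ P.range := by
    rintro _ ⟨b, hb, rfl⟩
    exact ⟨b, by rw [hP, (mem₀ b).1 hb]; exact (two_nsmul b).symm⟩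
  have hle2 : P.range ≤ b₀ := by
    rintro _ ⟨b, rfl⟩
    exact (mem₀ _).2 (gP b)
  have hmul := AddSubgroup.relIndex_mul_relIndex _ _ _ hle1 hle2
  have e1 : (D b₀).relIndex P.range = (D b₁).relIndex b₁ := by
    rw [← AddSubgroup.index_comap, hcP, ← hcQ, AddSubgroup.index_comap, hQr]
  have card2 : ∀ (B : Submodule ℤ A), ε ∈ B →
      (D B.toAddSubgroup).relIndex B.toAddSubgroup = 2 ^ (Module.finrank ℤ B + 1) := by
    intro B hB
    have h1 : (D B.toAddSubgroup).relIndex B.toAddSubgroup =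
        (nsmulAddMonoidHom 2 : B →+ B).range.index := by
      rw [AddSubgroup.relIndex]
      congr 1
      ext ⟨x, hx⟩
      rw [AddSubgroup.mem_addSubgroupOf, mem_D]
      constructor
      · rintro ⟨b, hb, h⟩
        exact ⟨⟨b, hb⟩, Subtype.ext h⟩
      · rintro ⟨⟨b, hb⟩, h⟩
        exact ⟨b, hb, congrArg Subtype.val h⟩
    have h2 : Nat.card (nsmulAddMonoidHom 2 : B →+ B).ker = 2 := by
      rw [Nat.card_eq_two_iff]
      refine ⟨0, ⟨⟨ε, hB⟩, Subtype.ext ((hε ε).2 (Or.inr rfl))⟩, ?_, ?_⟩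
      · intro h
        exact hε0 (congrArg Subtype.val (congrArg Subtype.val h)).symm
      · refine Set.eq_univ_of_forall ?_
        rintro ⟨⟨x, hx⟩, h⟩
        rcases (hε x).1 (congrArg Subtype.val h) with rfl | rfl
        · exact Or.inl rfl
        · exact Or.inr rfl
    rw [h1, index_range_two, h2, pow_succ]
  rw [e1, card2 a₁ ((mem₁ ε).2 (by rw [hgε, ← two_nsmul]; exact (hε ε).2 (Or.inr rfl))),
    card2 a₀ ((mem₀ ε).2 hgε)] at hmul
  have hidx : P.range.relIndex b₀ ≤ 2 := by
    have h1 : 2 ^ (Module.finrank ℤ a₁ + 1) * P.range.relIndex b₀ ≤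
        2 ^ (Module.finrank ℤ a₁ + 1) * 2 := by
      rw [hmul, ← pow_succ]
      exact Nat.pow_le_pow_right two_pos (by omega)
    exact Nat.le_of_mul_le_mul_left h1 (by positivity)
  have hidx0 : P.range.relIndex b₀ ≠ 0 := by
    rintro h
    rw [h, mul_zero] at hmul
    exact (pow_ne_zero _ two_ne_zero) hmul.symm
  by_contra! hc
  have : (P.range.addSubgroupOf b₀).FiniteIndex := ⟨hidx0⟩
  have hcard : Nat.card (b₀ ⧸ P.range.addSubgroupOf b₀) ≤ 2 := hidx
  obtain ⟨x, y, hx, hy, hxy⟩ : ∃ x y : b₀ ⧸ P.range.addSubgroupOf b₀, x ≠ 0 ∧ y ≠ 0 ∧ y ≠ x := by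
    have n1 : (QuotientAddGroup.mk ⟨u, (mem₀ _).2 hu⟩ : b₀ ⧸ P.range.addSubgroupOf b₀) ≠ 0 := by
      rw [Ne, QuotientAddGroup.eq_zero_iff]
      rintro ⟨e, he⟩
      exact (hc e).1 he
    have n2 : (QuotientAddGroup.mk (-⟨u₀, (mem₀ _).2 hu₀⟩) :
        b₀ ⧸ P.range.addSubgroupOf b₀) ≠ 0 := by
      rw [Ne, QuotientAddGroup.eq_zero_iff, AddSubgroup.neg_mem_iff]
      rintro ⟨e, he⟩
      exact hu₀n e he
    have n3 : (QuotientAddGroup.mk (-⟨u₀, (mem₀ _).2 hu₀⟩) :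
        b₀ ⧸ P.range.addSubgroupOf b₀) ≠ QuotientAddGroup.mk ⟨u, (mem₀ _).2 hu⟩ := by
      rw [Ne, QuotientAddGroup.eq, neg_neg]
      rintro ⟨e, he⟩
      exact (hc e).2 (he.trans (add_comm _ _))
    exact ⟨_, _, n1, n2, n3⟩
  have h3 : ({0, x, y} : Set (b₀ ⧸ P.range.addSubgroupOf b₀)).ncard = 3 := by
    rw [Set.ncard_eq_three]
    exact ⟨0, x, y, hx.symm, hy.symm, hxy.symm, rfl⟩
  have h4 := Set.ncard_le_card ({0, x, y} : Set (b₀ ⧸ P.range.addSubgroupOf b₀))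
  omega

end

section

open NumberField IsDedekindDomain

section TwoIntegers

variable {L : Type*} [Field L] [NumberField L]

/-- The ring of `2`-integers of a subfield `K` of `L`. -/
def twoIntegers (K : IntermediateField ℚ L) : Subring L where
  carrier := {x | x ∈ K ∧ ∃ N : ℕ, IsIntegral ℤ (2 ^ N * x)}
  zero_mem' := ⟨K.zero_mem, 0, by simpa using isIntegral_zero⟩
  one_mem' := ⟨K.one_mem, 0, by simpa using isIntegral_one⟩
  add_mem' := by
    rintro x y ⟨hx, N, hN⟩ ⟨hy, M, hM⟩
    refine ⟨K.add_mem hx hy, N + M, ?_⟩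
    have h2 : IsIntegral ℤ (2 : L) := by simpa using (isIntegral_algebraMap (R := ℤ) (A := L) (x := 2))
    have := ((h2.pow M).mul hN).add ((h2.pow N).mul hM)
    rwa [show (2 : L) ^ M * (2 ^ N * x) + 2 ^ N * (2 ^ M * y) = 2 ^ (N + M) * (x + y) by ring] at this
  mul_mem' := by
    rintro x y ⟨hx, N, hN⟩ ⟨hy, M, hM⟩
    refine ⟨K.mul_mem hx hy, N + M, ?_⟩
    rw [show (2 : L) ^ (N + M) * (x * y) = 2 ^ N * x * (2 ^ M * y) by ring]
    exact hN.mul hM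
  neg_mem' := by
    rintro x ⟨hx, N, hN⟩
    exact ⟨K.neg_mem hx, N, by simpa using hN.neg⟩

/-- The integral elements of a subfield `K` of `L`. -/
def integersIn (K : IntermediateField ℚ L) : Subring L where
  carrier := {x | x ∈ K ∧ IsIntegral ℤ x}
  zero_mem' := ⟨K.zero_mem, isIntegral_zero⟩
  one_mem' := ⟨K.one_mem, isIntegral_one⟩
  add_mem' := fun hx hy => ⟨K.add_mem hx.1 hy.1, hx.2.add hy.2⟩
  mul_mem' := fun hx hy => ⟨K.mul_mem hx.1 hy.1, hx.2.mul hy.2⟩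
  neg_mem' := fun hx => ⟨K.neg_mem hx.1, hx.2.neg⟩

theorem mem_twoIntegers_of_isIntegral {K : IntermediateField ℚ L} {x : L} (hx : x ∈ K)
    (h : IsIntegral ℤ x) : x ∈ twoIntegers K := ⟨hx, 0, by simpa using h⟩

theorem isIntegral_two : IsIntegral ℤ (2 : L) := by
  simpa using (isIntegral_algebraMap (R := ℤ) (A := L) (x := 2))

theorem inv_two_mem_twoIntegers (K : IntermediateField ℚ L) : (2 : L)⁻¹ ∈ twoIntegers K :=
  ⟨K.inv_mem (ofNat_mem K 2), 1, by simpa using isIntegral_one⟩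

theorem twoIntegers_mono {K M : IntermediateField ℚ L} (h : K ≤ M) :
    twoIntegers K ≤ twoIntegers M := fun _ hx => ⟨h hx.1, hx.2⟩

theorem map_mem_twoIntegers {M : IntermediateField ℚ L} (g : L ≃ₐ[ℚ] L) {x : L}
    (hg : g x ∈ M) (hx : x ∈ twoIntegers M) : g x ∈ twoIntegers M := by
  obtain ⟨-, N, hN⟩ := hx
  refine ⟨hg, N, ?_⟩
  have := hN.map (g.toAlgHom.restrictScalars ℤ)
  rw [map_mul, map_pow, map_ofNat] at this
  exact this

/-- The units of a subring of `L`, as an additive group. -/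
def unitsIn (R : Subring L) : Submodule ℤ (Additive Lˣ) :=
  AddSubgroup.toIntSubmodule R.toSubmonoid.units.toAddSubgroup

theorem mem_unitsIn {R : Subring L} {x : Additive Lˣ} :
    x ∈ unitsIn R ↔ (x.toMul : L) ∈ R ∧ (x.toMul : L)⁻¹ ∈ R := by
  rw [← Units.val_inv_eq_inv_val]
  exact Submonoid.mem_units_iff R.toSubmonoid x.toMul

/-- The inclusion of the units of `𝓞 K` in the multiplicative group of `L`. -/
def unitsInclusion (K : IntermediateField ℚ L) : Additive (𝓞 K)ˣ →ₗ[ℤ] Additive Lˣ :=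
  (Units.map (algebraMap (𝓞 K) L : 𝓞 K →* L)).toAdditive.toIntLinearMap

theorem unitsInclusion_injective (K : IntermediateField ℚ L) :
    Function.Injective (unitsInclusion K) := by
  intro x y h
  have h' : (algebraMap (𝓞 K) L) (x.toMul : 𝓞 K) = algebraMap (𝓞 K) L (y.toMul : 𝓞 K) :=
    congrArg (fun z : Additive Lˣ => (z.toMul : L)) h
  exact Additive.toMul.injective (Units.ext (FaithfulSMul.algebraMap_injective (𝓞 K) L h'))

theorem range_unitsInclusion (K : IntermediateField ℚ L) :
    LinearMap.range (unitsInclusion K) = unitsIn (integersIn K) := by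
  ext x
  rw [mem_unitsIn]
  have h_int : ∀ y : 𝓞 K, (algebraMap (𝓞 K) L) y ∈ integersIn K := fun y =>
    ⟨(y : K).2, (RingOfIntegers.isIntegral_coe y).map (K.val.restrictScalars ℤ)⟩
  constructor
  · rintro ⟨y, rfl⟩
    refine ⟨h_int _, ?_⟩
    rw [← Units.val_inv_eq_inv_val]
    exact h_int ((y.toMul⁻¹ : (𝓞 K)ˣ) : 𝓞 K)
  · rintro ⟨⟨h1, h1'⟩, h2, h2'⟩
    have lift : ∀ z : L, ∀ hz : z ∈ K, IsIntegral ℤ z → IsIntegral ℤ (⟨z, hz⟩ : K) :=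
      fun z hz h => (isIntegral_algHom_iff (K.val.restrictScalars ℤ) K.val.injective).1 h
    refine ⟨Additive.ofMul ⟨⟨⟨_, h1⟩, lift _ h1 h1'⟩, ⟨⟨_, h2⟩, lift _ h2 h2'⟩, ?_, ?_⟩, ?_⟩
    · apply RingOfIntegers.ext
      exact Subtype.ext (mul_inv_cancel₀ x.toMul.ne_zero)
    · apply RingOfIntegers.ext
      exact Subtype.ext (inv_mul_cancel₀ x.toMul.ne_zero)
    · exact Additive.toMul.injective (Units.ext rfl)

theorem finite_unitsIn_integersIn (K : IntermediateField ℚ L) :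
    Module.Finite ℤ (unitsIn (integersIn K)) := by
  rw [← range_unitsInclusion]; infer_instance

theorem finrank_unitsIn_integersIn (K : IntermediateField ℚ L) :
    Module.finrank ℤ (unitsIn (integersIn K)) = Units.rank K := by
  rw [← range_unitsInclusion, ← NumberField.Units.finrank_eq]
  exact LinearMap.finrank_range_of_inj (unitsInclusion_injective K)

/-- The (negative of the) order at a finite place, as a homomorphism. -/
noncomputable def negOrd (v : HeightOneSpectrum (𝓞 L)) : Additive Lˣ →+ ℤ :=
  (HeightOneSpectrum.valuationOfNeZero (K := L) v).toAdditive

theorem negOrd_eq_zero {v : HeightOneSpectrum (𝓞 L)} {x : Additive Lˣ} :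
    negOrd v x = 0 ↔ v.valuation L (x.toMul : L) = 1 := by
  rw [← HeightOneSpectrum.valuationOfNeZero_eq, ← WithZero.coe_one, WithZero.coe_inj]
  exact Iff.rfl

theorem valuation_le_one_of_isIntegral (v : HeightOneSpectrum (𝓞 L)) {x : L}
    (hx : IsIntegral ℤ x) : v.valuation L x ≤ 1 :=
  v.valuation_le_one (K := L) (⟨x, hx⟩ : 𝓞 L)

theorem valuation_lt_one_iff_mem' (v : HeightOneSpectrum (𝓞 L)) (x : 𝓞 L) :
    v.valuation L (x : L) < 1 ↔ x ∈ v.asIdeal :=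
  v.valuation_lt_one_iff_mem (K := L) x

theorem isIntegral_of_negOrd_eq_zero {v₁ v₂ : HeightOneSpectrum (𝓞 L)}
    (hv : ∀ v : HeightOneSpectrum (𝓞 L), (2 : 𝓞 L) ∈ v.asIdeal → v = v₁ ∨ v = v₂)
    {K : IntermediateField ℚ L} {x : Additive Lˣ} (hx : (x.toMul : L) ∈ twoIntegers K)
    (h1 : negOrd v₁ x = 0) (h2 : negOrd v₂ x = 0) : IsIntegral ℤ (x.toMul : L) := by
  obtain ⟨-, N, hN⟩ := hx
  obtain ⟨y, hy⟩ := HeightOneSpectrum.mem_integers_of_valuation_le_one (R := 𝓞 L) L (x.toMul : L)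
    (fun v => by
      by_cases h : (2 : 𝓞 L) ∈ v.asIdeal
      · rcases hv v h with rfl | rfl
        · exact (negOrd_eq_zero.1 h1).le
        · exact (negOrd_eq_zero.1 h2).le
      · have e2 : v.valuation L (2 : L) = 1 := by
          refine le_antisymm (valuation_le_one_of_isIntegral v isIntegral_two) ?_
          rw [← not_lt]
          exact fun hlt => h ((valuation_lt_one_iff_mem' v 2).1 hlt)
        have := valuation_le_one_of_isIntegral v hN
        rwa [map_mul, map_pow, e2, one_pow, one_mul] at this)
  rw [← hy]
  exact RingOfIntegers.isIntegral_coe y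

section Rank

variable {v₁ v₂ : HeightOneSpectrum (𝓞 L)}

/-- The pair of orders at `v₁`, `v₂` on the group of `2`-units of `K`. -/
noncomputable def ordPair (v₁ v₂ : HeightOneSpectrum (𝓞 L)) (K : IntermediateField ℚ L) :
    unitsIn (twoIntegers K) →ₗ[ℤ] ℤ × ℤ :=
  ((negOrd v₁).prod (negOrd v₂)).toIntLinearMap.comp (unitsIn (twoIntegers K)).subtype

/-- The kernel of the pair of orders consists of integral units. -/
noncomputable def kerOrdPairToUnits
    (hv : ∀ v : HeightOneSpectrum (𝓞 L), (2 : 𝓞 L) ∈ v.asIdeal → v = v₁ ∨ v = v₂)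
    (K : IntermediateField ℚ L) :
    LinearMap.ker (ordPair v₁ v₂ K) →ₗ[ℤ] unitsIn (integersIn K) :=
  LinearMap.codRestrict _ ((unitsIn (twoIntegers K)).subtype.comp (LinearMap.ker _).subtype)
    (by
      rintro ⟨⟨x, hx⟩, h⟩
      have hx' := mem_unitsIn.1 hx
      have h1 : negOrd v₁ x = 0 := congrArg Prod.fst h
      have h2 : negOrd v₂ x = 0 := congrArg Prod.snd h
      refine mem_unitsIn.2 ⟨⟨hx'.1.1, isIntegral_of_negOrd_eq_zero hv hx'.1 h1 h2⟩,
        hx'.2.1, ?_⟩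
      have := isIntegral_of_negOrd_eq_zero (x := -x) hv (K := K)
        (by simpa using hx'.2) (by rw [map_neg, h1, neg_zero]) (by rw [map_neg, h2, neg_zero])
      simpa using this)

theorem kerOrdPairToUnits_injective
    (hv : ∀ v : HeightOneSpectrum (𝓞 L), (2 : 𝓞 L) ∈ v.asIdeal → v = v₁ ∨ v = v₂)
    (K : IntermediateField ℚ L) : Function.Injective (kerOrdPairToUnits hv K) := by
  intro x y h
  have h' : ((x : unitsIn (twoIntegers K)) : Additive Lˣ) = ((y : unitsIn (twoIntegers K)) :
      Additive Lˣ) := congrArg (fun z : unitsIn (integersIn K) => (z : Additive Lˣ)) h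
  exact Subtype.ext (Subtype.ext h')

theorem finite_unitsIn_twoIntegers
    (hv : ∀ v : HeightOneSpectrum (𝓞 L), (2 : 𝓞 L) ∈ v.asIdeal → v = v₁ ∨ v = v₂)
    (K : IntermediateField ℚ L) : Module.Finite ℤ (unitsIn (twoIntegers K)) := by
  have := finite_unitsIn_integersIn K
  have : Module.Finite ℤ (LinearMap.ker (ordPair v₁ v₂ K)) :=
    Module.Finite.of_injective _ (kerOrdPairToUnits_injective hv K)
  have : Module.Finite ℤ (unitsIn (twoIntegers K) ⧸ LinearMap.ker (ordPair v₁ v₂ K)) :=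
    Module.Finite.equiv (ordPair v₁ v₂ K).quotKerEquivRange.symm
  exact Module.Finite.of_submodule_quotient (LinearMap.ker (ordPair v₁ v₂ K))

theorem finrank_unitsIn_twoIntegers_le
    (hv : ∀ v : HeightOneSpectrum (𝓞 L), (2 : 𝓞 L) ∈ v.asIdeal → v = v₁ ∨ v = v₂)
    (K : IntermediateField ℚ L) :
    Module.finrank ℤ (unitsIn (twoIntegers K)) ≤ Units.rank K + 2 := by
  have := finite_unitsIn_integersIn K
  have := finite_unitsIn_twoIntegers hv K
  have h := Submodule.finrank_quotient_add_finrank (LinearMap.ker (ordPair v₁ v₂ K))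
  have h1 := LinearMap.finrank_le_finrank_of_injective (kerOrdPairToUnits_injective hv K)
  have h2 := Submodule.finrank_le (LinearMap.range (ordPair v₁ v₂ K))
  rw [finrank_unitsIn_integersIn] at h1
  rw [(ordPair v₁ v₂ K).quotKerEquivRange.finrank_eq] at h
  simp only [Module.finrank_prod, Module.finrank_self] at h2
  omega

end Rank

theorem isTotallyComplex_of_sq_neg {F : Type*} [Field F] [NumberField F] {s : F} {d : ℕ}
    (hd : 0 < d) (hs : s ^ 2 = -(d : F)) : IsTotallyComplex F := by
  refine ⟨fun v => ?_⟩
  by_contra hv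
  rw [InfinitePlace.not_isComplex_iff_isReal] at hv
  have h := congrArg (InfinitePlace.embedding_of_isReal hv) hs
  rw [map_pow, map_neg, map_natCast] at h
  have h1 : (0 : ℝ) < d := by exact_mod_cast hd
  nlinarith [sq_nonneg (InfinitePlace.embedding_of_isReal hv s)]

theorem rank_add_one {F : Type*} [Field F] [NumberField F] [IsTotallyComplex F] :
    2 * (Units.rank F + 1) = Module.finrank ℚ F := by
  have h : 0 < Fintype.card (InfinitePlace F) := Fintype.card_pos
  rw [IsTotallyComplex.finrank, Units.rank, Nat.sub_add_cancel h,
    InfinitePlace.card_eq_nrRealPlaces_add_nrComplexPlaces,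
    IsTotallyComplex.nrRealPlaces_eq_zero, zero_add]

end TwoIntegers

end

section

open NumberField IsDedekindDomain

section QuadraticStep

variable {L : Type*} [Field L] [NumberField L]

/-- `M / K` is a quadratic extension inside `L`, with conjugation induced by `g`, étale outside
`2`. -/
structure QuadraticStep (K M : IntermediateField ℚ L) (g : L ≃ₐ[ℚ] L) : Prop where
  le : K ≤ M
  map_mem : ∀ x ∈ M, g x ∈ M
  invol : ∀ x ∈ M, g (g x) = x
  fixed : ∀ x ∈ M, g x = x ↔ x ∈ K
  etale : ∃ y₁ ∈ twoIntegers M, ∃ y₂ ∈ twoIntegers M, ∃ r₁ ∈ twoIntegers M,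
    ∃ r₂ ∈ twoIntegers M, r₁ * (y₁ - g y₁) + r₂ * (y₂ - g y₂) = 1

namespace QuadraticStep

variable {K M : IntermediateField ℚ L} {g : L ≃ₐ[ℚ] L}

/-- The conjugation on `2`-integers. -/
noncomputable def conj (H : QuadraticStep K M g) : twoIntegers M →+* twoIntegers M :=
  ((g : L →+* L).comp (twoIntegers M).subtype).codRestrict _
    fun x => map_mem_twoIntegers g (H.map_mem _ x.2.1) x.2

theorem quadraticEtale (H : QuadraticStep K M g) :
    QuadraticEtale (Subring.inclusion (twoIntegers_mono H.le)) H.conj where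
  inj := Subring.inclusion_injective _
  invol x := Subtype.ext (H.invol _ x.2.1)
  fixed r := Subtype.ext ((H.fixed _ (H.le r.2.1)).2 r.2.1)
  descend x hx :=
    ⟨⟨x, (H.fixed _ x.2.1).1 (congrArg Subtype.val hx), x.2.2⟩, rfl⟩
  etale := by
    obtain ⟨y₁, h1, y₂, h2, r₁, h3, r₂, h4, h⟩ := H.etale
    exact ⟨⟨y₁, h1⟩, ⟨y₂, h2⟩, ⟨r₁, h3⟩, ⟨r₂, h4⟩, Subtype.ext h⟩
  two_unit := ⟨⟨2⁻¹, inv_two_mem_twoIntegers K⟩, Subtype.ext (mul_inv_cancel₀ two_ne_zero)⟩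

theorem two_mul_finrank_le (H : QuadraticStep K M g) :
    2 * Module.finrank ℚ K ≤ Module.finrank ℚ M := by
  obtain ⟨y, hy⟩ := H.quadraticEtale.exists_sub_ne_zero
  have hy' : (y : L) - g y ≠ 0 := fun h => hy (Subtype.ext h)
  let φ : K × K →ₗ[ℚ] M :=
    { toFun := fun p => ⟨p.1 + p.2 * y,
        M.add_mem (H.le p.1.2) (M.mul_mem (H.le p.2.2) y.2.1)⟩
      map_add' := fun a b => Subtype.ext (by
        simp only [Prod.fst_add, Prod.snd_add, IntermediateField.coe_add]; ring)
      map_smul' := fun c a => Subtype.ext (by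
        simp only [Prod.smul_fst, Prod.smul_snd, IntermediateField.coe_smul, RingHom.id_apply,
          smul_add, smul_mul_assoc]) }
  have hφ : Function.Injective φ := by
    rw [← LinearMap.ker_eq_bot, LinearMap.ker_eq_bot']
    rintro ⟨a, b⟩ hab
    have h1 : (a : L) + b * y = 0 := congrArg Subtype.val hab
    have h2 := congrArg g h1
    rw [map_add, map_mul, map_zero, (H.fixed _ (H.le a.2)).2 a.2,
      (H.fixed _ (H.le b.2)).2 b.2] at h2
    have h3 : (b : L) * (y - g y) = 0 := by linear_combination h1 - h2
    have hb : (b : L) = 0 := (mul_eq_zero.1 h3).resolve_right hy'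
    have ha : (a : L) = 0 := by rw [hb] at h1; simpa using h1
    exact Prod.ext (Subtype.ext ha) (Subtype.ext hb)
  have := LinearMap.finrank_le_finrank_of_injective hφ
  rw [Module.finrank_prod] at this
  omega

theorem inv_mem_of_isUnit {R : Subring L} {e : R} (he : IsUnit e) : ((e : L))⁻¹ ∈ R := by
  obtain ⟨u, rfl⟩ := he
  have : ((u : R) : L) * ((u⁻¹ : Rˣ) : R) = 1 := by
    rw [← Subring.coe_mul, Units.mul_inv, Subring.coe_one]
  rw [inv_eq_of_mul_eq_one_right this]
  exact ((u⁻¹ : Rˣ) : R).2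

/-- `g` acting on the multiplicative group of `L`. -/
noncomputable def mulAct (g : L ≃ₐ[ℚ] L) : Additive Lˣ →+ Additive Lˣ :=
  (Units.map (g : L →* L)).toAdditive

theorem mulAct_val (g : L ≃ₐ[ℚ] L) (x : Additive Lˣ) :
    ((mulAct g x).toMul : L) = g (x.toMul : L) := rfl

theorem mulAct_mem (H : QuadraticStep K M g) {x : Additive Lˣ}
    (hx : x ∈ unitsIn (twoIntegers M)) : mulAct g x ∈ unitsIn (twoIntegers M) := by
  rw [mem_unitsIn] at hx ⊢
  rw [mulAct_val, ← map_inv₀]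
  exact ⟨map_mem_twoIntegers g (H.map_mem _ hx.1.1) hx.1,
    map_mem_twoIntegers g (H.map_mem _ hx.2.1) hx.2⟩

/-- `g` acting on the `2`-units of `M`. -/
noncomputable def unitAct (H : QuadraticStep K M g) :
    unitsIn (twoIntegers M) →+ unitsIn (twoIntegers M) :=
  AddMonoidHom.mk' (fun x => ⟨mulAct g (x : Additive Lˣ), H.mulAct_mem x.2⟩)
    fun x y => Subtype.ext (map_add (mulAct g) (x : Additive Lˣ) (y : Additive Lˣ))

theorem unitAct_val (H : QuadraticStep K M g) (x : unitsIn (twoIntegers M)) :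
    (((H.unitAct x : Additive Lˣ)).toMul : L) = g ((x : Additive Lˣ).toMul : L) := rfl

theorem units_ext {R : Subring L} {x y : unitsIn R}
    (h : ((x : Additive Lˣ).toMul : L) = ((y : Additive Lˣ).toMul : L)) : x = y :=
  Subtype.ext (Additive.toMul.injective (Units.ext h))

theorem norm_mem (H : QuadraticStep K M g) {x : L} (hx : x ∈ M) : x * g x ∈ K := by
  rw [← H.fixed _ (M.mul_mem hx (H.map_mem _ hx)), map_mul, H.invol _ hx, mul_comm]

theorem add_mulAct_mem (H : QuadraticStep K M g) {x : Additive Lˣ}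
    (hx : x ∈ unitsIn (integersIn M)) : x + mulAct g x ∈ unitsIn (integersIn K) := by
  have h_int : ∀ x : L, IsIntegral ℤ x → IsIntegral ℤ (g x) := fun x hx =>
    hx.map (g.toAlgHom.restrictScalars ℤ)
  rw [mem_unitsIn] at hx ⊢
  change (x.toMul : L) * g (x.toMul : L) ∈ _ ∧ ((x.toMul : L) * g (x.toMul : L))⁻¹ ∈ _
  rw [mul_inv, ← map_inv₀]
  exact ⟨⟨H.norm_mem hx.1.1, hx.1.2.mul (h_int _ hx.1.2)⟩,
    ⟨H.norm_mem hx.2.1, hx.2.2.mul (h_int _ hx.2.2)⟩⟩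

/-- The norm map on units. -/
noncomputable def normUnits (H : QuadraticStep K M g) :
    unitsIn (integersIn M) →ₗ[ℤ] unitsIn (integersIn K) :=
  (((AddMonoidHom.id _ + mulAct g).comp (unitsIn (integersIn M)).subtype.toAddMonoidHom).codRestrict
    (unitsIn (integersIn K)) fun x => H.add_mulAct_mem x.2).toIntLinearMap

theorem rank_le_add_finrank (H : QuadraticStep K M g)
    (a₁ : Submodule ℤ (unitsIn (twoIntegers M))) [Module.Finite ℤ a₁]
    (ha₁ : ∀ x, x ∈ a₁ ↔ x + H.unitAct x = 0) :
    Units.rank M ≤ Units.rank K + Module.finrank ℤ a₁ := by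
  have := finite_unitsIn_integersIn K
  have := finite_unitsIn_integersIn M
  let N := H.normUnits
  have h := Submodule.finrank_quotient_add_finrank (LinearMap.ker N)
  rw [N.quotKerEquivRange.finrank_eq, finrank_unitsIn_integersIn] at h
  have h2 := Submodule.finrank_le (LinearMap.range N)
  rw [finrank_unitsIn_integersIn] at h2
  let ι : LinearMap.ker N →ₗ[ℤ] a₁ :=
    (AddMonoidHom.mk' (fun x => ⟨⟨(x : unitsIn (integersIn M)), by
          have hx := mem_unitsIn.1 x.1.2
          exact mem_unitsIn.2 ⟨mem_twoIntegers_of_isIntegral hx.1.1 hx.1.2,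
            mem_twoIntegers_of_isIntegral hx.2.1 hx.2.2⟩⟩, by
        rw [ha₁]
        exact Subtype.ext (congrArg Subtype.val (LinearMap.mem_ker.1 x.2) :)⟩)
      fun x y => rfl).toIntLinearMap
  have hι : Function.Injective ι := fun x y hxy => by
    have h' := congrArg (fun z : a₁ => ((z : unitsIn (twoIntegers M)) : Additive Lˣ)) hxy
    exact Subtype.ext (Subtype.ext h')
  have h3 := LinearMap.finrank_le_finrank_of_injective hι
  omega

theorem finrank_invariants_le (H : QuadraticStep K M g) {v₁ v₂ : HeightOneSpectrum (𝓞 L)}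
    (hv : ∀ v : HeightOneSpectrum (𝓞 L), (2 : 𝓞 L) ∈ v.asIdeal → v = v₁ ∨ v = v₂)
    (a₀ : Submodule ℤ (unitsIn (twoIntegers M)))
    (ha₀ : ∀ x, x ∈ a₀ ↔ H.unitAct x = x) :
    Module.finrank ℤ a₀ ≤ Units.rank K + 2 := by
  have := finite_unitsIn_twoIntegers hv K
  let ι : a₀ →ₗ[ℤ] unitsIn (twoIntegers K) :=
    (AddMonoidHom.mk' (fun x => ⟨(x : unitsIn (twoIntegers M)), by
          have hx := mem_unitsIn.1 x.1.2
          have hx' : ((x : unitsIn (twoIntegers M)) : Additive Lˣ).toMul.val ∈ K :=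
            (H.fixed _ hx.1.1).1 (congrArg
              (fun z : unitsIn (twoIntegers M) => ((z : Additive Lˣ).toMul : L)) ((ha₀ _).1 x.2))
          exact mem_unitsIn.2 ⟨⟨hx', hx.1.2⟩, ⟨K.inv_mem hx', hx.2.2⟩⟩⟩)
      fun x y => rfl).toIntLinearMap
  have hι : Function.Injective ι := fun x y hxy => by
    have h' := congrArg (fun z : unitsIn (twoIntegers K) => (z : Additive Lˣ)) hxy
    exact Subtype.ext (Subtype.ext h')
  exact (LinearMap.finrank_le_finrank_of_injective hι).trans
    (finrank_unitsIn_twoIntegers_le hv K)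

theorem exists_norm_eq (H : QuadraticStep K M g) {v₁ v₂ : HeightOneSpectrum (𝓞 L)}
    (hv : ∀ v : HeightOneSpectrum (𝓞 L), (2 : 𝓞 L) ∈ v.asIdeal → v = v₁ ∨ v = v₂)
    {s : L} (hsK : s ∈ K) {d : ℕ} (hd : 0 < d) (hs : s ^ 2 = -(d : L))
    (hP : SquarePrincipal (twoIntegers K)) {u₀ : L} (hu₀ : u₀ ∈ twoIntegers K)
    (hu₀' : u₀⁻¹ ∈ twoIntegers K) (hu₀0 : u₀ ≠ 0) (hnon : ∀ z ∈ M, z * g z ≠ u₀)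
    {u : L} (hu : u ∈ twoIntegers K) (hu' : u⁻¹ ∈ twoIntegers K) (hu0 : u ≠ 0) :
    ∃ e ∈ twoIntegers M, e⁻¹ ∈ twoIntegers M ∧ e ≠ 0 ∧ (e * g e = u ∨ e * g e = u * u₀) := by
  have := finite_unitsIn_twoIntegers hv M
  have : IsTotallyComplex K := isTotallyComplex_of_sq_neg (s := (⟨s, hsK⟩ : K)) hd
    (Subtype.ext (by simpa using hs))
  have : IsTotallyComplex M := isTotallyComplex_of_sq_neg (s := (⟨s, H.le hsK⟩ : M)) hd
    (Subtype.ext (by simpa using hs))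
  let a₀ : Submodule ℤ (unitsIn (twoIntegers M)) :=
    LinearMap.ker (H.unitAct - AddMonoidHom.id _).toIntLinearMap
  let a₁ : Submodule ℤ (unitsIn (twoIntegers M)) :=
    LinearMap.ker (AddMonoidHom.id _ + H.unitAct).toIntLinearMap
  have ha₀ : ∀ x, x ∈ a₀ ↔ H.unitAct x = x := fun x => by
    rw [LinearMap.mem_ker]; exact sub_eq_zero
  have ha₁ : ∀ x, x ∈ a₁ ↔ x + H.unitAct x = 0 := fun x => by
    rw [LinearMap.mem_ker]; exact Iff.rfl
  have r0 := H.finrank_invariants_le hv a₀ ha₀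
  have r1 := H.rank_le_add_finrank a₁ ha₁
  have r2 := rank_add_one (F := K)
  have r3 := rank_add_one (F := M)
  have r4 := H.two_mul_finrank_le
  let mk : ∀ x : L, x ∈ twoIntegers M → x⁻¹ ∈ twoIntegers M → x ≠ 0 → unitsIn (twoIntegers M) :=
    fun x h1 h2 h3 => ⟨Additive.ofMul (Units.mk0 x h3), mem_unitsIn.2 ⟨h1, h2⟩⟩
  have val_add : ∀ x y : unitsIn (twoIntegers M), ((((x + y : unitsIn (twoIntegers M)) :
      Additive Lˣ)).toMul : L) = ((x : Additive Lˣ).toMul : L) * ((y : Additive Lˣ).toMul : L) :=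
    fun _ _ => rfl
  have val_zero : ((((0 : unitsIn (twoIntegers M)) : Additive Lˣ)).toMul : L) = 1 := rfl
  have mono := twoIntegers_mono H.le
  have hone : (-1 : L) ∈ twoIntegers M := (twoIntegers M).neg_mem (twoIntegers M).one_mem
  have gfix : ∀ x ∈ twoIntegers K, g x = x := fun x hx => (H.fixed _ (H.le hx.1)).2 hx.1
  obtain ⟨e, he⟩ := norm_or_norm_of_rank_le H.unitAct
    (fun x => units_ext (by
      rw [unitAct_val, unitAct_val, H.invol _ (mem_unitsIn.1 x.2).1.1]))
    (fun x hx => by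
      have hx1 := mem_unitsIn.1 x.2
      obtain ⟨e, he, h⟩ := H.quadraticEtale.exists_unit_of_norm_eq_one hP ⟨_, hx1.1⟩
        (Subtype.ext (by
          have := congrArg (fun z : unitsIn (twoIntegers M) => ((z : Additive Lˣ).toMul : L)) hx
          exact this))
      refine ⟨mk e e.2 (inv_mem_of_isUnit he) fun h0 => he.ne_zero (Subtype.ext h0), ?_⟩
      apply units_ext
      exact congrArg Subtype.val h)
    a₀ a₁ ha₀ ha₁ (by omega)
    (mk (-1) hone (by simp) (by simp))
    (fun h => by
      have := congrArg (fun z : unitsIn (twoIntegers M) => ((z : Additive Lˣ).toMul : L)) h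
      change (-1 : L) = 1 at this
      norm_num at this)
    (fun x => by
      constructor
      · intro h
        have := congrArg (fun z : unitsIn (twoIntegers M) => ((z : Additive Lˣ).toMul : L)) h
        simp only [two_nsmul, val_add, val_zero] at this
        rcases mul_self_eq_one_iff.1 this with h | h
        · exact Or.inl (units_ext h)
        · exact Or.inr (units_ext h)
      · rintro (rfl | rfl)
        · exact smul_zero _
        · exact units_ext (by
            rw [two_nsmul, val_add, val_zero]
            change (-1 : L) * -1 = 1
            ring))
    (units_ext (by change g (-1) = -1; rw [map_neg, map_one]))
    (mk u₀ (mono hu₀) (mono hu₀') hu₀0)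
    (units_ext (gfix _ hu₀))
    (fun e he => by
      have := congrArg (fun z : unitsIn (twoIntegers M) => ((z : Additive Lˣ).toMul : L)) he
      exact hnon _ (mem_unitsIn.1 e.2).1.1 this)
    (mk u (mono hu) (mono hu') hu0)
    (units_ext (gfix _ hu))
  have he1 := mem_unitsIn.1 e.2
  refine ⟨_, he1.1, he1.2, (e : Additive Lˣ).toMul.ne_zero, ?_⟩
  rcases he with he | he
  · left
    have := congrArg (fun z : unitsIn (twoIntegers M) => ((z : Additive Lˣ).toMul : L)) he
    exact this
  · right
    have := congrArg (fun z : unitsIn (twoIntegers M) => ((z : Additive Lˣ).toMul : L)) he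
    exact this

theorem squarePrincipal_top (H : QuadraticStep K M g) {v₁ v₂ : HeightOneSpectrum (𝓞 L)}
    (hv : ∀ v : HeightOneSpectrum (𝓞 L), (2 : 𝓞 L) ∈ v.asIdeal → v = v₁ ∨ v = v₂)
    {s : L} (hsK : s ∈ K) {d : ℕ} (hd : 0 < d) (hs : s ^ 2 = -(d : L))
    (hP : SquarePrincipal (twoIntegers K)) {u₀ : L} (hu₀ : u₀ ∈ twoIntegers K)
    (hu₀' : u₀⁻¹ ∈ twoIntegers K) (hu₀0 : u₀ ≠ 0) (hnon : ∀ z ∈ M, z * g z ≠ u₀) :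
    SquarePrincipal (twoIntegers M) := by
  refine H.quadraticEtale.squarePrincipal hP fun u z t hu ht hz => ?_
  have hu0 : (u : L) ≠ 0 := fun h => hu.ne_zero (Subtype.ext h)
  have ht0 : (t : L) ≠ 0 := fun h => ht (Subtype.ext h)
  have hz' : (z : L) * g z = u * (t : L) ^ 2 := congrArg Subtype.val hz
  obtain ⟨e, he, he', he0, h⟩ := H.exists_norm_eq hv hsK hd hs hP hu₀ hu₀' hu₀0 hnon u.2
    (inv_mem_of_isUnit hu) hu0
  rcases h with h | h
  · exact ⟨⟨e, he⟩, Subtype.ext h⟩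
  · exfalso
    have hgt : g (t : L) = t := (H.fixed _ (H.le t.2.1)).2 t.2.1
    refine hnon (e * t * (z : L)⁻¹) (M.mul_mem (M.mul_mem he.1 (H.le t.2.1))
      (M.inv_mem z.2.1)) ?_
    have hzz : (z : L) * g z ≠ 0 := by rw [hz']; exact mul_ne_zero hu0 (pow_ne_zero _ ht0)
    rw [map_mul, map_mul, map_inv₀, hgt]
    have : e * t * (z : L)⁻¹ * (g e * t * (g z)⁻¹) = (e * g e) * t ^ 2 * (z * g z)⁻¹ := by
      rw [mul_inv]; ring
    rw [this, h, hz']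
    field_simp

end QuadraticStep

end QuadraticStep

end

section

section Dyadic

theorem exists_sq_eq_neg_padic {d : ℕ} (hd : d % 8 = 7) : ∃ θ : ℚ_[2], θ ^ 2 = -(d : ℚ_[2]) := by
  obtain ⟨k, hk⟩ : ∃ k : ℕ, d + 1 = 2 ^ 3 * k := ⟨(d + 1) / 8, by omega⟩
  let F : Polynomial ℤ_[2] := Polynomial.X ^ 2 + Polynomial.C (d : ℤ_[2])
  have e1 : F.aeval (1 : ℤ_[2]) = 2 ^ 3 * (k : ℤ_[2]) := by
    have : ((d + 1 : ℕ) : ℤ_[2]) = ((2 ^ 3 * k : ℕ) : ℤ_[2]) := by rw [hk]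
    push_cast at this
    simp only [F, map_add, map_pow, Polynomial.aeval_X, Polynomial.aeval_C, one_pow,
      Algebra.algebraMap_self, RingHom.id_apply]
    rw [add_comm]; exact this
  have e2 : F.derivative.aeval (1 : ℤ_[2]) = 2 := by
    simp only [F, Polynomial.derivative_add, Polynomial.derivative_X_pow, Polynomial.derivative_C]
    simp
  have n2 : ‖(2 : ℤ_[2])‖ = 1 / 2 := by
    have := PadicInt.norm_p (p := 2)
    simpa using this
  obtain ⟨z, hz, -⟩ := hensels_lemma (F := F) (a := (1 : ℤ_[2])) (by
    rw [e1, e2, norm_mul, norm_pow, n2]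
    have := PadicInt.norm_le_one (k : ℤ_[2])
    have h0 := norm_nonneg (k : ℤ_[2])
    nlinarith)
  have hz' : z ^ 2 + (d : ℤ_[2]) = 0 := by
    simpa [F] using hz
  refine ⟨(z : ℚ_[2]), ?_⟩
  have := congrArg (fun t : ℤ_[2] => (t : ℚ_[2])) hz'
  push_cast at this
  linear_combination this

theorem padic_anisotropic {A : Fin 3 → ℤ}
    (hA : ∀ x : Fin 3 → ZMod 8, ∑ i, (A i : ZMod 8) * x i ^ 2 = 0 → ∀ i, 4 * x i = 0)
    {x : Fin 3 → ℚ_[2]} (hx : ∑ i, (A i : ℚ_[2]) * x i ^ 2 = 0) (i : Fin 3) : x i = 0 := by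
  by_contra hi
  obtain ⟨j, hj⟩ := Finite.exists_max (fun i => ‖x i‖)
  have hj0 : 0 < ‖x j‖ := (norm_pos_iff.2 hi).trans_le (hj i)
  have hj1 : x j ≠ 0 := norm_pos_iff.1 hj0
  let w : Fin 3 → ℤ_[2] := fun i => ⟨x i / x j, by
    rw [norm_div]; exact div_le_one_of_le₀ (hj i) hj0.le⟩
  have hw : ∑ i, (A i : ℤ_[2]) * w i ^ 2 = 0 := by
    apply Subtype.ext
    have : ∑ i, (A i : ℚ_[2]) * (x i / x j) ^ 2 = 0 := by
      have : ∑ i, (A i : ℚ_[2]) * (x i / x j) ^ 2 = (∑ i, (A i : ℚ_[2]) * x i ^ 2) / x j ^ 2 := by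
        rw [Finset.sum_div]; exact Finset.sum_congr rfl fun i _ => by ring
      rw [this, hx, zero_div]
    rw [Fin.sum_univ_three] at this ⊢
    push_cast
    exact this
  have h8 : ((2 : ℕ) ^ 3) = 8 := rfl
  have h := congrArg (PadicInt.toZModPow (p := 2) 3) hw
  rw [map_zero, map_sum] at h
  simp only [map_mul, map_pow, map_intCast] at h
  have h4 := hA (fun i => PadicInt.toZModPow (p := 2) 3 (w i)) h j
  have hwj : w j = 1 := Subtype.ext (div_self hj1)
  rw [hwj] at h4
  simp only [map_one] at h4
  exact absurd h4 (by decide)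

variable {L : Type*} [Field L] [NumberField L]

theorem anisotropic_of_sq {s : L} {d : ℕ} (hd : d % 8 = 7) (hs : s ^ 2 = -(d : L)) (A B C : ℤ)
    (hA : ∀ x y z : ZMod 8, (A : ZMod 8) * x ^ 2 + B * y ^ 2 + C * z ^ 2 = 0 →
      4 * x = 0 ∧ 4 * y = 0 ∧ 4 * z = 0)
    {x y z : L} (hx : ∃ u v : ℚ, x = u + v * s) (hy : ∃ u v : ℚ, y = u + v * s)
    (hz : ∃ u v : ℚ, z = u + v * s) (h : (A : L) * x ^ 2 + B * y ^ 2 + C * z ^ 2 = 0) :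
    x = 0 ∧ y = 0 ∧ z = 0 := by
  obtain ⟨θ, hθ⟩ := exists_sq_eq_neg_padic hd
  let φ : L →ₐ[ℚ] AlgebraicClosure ℚ_[2] := IsAlgClosed.lift
  have hφs : φ s = algebraMap ℚ_[2] _ θ ∨ φ s = algebraMap ℚ_[2] _ (-θ) := by
    rw [map_neg]
    apply sq_eq_sq_iff_eq_or_eq_neg.1
    rw [← map_pow, ← map_pow, hs, hθ]; simp
  have key : ∀ x : L, (∃ u v : ℚ, x = u + v * s) → ∃ r : ℚ_[2], φ x = algebraMap ℚ_[2] _ r := by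
    rintro x ⟨u, v, rfl⟩
    rcases hφs with h | h
    · exact ⟨u + v * θ, by simp [h]⟩
    · exact ⟨u + v * (-θ), by rw [map_add, map_mul, h, map_add, map_mul]; simp⟩
  obtain ⟨x', hx'⟩ := key x hx
  obtain ⟨y', hy'⟩ := key y hy
  obtain ⟨z', hz'⟩ := key z hz
  have h' : (A : ℚ_[2]) * x' ^ 2 + B * y' ^ 2 + C * z' ^ 2 = 0 := by
    apply (algebraMap ℚ_[2] (AlgebraicClosure ℚ_[2])).injective
    have := congrArg φ h
    simp only [map_add, map_mul, map_pow, map_zero, map_intCast, hx', hy', hz'] at this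
    simpa only [map_add, map_mul, map_pow, map_zero, map_intCast] using this
  have key2 := padic_anisotropic (A := ![A, B, C]) (x := ![x', y', z']) (fun w hw => by
    rw [Fin.sum_univ_three] at hw
    obtain ⟨h0, h1, h2⟩ := hA (w 0) (w 1) (w 2) hw
    intro i; fin_cases i
    · exact h0
    · exact h1
    · exact h2) (by rw [Fin.sum_univ_three]; exact h')
  have inj := φ.toRingHom.injective
  refine ⟨inj ?_, inj ?_, inj ?_⟩
  · exact hx'.trans (by rw [show x' = 0 from key2 0, map_zero]; exact (map_zero φ).symm)
  · exact hy'.trans (by rw [show y' = 0 from key2 1, map_zero]; exact (map_zero φ).symm)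
  · exact hz'.trans (by rw [show z' = 0 from key2 2, map_zero]; exact (map_zero φ).symm)

theorem sq_add_sq_add_sq_eq_zero {s : L} {d : ℕ} (hd : d % 8 = 7) (hs : s ^ 2 = -(d : L))
    {x y z : L} (hx : ∃ u v : ℚ, x = u + v * s) (hy : ∃ u v : ℚ, y = u + v * s)
    (hz : ∃ u v : ℚ, z = u + v * s) (h : x ^ 2 + y ^ 2 + z ^ 2 = 0) : x = 0 ∧ y = 0 ∧ z = 0 := by
  refine anisotropic_of_sq hd hs 1 1 1 (by simp only [Int.cast_one]; decide) hx hy hz ?_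
  push_cast; linear_combination h

theorem zmod_eq_five {p : ℕ} (hp : p % 8 = 5) : (p : ZMod 8) = 5 := by
  rw [← ZMod.natCast_mod, hp]; rfl

theorem sq_sub_two_mul_sq_eq_zero {s : L} {d p : ℕ} (hd : d % 8 = 7) (hs : s ^ 2 = -(d : L))
    (hp : p % 8 = 5) {x y z : L} (hx : ∃ u v : ℚ, x = u + v * s) (hy : ∃ u v : ℚ, y = u + v * s)
    (hz : ∃ u v : ℚ, z = u + v * s)
    (h : x ^ 2 - 2 * y ^ 2 = p * z ^ 2 ∨ x ^ 2 - 2 * y ^ 2 = -(p * z ^ 2)) :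
    x = 0 ∧ y = 0 ∧ z = 0 := by
  rcases h with h | h
  · refine anisotropic_of_sq hd hs 1 (-2) (-p) ?_ hx hy hz ?_
    · push_cast; rw [zmod_eq_five hp]; decide
    · push_cast; linear_combination h
  · refine anisotropic_of_sq hd hs 1 (-2) p ?_ hx hy hz ?_
    · push_cast; rw [zmod_eq_five hp]; decide
    · push_cast; linear_combination h

theorem two_ne_sq_sub_mul_sq {s : L} {d p : ℕ} (hd : d % 8 = 7) (hs : s ^ 2 = -(d : L))
    (hp : p % 8 = 5) {x y : L} (hx : ∃ u v : ℚ, x = u + v * s) (hy : ∃ u v : ℚ, y = u + v * s) :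
    x ^ 2 - p * y ^ 2 ≠ 2 := by
  intro h
  have := anisotropic_of_sq hd hs 1 (-p) (-2) (z := 1) (by
    push_cast; rw [zmod_eq_five hp]; decide) hx hy ⟨1, 0, by simp⟩
    (by push_cast; linear_combination h)
  exact one_ne_zero this.2.2

end Dyadic

end

section

section IntegerForms

/-- `2 ^ t` is the norm of an integer `(x + y√(-d)) / 2` with `x` odd. -/
def TwoPowNorm (d t : ℕ) : Prop := ∃ x y : ℤ, Odd x ∧ x ^ 2 + d * y ^ 2 = 2 ^ (t + 2)

variable {p q : ℕ} [hpp : Fact p.Prime] [hqp : Fact q.Prime]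

theorem not_isSquare_two (hp : p % 8 = 5) : ¬IsSquare (2 : ZMod p) := by
  rw [ZMod.exists_sq_eq_two_iff (by rintro rfl; omega)]
  omega

theorem two_ne_zero_zmod (hp : p % 8 = 5) : (2 : ZMod p) ≠ 0 := by
  intro h
  exact not_isSquare_two hp (h ▸ ⟨0, by simp⟩)

theorem TwoPowNorm.even (hp : p % 8 = 5) {t : ℕ} (h : TwoPowNorm (p * q) t) : Even t := by
  obtain ⟨x, y, -, h⟩ := h
  by_contra ht
  obtain ⟨e, rfl⟩ := Nat.not_even_iff_odd.1 ht
  have h' := congrArg (Int.cast : ℤ → ZMod p) h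
  push_cast at h'
  rw [CharP.cast_eq_zero (ZMod p) p, zero_mul, zero_mul, add_zero] at h'
  have h2 := two_ne_zero_zmod hp
  refine not_isSquare_two hp ⟨(x : ZMod p) / 2 ^ (e + 1), ?_⟩
  field_simp
  rw [h']; ring

theorem two_mul_sq_add_eq_sq (hp : p % 8 = 5) (hq : ¬p ∣ q) :
    ∀ (N : ℕ) (a b w : ℤ), w.natAbs ≤ N → 2 * a ^ 2 + 2 * (p * q) * b ^ 2 = w ^ 2 → w = 0 := by
  intro N
  induction N with
  | zero => intro a b w hw _; omega
  | succ N ih =>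
    intro a b w hw h
    have hpZ : Prime (p : ℤ) := Nat.prime_iff_prime_int.1 hpp.out
    have h' := congrArg (Int.cast : ℤ → ZMod p) h
    push_cast at h'
    rw [CharP.cast_eq_zero (ZMod p) p, zero_mul, mul_zero, zero_mul, add_zero] at h'
    have ha : (a : ZMod p) = 0 := by
      by_contra ha
      exact not_isSquare_two hp ⟨(w : ZMod p) / a, by field_simp; exact h'⟩
    rw [ha] at h'
    have hw0 : (w : ZMod p) = 0 := by
      have : (w : ZMod p) ^ 2 = 0 := by rw [← h']; ring
      exact pow_eq_zero_iff (two_ne_zero) |>.1 this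
    rw [ZMod.intCast_zmod_eq_zero_iff_dvd] at ha hw0
    obtain ⟨a', rfl⟩ := ha
    obtain ⟨w', rfl⟩ := hw0
    have hb : (p : ℤ) ∣ b := by
      have h1 : (p : ℤ) * (2 * q * b ^ 2) = p * (p * (w' ^ 2 - 2 * a' ^ 2)) := by
        linear_combination h
      have h2 := mul_left_cancel₀ hpZ.ne_zero h1
      have h3 : (p : ℤ) ∣ 2 * q * b ^ 2 := ⟨_, h2⟩
      rcases hpZ.dvd_or_dvd h3 with h4 | h4
      · rcases hpZ.dvd_or_dvd h4 with h5 | h5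
        · have := Int.natCast_dvd_natCast.1 (by exact_mod_cast h5 : (p : ℤ) ∣ ((2 : ℕ) : ℤ))
          have := Nat.le_of_dvd (by norm_num) this
          omega
        · exact absurd (Int.natCast_dvd_natCast.1 h5) hq
      · exact hpZ.dvd_of_dvd_pow h4
    obtain ⟨b', rfl⟩ := hb
    have h1 : (p : ℤ) ^ 2 * (2 * a' ^ 2 + 2 * (p * q) * b' ^ 2) = p ^ 2 * w' ^ 2 := by
      linear_combination h
    have h2 := mul_left_cancel₀ (pow_ne_zero 2 hpZ.ne_zero) h1
    have hp2 := hpp.out.two_le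
    have : w' = 0 := by
      by_cases hw' : w' = 0
      · exact hw'
      · refine ih a' b' w' ?_ h2
        rw [Int.natAbs_mul, Int.natAbs_natCast] at hw
        have := Int.natAbs_pos.2 hw'
        nlinarith
    rw [this, mul_zero]

theorem exists_sq_of_mul_eq_sq {a b c : ℤ} (ha : 0 < a) (hab : IsCoprime a b) (h : a * b = c ^ 2) :
    ∃ r, a = r ^ 2 := by
  obtain ⟨r, hr | hr⟩ := Int.sq_of_isCoprime hab h
  · exact ⟨r, hr⟩
  · nlinarith [sq_nonneg r]

theorem exists_split_of_dvd {D E : ℕ}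
    (hE : 1 ≤ E) (hDE : D = 2 * E) (hmin : ∀ t, 1 ≤ t → TwoPowNorm (p * q) t → D ∣ t) {x y : ℤ}
    (hx : Odd x) (h : x ^ 2 + p * q * y ^ 2 = 2 ^ (D + 2)) (hd : (p : ℤ) ∣ 2 ^ (E + 1) - x) :
    ∃ y₁ y₂ : ℤ, p * y₁ ^ 2 + q * y₂ ^ 2 = 2 ^ (E + 2) ∧ p * y₁ ^ 2 - q * y₂ ^ 2 = -2 * x ∧
      y₁ * y₂ = -y := by
  have hpZ : Prime (p : ℤ) := Nat.prime_iff_prime_int.1 hpp.out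
  have hqZ : Prime (q : ℤ) := Nat.prime_iff_prime_int.1 hqp.out
  have hp0 : (0 : ℤ) < p := by exact_mod_cast hpp.out.pos
  have hq0 : (0 : ℤ) < q := by exact_mod_cast hqp.out.pos
  have hy : y ≠ 0 := by
    rintro rfl
    have h1 : Odd (x ^ 2) := hx.pow
    have h2 : x ^ 2 = 2 ^ (D + 2) := by linear_combination h
    rw [h2] at h1
    exact (Int.not_odd_iff_even.2 ((Int.even_pow' (by omega)).2 even_two)) h1
  have hprod : (2 ^ (E + 1) - x) * (2 ^ (E + 1) + x) = p * q * y ^ 2 := by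
    subst hDE
    linear_combination -h
  have hpos : 0 < (2 ^ (E + 1) - x) * (2 ^ (E + 1) + x) := by
    rw [hprod]; positivity
  have h2pos : (0 : ℤ) < 2 ^ (E + 1) := by positivity
  have hf1 : 0 < 2 ^ (E + 1) - x := by
    rcases pos_and_pos_or_neg_and_neg_of_mul_pos hpos with h | h
    · exact h.1
    · linarith [h.1, h.2]
  have hf2 : 0 < 2 ^ (E + 1) + x := by
    rcases pos_and_pos_or_neg_and_neg_of_mul_pos hpos with h | h
    · exact h.2
    · linarith [h.1, h.2]
  have hodd : Odd (2 ^ (E + 1) - x) :=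
    ((Int.even_pow' (by omega)).2 even_two).sub_odd hx
  have hcop : IsCoprime (2 ^ (E + 1) - x) (2 ^ (E + 1) + x) := by
    have h1 : IsCoprime (2 ^ (E + 1) - x) (2 ^ (E + 2)) := by
      apply IsCoprime.pow_right
      obtain ⟨k, hk⟩ := hodd
      exact ⟨1, -k, by rw [hk]; ring⟩
    have h2 : (2 : ℤ) ^ (E + 1) + x = 2 ^ (E + 2) + (2 ^ (E + 1) - x) * (-1) := by ring
    rw [h2]
    exact h1.add_mul_left_right _
  obtain ⟨f1, hf1'⟩ := hd
  rw [hf1'] at hcop hprod hf1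
  have hf10 : 0 < f1 := pos_of_mul_pos_right hf1 hp0.le
  have hprod' : f1 * (2 ^ (E + 1) + x) = q * y ^ 2 :=
    mul_left_cancel₀ hpZ.ne_zero (by linear_combination hprod)
  have hcop' : IsCoprime f1 (2 ^ (E + 1) + x) := hcop.of_mul_left_right
  rcases hqZ.dvd_or_dvd (⟨_, hprod'⟩ : (q : ℤ) ∣ _) with ⟨g, hg⟩ | ⟨g, hg⟩
  · exfalso
    subst hg
    have hg0 : 0 < g := pos_of_mul_pos_right hf10 hq0.le
    have hc := hcop'.of_mul_left_right
    have e : g * (2 ^ (E + 1) + x) = y ^ 2 :=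
      mul_left_cancel₀ hqZ.ne_zero (by linear_combination hprod')
    obtain ⟨r, hr⟩ := exists_sq_of_mul_eq_sq hg0 hc e
    obtain ⟨r', hr'⟩ := exists_sq_of_mul_eq_sq hf2 hc.symm (by rw [mul_comm, e])
    have hT : TwoPowNorm (p * q) E := by
      refine ⟨r', r, ?_, ?_⟩
      · have : Odd (r' ^ 2) := by
          rw [← hr']; exact ((Int.even_pow' (by omega)).2 even_two).add_odd hx
        exact Int.odd_pow' (two_ne_zero) |>.1 this
      · push_cast
        rw [hr] at hf1'
        linear_combination -hf1' - hr'
    have := Nat.le_of_dvd (by omega) (hmin E hE hT)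
    omega
  · rw [hg] at hcop' hprod' hf2
    have hg0 : 0 < g := pos_of_mul_pos_right hf2 hq0.le
    have hc := hcop'.of_mul_right_right
    have e : f1 * g = y ^ 2 :=
      mul_left_cancel₀ hqZ.ne_zero (by linear_combination hprod')
    obtain ⟨r, hr⟩ := exists_sq_of_mul_eq_sq hf10 hc e
    obtain ⟨r', hr'⟩ := exists_sq_of_mul_eq_sq hg0 hc.symm (by rw [mul_comm, e])
    rw [hr] at hf1' e
    rw [hr'] at hg e
    have hs : (r * r') ^ 2 = y ^ 2 := by linear_combination e
    rcases sq_eq_sq_iff_eq_or_eq_neg.1 hs with h' | h'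
    · exact ⟨-r, r', by linear_combination -hf1' - hg, by linear_combination -hf1' + hg,
        by linear_combination -h'⟩
    · exact ⟨r, r', by linear_combination -hf1' - hg, by linear_combination -hf1' + hg, h'⟩

theorem exists_split (hp : p % 8 = 5) {D : ℕ} (hD : 1 ≤ D)
    (hT : TwoPowNorm (p * q) D) (hmin : ∀ t, 1 ≤ t → TwoPowNorm (p * q) t → D ∣ t) :
    ∃ (E : ℕ) (x y y₁ y₂ : ℤ), 1 ≤ E ∧ D = 2 * E ∧ Odd x ∧ x ^ 2 + p * q * y ^ 2 = 2 ^ (D + 2) ∧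
      p * y₁ ^ 2 + q * y₂ ^ 2 = 2 ^ (E + 2) ∧
      (p * y₁ ^ 2 - q * y₂ ^ 2 = -2 * x ∧ y₁ * y₂ = -y ∨
        p * y₁ ^ 2 - q * y₂ ^ 2 = 2 * x ∧ y₁ * y₂ = y) := by
  obtain ⟨E, hE⟩ := hT.even hp
  obtain ⟨x, y, hx, h⟩ := hT
  push_cast at h
  have hpZ : Prime (p : ℤ) := Nat.prime_iff_prime_int.1 hpp.out
  have hd : (p : ℤ) ∣ (2 ^ (E + 1) - x) * (2 ^ (E + 1) + x) := by
    refine ⟨q * y ^ 2, ?_⟩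
    subst hE
    linear_combination -h
  rcases hpZ.dvd_or_dvd hd with hd | hd
  · obtain ⟨y₁, y₂, h1, h2, h3⟩ := exists_split_of_dvd
      (by omega) (by omega) hmin hx h hd
    exact ⟨E, x, y, y₁, y₂, by omega, by omega, hx, h, h1, Or.inl ⟨h2, h3⟩⟩
  · obtain ⟨y₁, y₂, h1, h2, h3⟩ := exists_split_of_dvd (x := -x) (y := -y) (E := E)
      (by omega) (by omega) hmin hx.neg (by linear_combination h)
      (by rwa [sub_neg_eq_add])
    exact ⟨E, x, y, y₁, y₂, by omega, by omega, hx, h, h1,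
      Or.inr ⟨by linear_combination h2, by linear_combination h3⟩⟩

end IntegerForms

end

section

open NumberField IsDedekindDomain
open scoped nonZeroDivisors

section AwayFromTwo

variable {L : Type*} [Field L] [NumberField L]

/-- Integers as `2`-integers. -/
def toTwoIntegers (L : Type*) [Field L] [NumberField L] :
    𝓞 L →+* twoIntegers (⊤ : IntermediateField ℚ L) :=
  (algebraMap (𝓞 L) L).codRestrict _
    fun x => mem_twoIntegers_of_isIntegral IntermediateField.mem_top x.2

theorem toTwoIntegers_injective : Function.Injective (toTwoIntegers L) := fun _ _ h =>
  RingOfIntegers.ext (congrArg (fun t : twoIntegers (⊤ : IntermediateField ℚ L) => (t : L)) h)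

theorem isUnit_two_twoIntegers (K : IntermediateField ℚ L) : IsUnit (2 : twoIntegers K) :=
  IsUnit.of_mul_eq_one ⟨2⁻¹, inv_two_mem_twoIntegers K⟩
    (Subtype.ext (mul_inv_cancel₀ (two_ne_zero (α := L))))

theorem exists_toTwoIntegers_eq (y : twoIntegers (⊤ : IntermediateField ℚ L)) :
    ∃ (k : ℕ) (z : 𝓞 L), toTwoIntegers L z = 2 ^ k * y := by
  obtain ⟨-, k, hk⟩ := y.2
  exact ⟨k, ⟨2 ^ k * y, hk⟩, Subtype.ext rfl⟩

theorem exists_of_mem_map {I : Ideal (𝓞 L)} {y : twoIntegers (⊤ : IntermediateField ℚ L)}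
    (hy : y ∈ I.map (toTwoIntegers L)) : ∃ k : ℕ, ∃ z ∈ I, toTwoIntegers L z = 2 ^ k * y := by
  induction hy using Submodule.span_induction with
  | mem x hx => obtain ⟨z, hz, rfl⟩ := hx; exact ⟨0, z, hz, by simp⟩
  | zero => exact ⟨0, 0, I.zero_mem, by simp⟩
  | add x y _ _ hx hy =>
    obtain ⟨k, z, hz, h⟩ := hx
    obtain ⟨l, w, hw, h'⟩ := hy
    refine ⟨k + l, 2 ^ l * z + 2 ^ k * w,
      I.add_mem (I.mul_mem_left _ hz) (I.mul_mem_left _ hw), ?_⟩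
    rw [map_add, map_mul, map_mul, h, h', map_pow, map_pow, map_ofNat]; ring
  | smul a x _ hx =>
    obtain ⟨k, z, hz, h⟩ := hx
    obtain ⟨l, w, hw⟩ := exists_toTwoIntegers_eq a
    refine ⟨l + k, w * z, I.mul_mem_left _ hz, ?_⟩
    rw [map_mul, h, hw, smul_eq_mul]; ring

theorem map_comap_toTwoIntegers (I : Ideal (twoIntegers (⊤ : IntermediateField ℚ L))) :
    (I.comap (toTwoIntegers L)).map (toTwoIntegers L) = I := by
  refine le_antisymm Ideal.map_comap_le fun y hy => ?_
  obtain ⟨k, z, hz⟩ := exists_toTwoIntegers_eq y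
  have h1 : toTwoIntegers L z ∈ (I.comap (toTwoIntegers L)).map (toTwoIntegers L) :=
    Ideal.mem_map_of_mem _ (by rw [Ideal.mem_comap, hz]; exact I.mul_mem_left _ hy)
  rw [hz] at h1
  exact (Ideal.unit_mul_mem_iff_mem _ ((isUnit_two_twoIntegers _).pow k)).1 h1

theorem exists_two_pow_mul_mem {I J : Ideal (𝓞 L)}
    (h : I.map (toTwoIntegers L) ≤ J.map (toTwoIntegers L)) :
    ∃ M : ℕ, Ideal.span {2 ^ M} * I ≤ J := by
  obtain ⟨S, hS⟩ := (IsNoetherian.noetherian I : I.FG)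
  have key : ∀ z ∈ S, ∃ k : ℕ, 2 ^ k * z ∈ J := fun z hz => by
    have hz' : z ∈ I := hS ▸ Submodule.subset_span hz
    obtain ⟨k, w, hw, hk⟩ := exists_of_mem_map (h (Ideal.mem_map_of_mem _ hz'))
    refine ⟨k, ?_⟩
    have : w = 2 ^ k * z := toTwoIntegers_injective (by
      rw [hk, map_mul, map_pow, map_ofNat])
    exact this ▸ hw
  choose! k hk using key
  refine ⟨∑ z ∈ S, k z, ?_⟩
  rw [Ideal.span_singleton_mul_le_iff]
  intro z hz
  rw [← hS] at hz
  induction hz using Submodule.span_induction with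
  | mem x hx =>
    have := Finset.single_le_sum (f := k) (fun _ _ => Nat.zero_le _) hx
    obtain ⟨c, hc⟩ := Nat.exists_eq_add_of_le this
    rw [hc, pow_add, mul_comm (2 ^ k x), mul_assoc]
    exact J.mul_mem_left _ (hk x hx)
  | zero => rw [mul_zero]; exact J.zero_mem
  | add x y _ _ hx hy => rw [mul_add]; exact J.add_mem hx hy
  | smul a x _ hx => rw [smul_eq_mul, mul_left_comm]; exact J.mul_mem_left _ hx

/-- A height one prime as a nonzero ideal. -/
def heightOneIdeal (v : HeightOneSpectrum (𝓞 L)) : (Ideal (𝓞 L))⁰ :=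
  ⟨v.asIdeal, mem_nonZeroDivisors_of_ne_zero v.ne_bot⟩

variable {v₁ v₂ : HeightOneSpectrum (𝓞 L)}

theorem mk0_mem_zpowers_of_two_pow_mem
    (hv : ∀ v : HeightOneSpectrum (𝓞 L), (2 : 𝓞 L) ∈ v.asIdeal → v = v₁ ∨ v = v₂)
    (hcl : ClassGroup.mk0 (heightOneIdeal v₂) ∈
      Subgroup.zpowers (ClassGroup.mk0 (heightOneIdeal v₁))) (Q : Ideal (𝓞 L)) :
    ∀ (hQ : Q ∈ (Ideal (𝓞 L))⁰) (M : ℕ), (2 : 𝓞 L) ^ M ∈ Q →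
      ClassGroup.mk0 ⟨Q, hQ⟩ ∈ Subgroup.zpowers (ClassGroup.mk0 (heightOneIdeal v₁)) := by
  induction Q using UniqueFactorizationMonoid.induction_on_prime with
  | h₁ => intro hQ; exact absurd rfl (nonZeroDivisors.ne_zero hQ)
  | h₂ Q hu =>
    intro hQ M _
    rw [Ideal.isUnit_iff] at hu
    have : ClassGroup.mk0 ⟨Q, hQ⟩ = 1 := by
      rw [ClassGroup.mk0_eq_one_iff, hu]
      exact ⟨1, by simp⟩
    rw [this]; exact one_mem _
  | h₃ Q p hQ0 hp ih =>
    intro hQ M hM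
    have hpI : p.IsPrime := Ideal.isPrime_of_prime hp
    have h2 : (2 : 𝓞 L) ∈ p := hpI.mem_of_pow_mem M (Ideal.mul_le_left (I := p) (J := Q) hM)
    have e : (⟨p * Q, hQ⟩ : (Ideal (𝓞 L))⁰) =
        heightOneIdeal ⟨p, hpI, hp.ne_zero⟩ * ⟨Q, mem_nonZeroDivisors_of_ne_zero hQ0⟩ :=
      Subtype.ext rfl
    rw [e, map_mul]
    refine mul_mem ?_ (ih _ M (Ideal.mul_le_right (I := p) (J := Q) hM))
    rcases hv ⟨p, hpI, hp.ne_zero⟩ h2 with h | h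
    · rw [h]; exact Subgroup.mem_zpowers _
    · rw [h]; exact hcl

theorem SquarePrincipal.pow {R : Type*} [CommRing R] (hR : SquarePrincipal R) (k : ℕ) :
    ∀ (I : Ideal R) (x : R), I ^ 2 ^ k = Ideal.span {x} → ∃ y, I = Ideal.span {y} := by
  induction k with
  | zero => intro I x h; exact ⟨x, by simpa using h⟩
  | succ k ih =>
    intro I x h
    obtain ⟨y, hy⟩ := hR (I ^ 2 ^ k) x (by rw [← pow_mul, ← pow_succ]; exact h)
    exact ih I y hy

theorem mem_zpowers_of_pow_two_pow_eq_one
    (hv : ∀ v : HeightOneSpectrum (𝓞 L), (2 : 𝓞 L) ∈ v.asIdeal → v = v₁ ∨ v = v₂)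
    (hcl : ClassGroup.mk0 (heightOneIdeal v₂) ∈
      Subgroup.zpowers (ClassGroup.mk0 (heightOneIdeal v₁)))
    (hP : SquarePrincipal (twoIntegers (⊤ : IntermediateField ℚ L))) (x : ClassGroup (𝓞 L))
    (k : ℕ) (hx : x ^ 2 ^ k = 1) :
    x ∈ Subgroup.zpowers (ClassGroup.mk0 (heightOneIdeal v₁)) := by
  obtain ⟨⟨I, hI⟩, rfl⟩ := ClassGroup.mk0_surjective x
  have hI0 : I ≠ 0 := nonZeroDivisors.ne_zero hI
  rw [← map_pow] at hx
  have h1 := (ClassGroup.mk0_eq_one_iff (pow_mem hI (2 ^ k))).1 hx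
  obtain ⟨b, hb⟩ := h1
  have hb' : I ^ 2 ^ k = Ideal.span {b} := hb
  obtain ⟨w, hw⟩ := hP.pow k (I.map (toTwoIntegers L)) (toTwoIntegers L b) (by
    rw [← Ideal.map_pow, hb', Ideal.map_span, Set.image_singleton])
  have hwI : w ∈ I.map (toTwoIntegers L) := hw ▸ Ideal.mem_span_singleton_self w
  obtain ⟨l, z, hz, hzw⟩ := exists_of_mem_map hwI
  have hspan : I.map (toTwoIntegers L) = Ideal.span {toTwoIntegers L z} := by
    rw [hw, hzw, Ideal.span_singleton_eq_span_singleton]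
    obtain ⟨u, hu⟩ := (isUnit_two_twoIntegers (⊤ : IntermediateField ℚ L)).pow l
    exact ⟨u, by rw [hu, mul_comm]⟩
  have hz0 : z ≠ 0 := by
    rintro rfl
    rw [map_zero] at hspan
    have : I = ⊥ := by
      rw [eq_bot_iff]
      intro y hy
      have := hspan ▸ Ideal.mem_map_of_mem (toTwoIntegers L) hy
      rw [Ideal.span_singleton_eq_bot.2 rfl, Ideal.mem_bot] at this
      exact toTwoIntegers_injective (this.trans (map_zero _).symm)
    exact hI0 this
  obtain ⟨Q, hQ⟩ : I ∣ Ideal.span {z} := Ideal.dvd_span_singleton.2 hz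
  have hQ0 : Q ≠ 0 := by
    rintro rfl
    rw [mul_zero] at hQ
    exact hz0 (Ideal.span_singleton_eq_bot.1 hQ)
  have htop : Q.map (toTwoIntegers L) = ⊤ := by
    have h2 := congrArg (Ideal.map (toTwoIntegers L)) hQ
    rw [Ideal.map_mul, hspan, Ideal.map_span, Set.image_singleton] at h2
    have h3 : toTwoIntegers L z ∈
        Ideal.span {toTwoIntegers L z} * Q.map (toTwoIntegers L) :=
      h2 ▸ Ideal.mem_span_singleton_self _
    obtain ⟨y, hy, hyz⟩ := Ideal.mem_span_singleton_mul.1 h3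
    have hz0' : toTwoIntegers L z ≠ 0 := fun h =>
      hz0 (toTwoIntegers_injective (h.trans (map_zero _).symm))
    have : y = 1 := mul_left_cancel₀ hz0' (by rw [hyz, mul_one])
    rw [Ideal.eq_top_iff_one]; exact this ▸ hy
  obtain ⟨M, hM⟩ := exists_two_pow_mul_mem (I := ⊤) (J := Q) (by rw [htop]; exact le_top)
  have hM' : (2 : 𝓞 L) ^ M ∈ Q := hM (by
    rw [Ideal.mul_top]; exact Ideal.mem_span_singleton_self _)
  have h4 := mk0_mem_zpowers_of_two_pow_mem hv hcl Q (mem_nonZeroDivisors_of_ne_zero hQ0) M hM'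
  have h5 : ClassGroup.mk0 ⟨I, hI⟩ *
      ClassGroup.mk0 ⟨Q, mem_nonZeroDivisors_of_ne_zero hQ0⟩ = 1 := by
    rw [← map_mul]
    refine (ClassGroup.mk0_eq_one_iff (mul_mem hI (mem_nonZeroDivisors_of_ne_zero hQ0))).2
      ⟨z, hQ.symm⟩
  rw [eq_inv_of_mul_eq_one_left h5]
  exact inv_mem h4

end AwayFromTwo

section CyclicSylow

variable {G : Type*} [CommGroup G] [Finite G] {c : G}

theorem factorization_card_eq_of_forall_mem_zpowers
    (hc : ∀ (x : G) (k : ℕ), x ^ 2 ^ k = 1 → x ∈ Subgroup.zpowers c) :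
    (Nat.card G).factorization 2 = (orderOf c).factorization 2 ∧
      ∀ P : Sylow 2 G, Nonempty
        (P ≃* Multiplicative (ZMod (2 ^ (orderOf c).factorization 2))) := by
  have hle : ∀ P : Sylow 2 G, (P : Subgroup G) ≤ Subgroup.zpowers c := fun P x hx => by
    obtain ⟨k, hk⟩ := P.isPGroup' ⟨x, hx⟩
    exact hc x k (congrArg Subtype.val hk)
  have hfac : (Nat.card G).factorization 2 = (orderOf c).factorization 2 := by
    refine le_antisymm ?_ ((Nat.factorization_le_iff_dvd (orderOf_pos c).ne'
      Nat.card_pos.ne').2 (orderOf_dvd_natCard c) 2)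
    obtain ⟨P⟩ : Nonempty (Sylow 2 G) := inferInstance
    have h1 := Subgroup.card_dvd_of_le (hle P)
    rw [Nat.card_zpowers, P.card_eq_multiplicity] at h1
    exact (Nat.prime_two.pow_dvd_iff_le_factorization (orderOf_pos c).ne').1 h1
  refine ⟨hfac, fun P => ?_⟩
  have hcyc : IsCyclic P :=
    isCyclic_of_injective (Subgroup.inclusion (hle P)) (Subgroup.inclusion_injective _)
  refine ⟨mulEquivOfCyclicCardEq ?_⟩
  rw [← hfac]
  refine P.card_eq_multiplicity.trans ?_
  simp

end CyclicSylow

end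

section

open NumberField IsDedekindDomain
open scoped nonZeroDivisors

section QuadraticField

variable {F : Type*} [Field F] [NumberField F]

theorem exists_int_of_isIntegral {r : ℚ} (h : IsIntegral ℤ (r : F)) : ∃ n : ℤ, r = n := by
  have h' : IsIntegral ℤ (algebraMap ℚ F r) := by simpa using h
  rw [isIntegral_algebraMap_iff (algebraMap ℚ F).injective] at h'
  obtain ⟨n, hn⟩ := IsIntegrallyClosed.isIntegral_iff.1 h'
  exact ⟨n, by simpa using hn.symm⟩

theorem isIntegral_map_algEquiv {x : F} (g : F ≃ₐ[ℚ] F) (hx : IsIntegral ℤ x) :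
    IsIntegral ℤ (g x) := hx.map (g.toAlgHom.restrictScalars ℤ)

/-- `F = ℚ(√(-pq))` with generator `s` and conjugation `J`. -/
structure ImaginaryQuadratic (p q : ℕ) (s : F) (J : F ≃ₐ[ℚ] F) : Prop where
  sq : s ^ 2 = -((p * q : ℕ) : F)
  conj : J s = -s
  all : ∀ x : F, ∃ u v : ℚ, x = u + v * s

namespace ImaginaryQuadratic

variable {p q : ℕ} [hpp : Fact p.Prime] [hqp : Fact q.Prime] {s : F} {J : F ≃ₐ[ℚ] F}

theorem conj_apply (H : ImaginaryQuadratic p q s J) (u v : ℚ) :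
    J ((u : F) + v * s) = u - v * s := by
  rw [map_add, map_mul, map_ratCast, map_ratCast, H.conj]; ring

theorem conj_conj (H : ImaginaryQuadratic p q s J) (x : F) : J (J x) = x := by
  obtain ⟨u, v, rfl⟩ := H.all x
  rw [H.conj_apply, map_sub, map_mul, map_ratCast, map_ratCast, H.conj]; ring

theorem ne_zero (H : ImaginaryQuadratic p q s J) : s ≠ 0 := by
  rintro rfl
  have := H.sq
  have h := mul_ne_zero hpp.out.ne_zero hqp.out.ne_zero
  rw [zero_pow two_ne_zero, eq_comm, neg_eq_zero, Nat.cast_eq_zero] at this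
  exact h this

theorem isIntegral (H : ImaginaryQuadratic p q s J) : IsIntegral ℤ s := by
  refine IsIntegral.of_pow two_pos ?_
  rw [H.sq]
  exact (by simpa using (isIntegral_algebraMap (R := ℤ) (A := F) (x := ((p * q : ℕ) : ℤ))) :
    IsIntegral ℤ ((p * q : ℕ) : F)).neg

theorem eq_zero_of_add_mul_eq_zero (H : ImaginaryQuadratic p q s J) {u v : ℚ}
    (h : (u : F) + v * s = 0) : u = 0 ∧ v = 0 := by
  have h2 := congrArg J h
  rw [H.conj_apply, map_zero] at h2
  have h3 : (u : F) = 0 := by linear_combination h / 2 + h2 / 2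
  refine ⟨by exact_mod_cast h3, ?_⟩
  rw [h3, zero_add] at h
  exact_mod_cast (mul_eq_zero.1 h).resolve_right H.ne_zero

theorem ext (H : ImaginaryQuadratic p q s J) {u v u' v' : ℚ}
    (h : (u : F) + v * s = u' + v' * s) : u = u' ∧ v = v' := by
  have := H.eq_zero_of_add_mul_eq_zero (u := u - u') (v := v - v')
    (by push_cast; linear_combination h)
  exact ⟨sub_eq_zero.1 this.1, sub_eq_zero.1 this.2⟩

theorem exists_int_repr (H : ImaginaryQuadratic p q s J) (hpq : p ≠ q) (h4 : p * q % 4 = 3)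
    {x : F} (hx : IsIntegral ℤ x) : ∃ X Y : ℤ, 2 ∣ X - Y ∧ 2 * x = X + Y * s := by
  obtain ⟨u, v, rfl⟩ := H.all x
  have hJ := isIntegral_map_algEquiv J hx
  rw [H.conj_apply] at hJ
  have hs2 := H.sq
  push_cast at hs2
  obtain ⟨X, hX⟩ := exists_int_of_isIntegral (F := F) (r := 2 * u) (by
    have h := hx.add hJ
    rwa [show (u : F) + v * s + (u - v * s) = ((2 * u : ℚ) : F) by push_cast; ring] at h)
  obtain ⟨Z, hZ⟩ := exists_int_of_isIntegral (F := F) (r := -(2 * v * (p * q))) (by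
    have h := H.isIntegral.mul (hx.sub hJ)
    rwa [show s * ((u : F) + v * s - (u - v * s)) = ((-(2 * v * (p * q)) : ℚ) : F) by
      push_cast; linear_combination 2 * v * hs2] at h)
  obtain ⟨W, hW⟩ := exists_int_of_isIntegral (F := F) (r := -(4 * v ^ 2 * (p * q))) (by
    have h := (hx.sub hJ).pow 2
    rwa [show ((u : F) + v * s - (u - v * s)) ^ 2 = ((-(4 * v ^ 2 * (p * q)) : ℚ) : F) by
      push_cast; linear_combination 4 * v ^ 2 * hs2] at h)
  obtain ⟨n, hn⟩ := exists_int_of_isIntegral (F := F) (r := u ^ 2 + p * q * v ^ 2) (by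
    have h := hx.mul hJ
    rwa [show ((u : F) + v * s) * (u - v * s) = ((u ^ 2 + p * q * v ^ 2 : ℚ) : F) by
      push_cast; linear_combination -v ^ 2 * hs2] at h)
  have hZW : Z ^ 2 = (p * q) * (-W) := by
    have : (Z : ℚ) ^ 2 = (p * q) * (-W) := by rw [← hZ, ← hW]; ring
    exact_mod_cast this
  have hpq0 : (p * q : ℚ) ≠ 0 := by
    exact_mod_cast mul_ne_zero hpp.out.ne_zero hqp.out.ne_zero
  have hdvd : (p : ℤ) * q ∣ Z := by
    have hcop : IsCoprime (p : ℤ) q :=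
      Nat.isCoprime_iff_coprime.2 ((Nat.coprime_primes hpp.out hqp.out).2 hpq)
    refine hcop.mul_dvd ?_ ?_
    · exact (Nat.prime_iff_prime_int.1 hpp.out).dvd_of_dvd_pow (n := 2)
        ⟨q * -W, by rw [hZW]; ring⟩
    · exact (Nat.prime_iff_prime_int.1 hqp.out).dvd_of_dvd_pow (n := 2)
        ⟨p * -W, by rw [hZW]; ring⟩
  obtain ⟨Y', hY'⟩ := hdvd
  have hv : 2 * v = ((-Y' : ℤ) : ℚ) := by
    have : (p * q : ℚ) * (2 * v) = p * q * ((-Y' : ℤ) : ℚ) := by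
      have h5 : (Z : ℚ) = p * q * Y' := by exact_mod_cast congrArg (Int.cast : ℤ → ℚ) hY'
      push_cast
      linear_combination -hZ - h5
    exact mul_left_cancel₀ hpq0 this
  refine ⟨X, -Y', ?_, ?_⟩
  · have h5 : X ^ 2 + p * q * (-Y') ^ 2 = 4 * n := by
      have : (X : ℚ) ^ 2 + p * q * ((-Y' : ℤ) : ℚ) ^ 2 = 4 * n := by
        rw [← hX, ← hv, ← hn]; ring
      exact_mod_cast this
    obtain ⟨k, hk⟩ : ∃ k : ℤ, (p : ℤ) * q = 4 * k + 3 := ⟨(p * q : ℕ) / 4, by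
      have : (p * q : ℕ) = 4 * ((p * q : ℕ) / 4) + 3 := by omega
      exact_mod_cast this⟩
    rw [hk] at h5
    by_contra hodd
    have h6 : (X - -Y') ^ 2 = 4 * (n - (k + 1) * Y' ^ 2 ) + 2 * (Y' * Y' + X * Y') := by
      linear_combination h5
    have h7 : Odd ((X - -Y') ^ 2) := by
      apply Odd.pow
      rwa [← Int.not_even_iff_odd, even_iff_two_dvd]
    rw [h6] at h7
    exact Int.not_odd_iff_even.2 ⟨2 * (n - (k + 1) * Y' ^ 2) + (Y' * Y' + X * Y'), by ring⟩ h7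
  · have h5 : (2 : F) * u = X := by exact_mod_cast congrArg (Rat.cast : ℚ → F) hX
    have h6 : (2 : F) * v = ((-Y' : ℤ) : F) := by exact_mod_cast congrArg (Rat.cast : ℚ → F) hv
    linear_combination h5 + s * h6

theorem isIntegral_half (H : ImaginaryQuadratic p q s J) (h4 : p * q % 4 = 3) {x : F} {X Y : ℤ}
    (hXY : 2 ∣ X - Y) (hx : 2 * x = X + Y * s) : IsIntegral ℤ x := by
  obtain ⟨k, hk⟩ : ∃ k : ℤ, (p : ℤ) * q = 4 * k + 3 := ⟨(p * q : ℕ) / 4, by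
    have : (p * q : ℕ) = 4 * ((p * q : ℕ) / 4) + 3 := by omega
    exact_mod_cast this⟩
  obtain ⟨e, he⟩ := hXY
  obtain rfl : X = Y + 2 * e := by linear_combination he
  have hs2 := H.sq
  push_cast at hs2
  have hk' : (p : F) * q = 4 * k + 3 := by exact_mod_cast congrArg (Int.cast : ℤ → F) hk
  let ω : F := (1 + s) / 2
  have hω : IsIntegral ℤ ω := by
    refine ⟨Polynomial.X ^ 2 - Polynomial.X + Polynomial.C (k + 1), ?_, ?_⟩
    · monicity!
    · have : Polynomial.eval₂ (algebraMap ℤ F) ω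
          (Polynomial.X ^ 2 - Polynomial.X + Polynomial.C (k + 1)) = ω ^ 2 - ω + (k + 1) := by
        simp only [Polynomial.eval₂_add, Polynomial.eval₂_sub, Polynomial.eval₂_pow,
          Polynomial.eval₂_X, Polynomial.eval₂_C]
        simp
      rw [this]
      simp only [ω]
      linear_combination (hs2 + hk' * (-1)) / 4
  have : x = e + Y * ω := by
    simp only [ω]
    push_cast at hx
    linear_combination hx / 2
  rw [this]
  have h_int : ∀ m : ℤ, IsIntegral ℤ (m : F) := fun m => by
    simpa using (isIntegral_algebraMap (R := ℤ) (A := F) (x := m))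
  exact (h_int e).add ((h_int Y).mul hω)

theorem finrank_eq (H : ImaginaryQuadratic p q s J) : Module.finrank ℚ F = 2 := by
  let b : (ℚ × ℚ) →ₗ[ℚ] F :=
    { toFun := fun a => a.1 + a.2 * s
      map_add' := fun a c => by simp only [Prod.fst_add, Prod.snd_add]; push_cast; ring
      map_smul' := fun a c => by
        rw [Prod.smul_fst, Prod.smul_snd, smul_eq_mul, smul_eq_mul, RingHom.id_apply,
          Algebra.smul_def, eq_ratCast]
        push_cast; ring }
  have hb : Function.Bijective b := by
    refine ⟨fun a c h => ?_, fun x => ?_⟩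
    · exact Prod.ext (H.ext h).1 (H.ext h).2
    · obtain ⟨u, v, h⟩ := H.all x
      exact ⟨(u, v), h.symm⟩
  rw [← (LinearEquiv.ofBijective b hb).finrank_eq]
  simp

theorem absNorm_span (H : ImaginaryQuadratic p q s J) {x : 𝓞 F} {n : ℤ}
    (hn : (x : F) * J x = n) : Ideal.absNorm (Ideal.span {x}) = n.natAbs := by
  rw [Ideal.absNorm_span_singleton]
  have h1 : Algebra.norm ℚ ((x : F) * J x) = (Algebra.norm ℚ (x : F)) ^ 2 := by
    rw [map_mul, Algebra.norm_eq_of_algEquiv, pow_two]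
  rw [hn] at h1
  have h2 : Algebra.norm ℚ (n : F) = (n : ℚ) ^ 2 := by
    rw [show (n : F) = algebraMap ℚ F n by simp, Algebra.norm_algebraMap, H.finrank_eq]
  rw [h2, ← Algebra.coe_norm_int] at h1
  have h3 : n ^ 2 = (Algebra.norm ℤ x) ^ 2 := by exact_mod_cast h1
  exact (Int.natAbs_eq_iff_sq_eq.2 h3).symm

end ImaginaryQuadratic

end QuadraticField

end

section

open NumberField IsDedekindDomain
open scoped nonZeroDivisors

section QuadraticPrimes

variable {F : Type*} [Field F] [NumberField F]

theorem RingOfIntegers.coe_two_mul (z : 𝓞 F) : ((2 * z : 𝓞 F) : F) = 2 * (z : F) := by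
  rw [two_mul, two_mul]; rfl

theorem RingOfIntegers.coe_two_pow (t : ℕ) : (((2 : 𝓞 F) ^ t : 𝓞 F) : F) = 2 ^ t := by
  induction t with
  | zero => rfl
  | succ t ih => rw [pow_succ', RingOfIntegers.coe_two_mul, ih, pow_succ']

theorem Ideal.isCoprime_of_not_dvd {R : Type*} [CommRing R] [IsDedekindDomain R] {I P : Ideal R} (hP : P.IsMaximal)
    (h : ¬P ∣ I) : IsCoprime I P := by
  rw [Ideal.isCoprime_iff_sup_eq]
  by_contra hc
  refine h ?_
  have h1 := hP.eq_of_le hc le_sup_right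
  rw [Ideal.dvd_iff_le, h1]
  exact le_sup_left

namespace ImaginaryQuadratic

variable {p q : ℕ} [hpp : Fact p.Prime] [hqp : Fact q.Prime] {s : F} {J : F ≃ₐ[ℚ] F}

theorem exists_halves (H : ImaginaryQuadratic p q s J) (h8 : p * q % 8 = 7) :
    ∃ ω ω' : 𝓞 F, 2 * (ω : F) = 1 + s ∧ 2 * (ω' : F) = 1 - s ∧ ω + ω' = 1 ∧
      ∃ k : ℤ, ω * ω' = 2 * k := by
  have h4 : p * q % 4 = 3 := by omega
  have h1 : 2 * ((1 + s) / 2) = ((1 : ℤ) : F) + (1 : ℤ) * s := by push_cast; ring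
  have h2 : 2 * ((1 - s) / 2) = ((1 : ℤ) : F) + (-1 : ℤ) * s := by push_cast; ring
  refine ⟨⟨_, H.isIntegral_half h4 (by norm_num) h1⟩,
    ⟨_, H.isIntegral_half h4 (by norm_num) h2⟩, ?_, ?_, RingOfIntegers.ext ?_, ?_⟩
  · change 2 * ((1 + s) / 2) = _; ring
  · change 2 * ((1 - s) / 2) = _; ring
  · change (1 + s) / 2 + (1 - s) / 2 = 1; ring
  · obtain ⟨k, hk⟩ : ∃ k : ℕ, p * q = 8 * k + 7 := ⟨p * q / 8, by omega⟩
    refine ⟨(k : ℤ) + 1, RingOfIntegers.ext ?_⟩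
    have hs2 := H.sq
    rw [hk] at hs2
    push_cast at hs2
    have h3 : (((k : ℤ) + 1 : ℤ) : 𝓞 F) = (((k : ℤ) + 1 : ℤ) : F) := by simp
    rw [RingOfIntegers.coe_two_mul]
    change (1 + s) / 2 * ((1 - s) / 2) = 2 * ((((k : ℤ) + 1 : ℤ) : 𝓞 F) : F)
    rw [h3]
    push_cast
    linear_combination -hs2 / 4

theorem exists_primes_over_two (H : ImaginaryQuadratic p q s J) (hpq : p ≠ q)
    (h8 : p * q % 8 = 7) :
    ∃ A B : HeightOneSpectrum (𝓞 F), A ≠ B ∧ A.asIdeal * B.asIdeal = Ideal.span {2} ∧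
      Ideal.absNorm A.asIdeal = 2 ∧ Ideal.absNorm B.asIdeal = 2 := by
  obtain ⟨ω, ω', h1, h2, h3, k, hk⟩ := H.exists_halves h8
  have h4 : p * q % 4 = 3 := by omega
  have not_dvd : ∀ z : 𝓞 F, ω ≠ 2 * z ∧ ω' ≠ 2 * z := by
    intro z
    obtain ⟨X, Y, -, hXY⟩ := H.exists_int_repr (x := (z : F)) hpq h4 z.2
    constructor <;> intro h <;> have h' := congrArg (fun t : 𝓞 F => (t : F)) h <;>
      simp only [RingOfIntegers.coe_two_mul] at h'
    · have := (H.ext (u := 1) (v := 1) (u' := 2 * X) (v' := 2 * Y) (by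
        push_cast; linear_combination -h1 + 2 * h' + 2 * hXY)).1
      have : (1 : ℤ) = 2 * X := by exact_mod_cast this
      omega
    · have := (H.ext (u := 1) (v := -1) (u' := 2 * X) (v' := 2 * Y) (by
        push_cast; linear_combination -h2 + 2 * h' + 2 * hXY)).1
      have : (1 : ℤ) = 2 * X := by exact_mod_cast this
      omega
  let A : Ideal (𝓞 F) := Ideal.span {2, ω}
  let B : Ideal (𝓞 F) := Ideal.span {2, ω'}
  have h2A : (2 : 𝓞 F) ∈ A := Ideal.subset_span (by simp)
  have hωA : ω ∈ A := Ideal.subset_span (by simp)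
  have h2B : (2 : 𝓞 F) ∈ B := Ideal.subset_span (by simp)
  have hωB : ω' ∈ B := Ideal.subset_span (by simp)
  have hAB : A * B = Ideal.span {2} := by
    apply le_antisymm
    · rw [Ideal.span_pair_mul_span_pair, Ideal.span_le]
      rintro x (rfl | rfl | rfl | rfl)
      · exact Ideal.mul_mem_left _ _ (Ideal.mem_span_singleton_self 2)
      · exact Ideal.mul_mem_right _ _ (Ideal.mem_span_singleton_self 2)
      · exact Ideal.mul_mem_left _ _ (Ideal.mem_span_singleton_self 2)
      · rw [hk]; exact Ideal.mul_mem_right _ _ (Ideal.mem_span_singleton_self 2)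
    · rw [Ideal.span_singleton_le_iff_mem]
      have := (A * B).add_mem (Ideal.mul_mem_mul h2A hωB) (Ideal.mul_mem_mul hωA h2B)
      rwa [show 2 * ω' + ω * 2 = (2 : 𝓞 F) by linear_combination 2 * h3] at this
  have hA1 : A ≠ ⊤ := fun h => by
    rw [h, Ideal.top_mul] at hAB
    rw [hAB] at hωB
    obtain ⟨z, hz⟩ := Ideal.mem_span_singleton.1 hωB
    exact (not_dvd z).2 hz
  have hB1 : B ≠ ⊤ := fun h => by
    rw [h, Ideal.mul_top] at hAB
    rw [hAB] at hωA
    obtain ⟨z, hz⟩ := Ideal.mem_span_singleton.1 hωA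
    exact (not_dvd z).1 hz
  have hN : Ideal.absNorm A * Ideal.absNorm B = 4 := by
    rw [← map_mul, hAB]
    have := H.absNorm_span (x := 2) (n := 4) (by
      simp only [map_ofNat]; norm_num)
    simpa using this
  have hNA : Ideal.absNorm A ≠ 1 := fun h => hA1 (Ideal.absNorm_eq_one_iff.1 h)
  have hNB : Ideal.absNorm B ≠ 1 := fun h => hB1 (Ideal.absNorm_eq_one_iff.1 h)
  have hNA2 : Ideal.absNorm A = 2 := by
    have : Ideal.absNorm A ≤ 4 := Nat.le_of_dvd (by norm_num) ⟨_, hN.symm⟩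
    interval_cases Ideal.absNorm A <;> omega
  have hNB2 : Ideal.absNorm B = 2 := by rw [hNA2] at hN; omega
  have hA0 : A ≠ ⊥ := fun h => two_ne_zero (α := 𝓞 F) (by simp [h] at h2A)
  have hB0 : B ≠ ⊥ := fun h => two_ne_zero (α := 𝓞 F) (by simp [h] at h2B)
  refine ⟨⟨A, Ideal.isPrime_of_irreducible_absNorm (by rw [hNA2]; exact Nat.prime_two), hA0⟩,
    ⟨B, Ideal.isPrime_of_irreducible_absNorm (by rw [hNB2]; exact Nat.prime_two), hB0⟩,
    fun h => hA1 ?_, hAB, hNA2, hNB2⟩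
  have h : A = B := congrArg HeightOneSpectrum.asIdeal h
  rw [Ideal.eq_top_iff_one, ← h3]
  exact A.add_mem hωA (h ▸ hωB)

theorem exists_norm_repr (H : ImaginaryQuadratic p q s J) {x : F} {X Y : ℤ}
    (hx : 2 * x = X + Y * s) : 4 * (x * J x) = ((X ^ 2 + p * q * Y ^ 2 : ℤ) : F) := by
  have h := congrArg J hx
  rw [map_mul, map_add, map_mul, map_intCast, map_intCast, H.conj, map_ofNat] at h
  have hs2 := H.sq
  push_cast at hs2 ⊢
  linear_combination hx * (2 * J x) + (X + Y * s) * h - Y ^ 2 * hs2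

theorem two_dvd_sub {h4 : p * q % 4 = 3} {X Y n : ℤ} (h : X ^ 2 + p * q * Y ^ 2 = 2 * n) :
    2 ∣ X - Y := by
  obtain ⟨k, hk⟩ : ∃ k : ℤ, (p : ℤ) * q = 4 * k + 3 := ⟨(p * q : ℕ) / 4, by
    have : (p * q : ℕ) = 4 * ((p * q : ℕ) / 4) + 3 := by omega
    exact_mod_cast this⟩
  rw [hk] at h
  have h1 : 2 ∣ (X - Y) ^ 2 :=
    ⟨n - (2 * k + 1) * Y ^ 2 - X * Y, by linear_combination h⟩
  exact Int.prime_two.dvd_of_dvd_pow h1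

theorem pow_eq_one_of_twoPowNorm (H : ImaginaryQuadratic p q s J) (hpq : p ≠ q)
    (h8 : p * q % 8 = 7) {A B : HeightOneSpectrum (𝓞 F)} (hne : A ≠ B)
    (hAB : A.asIdeal * B.asIdeal = Ideal.span {2}) (hA : Ideal.absNorm A.asIdeal = 2)
    (hB : Ideal.absNorm B.asIdeal = 2) {t : ℕ} (ht : TwoPowNorm (p * q) t) :
    (A.asIdeal ^ t).IsPrincipal ∨ (B.asIdeal ^ t).IsPrincipal := by
  have h4 : p * q % 4 = 3 := by omega
  obtain ⟨x, y, hx, h⟩ := ht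
  push_cast at h
  have hxy : (2 : ℤ) ∣ x - y := two_dvd_sub (h4 := h4) (n := 2 ^ (t + 1)) (by rw [h]; ring)
  have hγ : 2 * (((x : F) + y * s) / 2) = (x : F) + y * s := by ring
  let γ : 𝓞 F := ⟨_, H.isIntegral_half h4 hxy hγ⟩
  have hγ' : 2 * (γ : F) = (x : F) + y * s := hγ
  have hγγ : (γ : F) * J γ = ((2 ^ t : ℤ) : F) := by
    have h1 := H.exists_norm_repr hγ'
    rw [h] at h1
    push_cast at h1 ⊢
    linear_combination h1 / 4
  have hN : Ideal.absNorm (Ideal.span {γ}) = 2 ^ t := by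
    rw [H.absNorm_span hγγ]; simp
  let γ' : 𝓞 F := ⟨J γ, isIntegral_map_algEquiv J γ.2⟩
  have hdvd : Ideal.span {γ} ∣ A.asIdeal ^ t * B.asIdeal ^ t := by
    refine ⟨Ideal.span {γ'}, ?_⟩
    rw [← mul_pow, hAB, Ideal.span_singleton_pow, Ideal.span_singleton_mul_span_singleton]
    congr 2
    apply RingOfIntegers.ext
    rw [RingOfIntegers.coe_two_pow]
    exact_mod_cast hγγ.symm
  have hnot : ¬(Ideal.span {2} ∣ Ideal.span {γ}) := by
    intro h
    rw [Ideal.dvd_span_singleton, Ideal.mem_span_singleton] at h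
    obtain ⟨z, hz⟩ := h
    obtain ⟨X, Y, -, hXY⟩ := H.exists_int_repr (x := (z : F)) hpq h4 z.2
    have hz' : (γ : F) = 2 * z := by rw [hz, RingOfIntegers.coe_two_mul]
    have := (H.ext (u := x) (v := y) (u' := 2 * X) (v' := 2 * Y) (by
      push_cast; linear_combination -hγ' + 2 * hz' + 2 * hXY)).1
    have : x = 2 * X := by exact_mod_cast this
    rw [this] at hx
    exact Int.not_odd_iff_even.2 (even_two_mul X) hx
  have hcop : IsCoprime A.asIdeal B.asIdeal :=
    haveI := A.isMaximal
    haveI := B.isMaximal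
    Ideal.isCoprime_of_isMaximal fun h => hne (HeightOneSpectrum.ext h)
  have final : ∀ P : Ideal (𝓞 F), Ideal.absNorm P = 2 → Ideal.span {γ} ∣ P ^ t →
      (P ^ t).IsPrincipal := by
    rintro P hP ⟨Q, hQ⟩
    have := congrArg Ideal.absNorm hQ
    rw [map_pow, hP, map_mul, hN] at this
    have hQ1 : Ideal.absNorm Q = 1 := by
      have h2 : 0 < 2 ^ t := by positivity
      nlinarith
    rw [Ideal.absNorm_eq_one_iff] at hQ1
    rw [hQ, hQ1, Ideal.mul_top]
    exact ⟨γ, rfl⟩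
  by_cases hAγ : A.asIdeal ∣ Ideal.span {γ}
  · left
    refine final _ hA (IsCoprime.dvd_of_dvd_mul_right ?_ hdvd)
    apply IsCoprime.pow_right
    by_contra hc
    apply hnot
    rw [← hAB]
    refine hcop.mul_dvd hAγ ?_
    by_contra hBγ
    exact hc (Ideal.isCoprime_of_not_dvd B.isMaximal hBγ)
  · right
    refine final _ hB (IsCoprime.dvd_of_dvd_mul_left ?_ hdvd)
    apply IsCoprime.pow_right
    exact Ideal.isCoprime_of_not_dvd A.isMaximal hAγ

theorem twoPowNorm_of_isPrincipal (H : ImaginaryQuadratic p q s J) (hpq : p ≠ q)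
    (h8 : p * q % 8 = 7) {A B : HeightOneSpectrum (𝓞 F)} (hne : A ≠ B)
    (hAB : A.asIdeal * B.asIdeal = Ideal.span {2}) (hA : Ideal.absNorm A.asIdeal = 2)
    {D : ℕ} (hD : 1 ≤ D) (h : (A.asIdeal ^ D).IsPrincipal) : TwoPowNorm (p * q) D := by
  have h4 : p * q % 4 = 3 := by omega
  obtain ⟨γ, hγ⟩ := h
  have hγ' : A.asIdeal ^ D = Ideal.span {γ} := hγ
  obtain ⟨X, Y, hXY, hXY'⟩ := H.exists_int_repr (x := (γ : F)) hpq h4 γ.2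
  have hn4 := H.exists_norm_repr hXY'
  have h_int : ((γ : F) * J γ) = (((X ^ 2 + p * q * Y ^ 2 : ℤ) / 4 : ℚ) : F) := by
    rw [Rat.cast_div, Rat.cast_intCast, ← hn4, Rat.cast_ofNat]; ring
  obtain ⟨n, hn⟩ := exists_int_of_isIntegral (F := F)
    (r := ((X ^ 2 + p * q * Y ^ 2 : ℤ) / 4 : ℚ))
    (h_int ▸ (γ.2.mul (isIntegral_map_algEquiv J γ.2) : IsIntegral ℤ ((γ : F) * J γ)))
  have hn' : X ^ 2 + p * q * Y ^ 2 = 4 * n := by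
    have : ((X ^ 2 + p * q * Y ^ 2 : ℤ) : ℚ) = 4 * n := by linarith
    exact_mod_cast this
  have hn0 : 0 ≤ n := by
    have : 0 ≤ X ^ 2 + p * q * Y ^ 2 := by positivity
    omega
  have hN := H.absNorm_span (x := γ) (n := n) (by rw [h_int, hn]; simp)
  rw [← hγ', map_pow, hA] at hN
  have hn2 : n = 2 ^ D := by
    rw [← Int.natAbs_of_nonneg hn0, ← hN]; simp
  have hfin : X ^ 2 + p * q * Y ^ 2 = 2 ^ (D + 2) := by rw [hn', hn2]; ring
  refine ⟨X, Y, ?_, by push_cast; exact hfin⟩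
  by_contra hX
  rw [Int.not_odd_iff_even, even_iff_two_dvd] at hX
  have hY : (2 : ℤ) ∣ Y := by
    have := dvd_sub hX hXY
    rwa [sub_sub_cancel] at this
  obtain ⟨X', rfl⟩ := hX
  obtain ⟨Y', rfl⟩ := hY
  have hXY2 : 2 ∣ X' - Y' := two_dvd_sub (h4 := h4) (n := 2 ^ (D - 1)) (by
    obtain ⟨e, rfl⟩ : ∃ e, D = e + 1 := ⟨D - 1, by omega⟩
    have : (4 : ℤ) * (X' ^ 2 + p * q * Y' ^ 2) = 4 * (2 * 2 ^ e) := by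
      linear_combination hfin
    rw [Nat.add_sub_cancel]
    linarith)
  push_cast at hXY'
  have hz := H.isIntegral_half h4 (x := (γ : F) / 2) hXY2 (by
    linear_combination hXY' / 2)
  have h2γ : γ ∈ Ideal.span {(2 : 𝓞 F)} := by
    rw [Ideal.mem_span_singleton]
    let z : 𝓞 F := ⟨(γ : F) / 2, hz⟩
    refine ⟨z, RingOfIntegers.ext ?_⟩
    have h : (z : F) = (γ : F) / 2 := rfl
    rw [RingOfIntegers.coe_two_mul, h]
    ring
  have hle : A.asIdeal ^ D ≤ B.asIdeal := by
    rw [hγ', Ideal.span_singleton_le_iff_mem]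
    have h3 : A.asIdeal * B.asIdeal ≤ B.asIdeal := Ideal.mul_le_right
    rw [hAB] at h3
    exact h3 h2γ
  haveI := B.isPrime
  have := Ideal.IsPrime.le_of_pow_le hle
  exact hne (HeightOneSpectrum.ext (A.isMaximal.eq_of_le B.isPrime.ne_top this))

theorem eq_or_eq_of_two_mem {A B : HeightOneSpectrum (𝓞 F)}
    (hAB : A.asIdeal * B.asIdeal = Ideal.span {2}) (v : HeightOneSpectrum (𝓞 F))
    (hv : (2 : 𝓞 F) ∈ v.asIdeal) : v = A ∨ v = B := by
  have h : A.asIdeal * B.asIdeal ≤ v.asIdeal := by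
    rw [hAB, Ideal.span_singleton_le_iff_mem]; exact hv
  rcases v.isPrime.mul_le.1 h with h | h
  · exact Or.inl (HeightOneSpectrum.ext (A.isMaximal.eq_of_le v.isPrime.ne_top h).symm)
  · exact Or.inr (HeightOneSpectrum.ext (B.isMaximal.eq_of_le v.isPrime.ne_top h).symm)

end ImaginaryQuadratic

end QuadraticPrimes

end

section

open NumberField IsDedekindDomain
open scoped nonZeroDivisors

section QuadraticBase

variable {F : Type*} [Field F] [NumberField F]

theorem mem_twoIntegers_of_sq_mem {K : IntermediateField ℚ F} {y : F} (hy : y ∈ K)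
    (h : y ^ 2 ∈ twoIntegers K) : y ∈ twoIntegers K := by
  obtain ⟨-, N, hN⟩ := h
  refine ⟨hy, N, IsIntegral.of_pow two_pos ?_⟩
  rw [show (2 ^ N * y) ^ 2 = 2 ^ N * (2 ^ N * y ^ 2) by ring]
  exact (isIntegral_two.pow N).mul hN

namespace ImaginaryQuadratic

variable {p q : ℕ} [hpp : Fact p.Prime] [hqp : Fact q.Prime] {s : F} {J : F ≃ₐ[ℚ] F}

/-- The conjugation on `2`-integers. -/
def conjTwoIntegers (J : F ≃ₐ[ℚ] F) (x : twoIntegers (⊤ : IntermediateField ℚ F)) :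
    twoIntegers (⊤ : IntermediateField ℚ F) :=
  ⟨J x, map_mem_twoIntegers J IntermediateField.mem_top x.2⟩

/-- The generator as a `2`-integer. -/
def root (H : ImaginaryQuadratic p q s J) : twoIntegers (⊤ : IntermediateField ℚ F) :=
  ⟨s, mem_twoIntegers_of_isIntegral IntermediateField.mem_top H.isIntegral⟩

theorem root_sq (H : ImaginaryQuadratic p q s J) : H.root * H.root = -((p : ℤ) * (q : ℤ) : ℤ) := by
  apply Subtype.ext
  have h := H.sq
  push_cast at h ⊢
  rw [← h, pow_two]; rfl

theorem exists_span_pair_eq (H : ImaginaryQuadratic p q s J) {y₁ y₂ : ℤ} {t : ℕ}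
    (hy : p * y₁ ^ 2 + q * y₂ ^ 2 = 2 ^ t) {f : ℤ} (hf : f ∣ p * q) :
    ∃ δ α β g h : twoIntegers (⊤ : IntermediateField ℚ F),
      δ = α * (f : ℤ) + β * H.root ∧ ((f : ℤ) : twoIntegers (⊤ : IntermediateField ℚ F)) = g * δ ∧
      H.root = h * δ := by
  have hs := H.root_sq
  set r := H.root
  obtain ⟨w, hw⟩ := (isUnit_two_twoIntegers (⊤ : IntermediateField ℚ F)).exists_right_inv
  have hwt : (2 : twoIntegers (⊤ : IntermediateField ℚ F)) ^ t * w ^ t = 1 := by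
    rw [← mul_pow, hw, one_pow]
  have hy' := congrArg (Int.cast : ℤ → twoIntegers (⊤ : IntermediateField ℚ F)) hy
  push_cast at hy' hs
  have key : ∀ n : ℕ, n ∣ p * q → ∃ δ α β g h : twoIntegers (⊤ : IntermediateField ℚ F),
      δ = α * n + β * r ∧ ((n : ℕ) : twoIntegers (⊤ : IntermediateField ℚ F)) = g * δ ∧
      r = h * δ := by
    intro n hn
    obtain ⟨k₁, k₂, h1, h2, rfl⟩ := (Nat.dvd_mul).1 hn
    rcases (Nat.dvd_prime hpp.out).1 h1 with rfl | rfl <;>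
      rcases (Nat.dvd_prime hqp.out).1 h2 with rfl | rfl
    · exact ⟨1, 1, 0, 1, r, by simp, by simp, by simp⟩
    · refine ⟨k₂ * y₂ + y₁ * r, y₂, y₁, (k₂ * y₂ - y₁ * r) * w ^ t, (r * y₂ + p * y₁) * w ^ t,
        ?_, ?_, ?_⟩
      · push_cast; ring
      · push_cast
        linear_combination (-k₂ : twoIntegers (⊤ : IntermediateField ℚ F)) * hwt
          - k₂ * w ^ t * hy' + y₁ ^ 2 * w ^ t * hs
      · linear_combination (-r) * hwt - r * w ^ t * hy' - y₁ * y₂ * w ^ t * hs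
    · refine ⟨k₁ * y₁ + y₂ * r, y₁, y₂, (k₁ * y₁ - y₂ * r) * w ^ t, (r * y₁ + q * y₂) * w ^ t,
        ?_, ?_, ?_⟩
      · push_cast; ring
      · push_cast
        linear_combination (-k₁ : twoIntegers (⊤ : IntermediateField ℚ F)) * hwt
          - k₁ * w ^ t * hy' + y₂ ^ 2 * w ^ t * hs
      · linear_combination (-r) * hwt - r * w ^ t * hy' - y₁ * y₂ * w ^ t * hs
    · exact ⟨r, 0, 1, -r, 1, by simp, by push_cast; linear_combination hs, by simp⟩
  obtain ⟨n, rfl | rfl⟩ := f.eq_nat_or_neg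
  · have := key n (by exact_mod_cast hf)
    simpa using this
  · obtain ⟨δ, α, β, g, h, h1, h2, h3⟩ := key n (by
      rw [Int.neg_dvd] at hf; exact_mod_cast hf)
    refine ⟨δ, -α, β, -g, h, ?_, ?_, h3⟩
    · push_cast; rw [neg_mul_neg]; exact h1
    · push_cast; rw [h2]; ring

theorem exists_span_of_conj_mem (H : ImaginaryQuadratic p q s J) (hpq : p ≠ q)
    (h4 : p * q % 4 = 3) {y₁ y₂ : ℤ} {t : ℕ}
    (hy : p * y₁ ^ 2 + q * y₂ ^ 2 = 2 ^ t) (W : Ideal (twoIntegers (⊤ : IntermediateField ℚ F)))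
    (hW : ∀ x ∈ W, conjTwoIntegers J x ∈ W) : ∃ w, W = Ideal.span {w} := by
  obtain ⟨i2, hi2⟩ := (isUnit_two_twoIntegers (⊤ : IntermediateField ℚ F)).exists_right_inv
  have cancel : ∀ (W : Ideal (twoIntegers (⊤ : IntermediateField ℚ F))) (N : ℕ)
      (x : twoIntegers (⊤ : IntermediateField ℚ F)), 2 ^ N * x ∈ W → x ∈ W := fun W N x hx => by
    have := W.mul_mem_left (i2 ^ N) hx
    rwa [← mul_assoc, ← mul_pow, mul_comm i2, hi2, one_pow, one_mul] at this
  have hs := H.root_sq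
  let A : Ideal ℤ := W.comap (Int.castRingHom _)
  let B : Ideal ℤ :=
    { carrier := {v | (v : twoIntegers (⊤ : IntermediateField ℚ F)) * H.root ∈ W}
      zero_mem' := by simp
      add_mem' := fun {a b} ha hb => by
        have := W.add_mem ha hb
        rw [← add_mul, ← Int.cast_add] at this
        exact this
      smul_mem' := fun c a ha => by
        have := W.mul_mem_left (c : twoIntegers (⊤ : IntermediateField ℚ F)) ha
        rw [← mul_assoc, ← Int.cast_mul] at this
        exact this }
  have hB : ∀ v : ℤ, v ∈ B ↔ (v : twoIntegers (⊤ : IntermediateField ℚ F)) * H.root ∈ W :=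
    fun v => Iff.rfl
  have hA : ∀ v : ℤ, v ∈ A ↔ (v : twoIntegers (⊤ : IntermediateField ℚ F)) ∈ W :=
    fun v => Iff.rfl
  obtain ⟨c, hc⟩ := (IsPrincipalIdealRing.principal A).principal
  obtain ⟨e, he⟩ := (IsPrincipalIdealRing.principal B).principal
  have hcA : c ∈ A := by rw [hc]; exact Submodule.mem_span_singleton_self c
  have heB : e ∈ B := by rw [he]; exact Submodule.mem_span_singleton_self e
  have memA : ∀ v : ℤ, v ∈ A → c ∣ v := fun v hv => by
    rw [hc] at hv; exact Ideal.mem_span_singleton.1 hv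
  have memB : ∀ v : ℤ, v ∈ B → e ∣ v := fun v hv => by
    rw [he] at hv; exact Ideal.mem_span_singleton.1 hv
  have hec : e ∣ c := memB c ((hB c).2 (W.mul_mem_right _ ((hA c).1 hcA)))
  have hce : c ∣ p * q * e := memA _ (by
    rw [hA]
    have := W.mul_mem_right (-H.root) ((hB e).1 heB)
    rw [mul_assoc, mul_neg, hs, neg_neg, ← Int.cast_mul, mul_comm e] at this
    exact this)
  have hgen : W = Ideal.span {(c : twoIntegers (⊤ : IntermediateField ℚ F)), e * H.root} := by
    apply le_antisymm
    · intro x hx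
      obtain ⟨-, k, hk⟩ := x.2
      obtain ⟨X, Y, -, hXY⟩ := H.exists_int_repr hpq h4 hk
      have h1 : 2 ^ (k + 1) * x = X + Y * H.root := Subtype.ext (by
        push_cast
        rw [pow_succ', mul_assoc]
        exact hXY)
      have h2 : 2 ^ (k + 1) * conjTwoIntegers J x = X - Y * H.root := Subtype.ext (by
        have h := congrArg J hXY
        rw [map_mul, map_mul, map_pow, map_ofNat, map_add, map_mul, map_intCast, map_intCast,
          H.conj, mul_neg, ← sub_eq_add_neg, ← mul_assoc, ← pow_succ'] at h
        push_cast
        exact h)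
      have h3 := W.mul_mem_left (2 ^ (k + 1)) hx
      have h4 := W.mul_mem_left (2 ^ (k + 1)) (hW x hx)
      have hX : c ∣ X := memA _ ((hA X).2 (cancel W 1 _ (by
        have := W.add_mem h3 h4
        rw [h1, h2] at this
        convert this using 1; ring)))
      have hY : e ∣ Y := memB _ ((hB Y).2 (cancel W 1 _ (by
        have := W.sub_mem h3 h4
        rw [h1, h2] at this
        convert this using 1; ring)))
      obtain ⟨X, rfl⟩ := hX
      obtain ⟨Y, rfl⟩ := hY
      refine cancel _ (k + 1) _ ?_
      rw [h1, Ideal.mem_span_pair]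
      exact ⟨X, Y, by push_cast; ring⟩
    · rw [Ideal.span_le]
      rintro x (rfl | rfl)
      · exact (hA c).1 hcA
      · exact (hB e).1 heB
  obtain ⟨f, rfl⟩ := hec
  by_cases he0 : e = 0
  · refine ⟨0, ?_⟩
    rw [hgen, he0]
    simp
  have hf : f ∣ p * q := by
    rw [mul_comm ((p : ℤ) * q)] at hce
    exact (mul_dvd_mul_iff_left he0).1 hce
  obtain ⟨δ, α, β, g, h, h1, h2, h3⟩ := H.exists_span_pair_eq hy hf
  refine ⟨e * δ, ?_⟩
  rw [hgen]
  apply le_antisymm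
  · rw [Ideal.span_le]
    rintro x (rfl | rfl)
    · refine Ideal.mem_span_singleton.2 ⟨g, ?_⟩
      push_cast; rw [h2]; ring
    · refine Ideal.mem_span_singleton.2 ⟨h, ?_⟩
      rw [h3]; ring
  · rw [Ideal.span_singleton_le_iff_mem, Ideal.mem_span_pair]
    exact ⟨α, β, by rw [h1]; push_cast; ring⟩

theorem norm_eq_sq_of_sq_eq_span (H : ImaginaryQuadratic p q s J) (hpq : p ≠ q)
    (h4 : p * q % 4 = 3) (hp : p % 8 = 5)
    {I : Ideal (twoIntegers (⊤ : IntermediateField ℚ F))} {z : 𝓞 F} (hz : z ≠ 0)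
    (hI : I ^ 2 = Ideal.span {toTwoIntegers F z}) :
    ∃ a : ℤ, a ≠ 0 ∧ (z : F) * J z = (a : F) ^ 2 := by
  obtain ⟨X, Y, -, hXY⟩ := H.exists_int_repr (x := (z : F)) hpq h4 z.2
  have hn4 := H.exists_norm_repr hXY
  have h_int : ((z : F) * J z) = (((X ^ 2 + p * q * Y ^ 2 : ℤ) / 4 : ℚ) : F) := by
    rw [Rat.cast_div, Rat.cast_intCast, ← hn4, Rat.cast_ofNat]; ring
  obtain ⟨n, hn⟩ := exists_int_of_isIntegral (F := F)
    (r := ((X ^ 2 + p * q * Y ^ 2 : ℤ) / 4 : ℚ))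
    (h_int ▸ (z.2.mul (isIntegral_map_algEquiv J z.2) : IsIntegral ℤ ((z : F) * J z)))
  have hn' : X ^ 2 + p * q * Y ^ 2 = 4 * n := by
    have : ((X ^ 2 + p * q * Y ^ 2 : ℤ) : ℚ) = 4 * n := by linarith
    exact_mod_cast this
  have hn0 : 0 ≤ n := by
    have : 0 ≤ X ^ 2 + p * q * Y ^ 2 := by positivity
    omega
  have hzn : (z : F) * J z = n := by rw [h_int, hn]; simp
  have hzF : (z : F) ≠ 0 := fun h => hz (RingOfIntegers.ext h)
  have hnne : n ≠ 0 := by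
    rintro rfl
    rw [Int.cast_zero, mul_eq_zero] at hzn
    exact hzn.elim hzF fun h => hzF ((map_eq_zero J).1 h)
  have hN := H.absNorm_span (x := z) (n := n) hzn
  lift n to ℕ using hn0
  rw [Int.natAbs_natCast] at hN
  have h2N : ∀ M : ℕ, Ideal.absNorm (Ideal.span {(2 : 𝓞 F) ^ M}) = 2 ^ (2 * M) := fun M => by
    rw [H.absNorm_span (n := 2 ^ (2 * M))]
    · simp
    · rw [RingOfIntegers.coe_two_pow, map_pow, map_ofNat]; push_cast; ring
  let I₀ := I.comap (toTwoIntegers F)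
  have hmap : (I₀ ^ 2).map (toTwoIntegers F) = (Ideal.span {z}).map (toTwoIntegers F) := by
    rw [Ideal.map_pow, map_comap_toTwoIntegers, hI, Ideal.map_span, Set.image_singleton]
  obtain ⟨M, hM⟩ := exists_two_pow_mul_mem hmap.le
  obtain ⟨M', hM'⟩ := exists_two_pow_mul_mem hmap.ge
  have d1 := Ideal.absNorm_dvd_absNorm_of_le hM
  have d2 := Ideal.absNorm_dvd_absNorm_of_le hM'
  rw [map_mul, map_pow, h2N, hN] at d1 d2
  set c := Ideal.absNorm I₀
  obtain ⟨i, w, hiw⟩ : ∃ i w : ℕ, n * 2 ^ i = w ^ 2 := by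
    obtain ⟨e, he⟩ := d1
    obtain ⟨f, hf⟩ := d2
    have hef : e * f = 2 ^ (2 * M + 2 * M') := by
      have hn0 : 0 < n := Nat.pos_of_ne_zero (by exact_mod_cast hnne)
      refine Nat.eq_of_mul_eq_mul_left hn0 ?_
      rw [pow_add, ← mul_assoc, ← he, mul_assoc, ← hf]
      ring
    obtain ⟨i, -, rfl⟩ := (Nat.dvd_prime_pow Nat.prime_two).1 ⟨f, hef.symm⟩
    exact ⟨i, 2 ^ M * c, by rw [← he]; ring⟩
  have hn0 : n ≠ 0 := by exact_mod_cast hnne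
  rcases i.even_or_odd' with ⟨j, rfl | rfl⟩
  · have hdvd : (2 ^ j) ^ 2 ∣ w ^ 2 := ⟨n, by rw [← hiw]; ring⟩
    obtain ⟨w, rfl⟩ := (Nat.pow_dvd_pow_iff two_ne_zero).1 hdvd
    have hnw : n = w ^ 2 := by
      refine Nat.eq_of_mul_eq_mul_right (show 0 < 2 ^ (2 * j) by positivity) ?_
      rw [hiw]; ring
    refine ⟨w, ?_, ?_⟩
    · rintro h
      rw [Int.natCast_eq_zero] at h
      exact hn0 (by rw [hnw, h]; rfl)
    · rw [hzn, hnw]; push_cast; ring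
  · exfalso
    have hpdq : ¬p ∣ q := fun h => hpq ((Nat.prime_dvd_prime_iff_eq hpp.out hqp.out).1 h)
    have hiw' : (n : ℤ) * 2 ^ (2 * j + 1) = (w : ℤ) ^ 2 := by exact_mod_cast hiw
    have h0 := two_mul_sq_add_eq_sq hp hpdq _ (2 ^ j * X) (2 ^ j * Y) (2 * w) le_rfl (by
      linear_combination 2 * 2 ^ (2 * j) * hn' + 4 * hiw')
    have hw0 : w = 0 := by omega
    rw [hw0] at hiw
    have : n * 2 ^ (2 * j + 1) ≠ 0 := by positivity
    exact this hiw

theorem squarePrincipal (H : ImaginaryQuadratic p q s J) (hpq : p ≠ q)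
    (h4 : p * q % 4 = 3) (hp : p % 8 = 5) {y₁ y₂ : ℤ} {t : ℕ}
    (hy : p * y₁ ^ 2 + q * y₂ ^ 2 = 2 ^ t) :
    SquarePrincipal (twoIntegers (⊤ : IntermediateField ℚ F)) := by
  intro I x hI
  by_cases hx0 : x = 0
  · rw [hx0, Ideal.span_singleton_zero] at hI
    exact ⟨0, by rw [Ideal.span_singleton_zero]; exact pow_eq_zero_iff two_ne_zero |>.1 hI⟩
  obtain ⟨k, z, hz⟩ := exists_toTwoIntegers_eq x
  have hz0 : z ≠ 0 := by
    rintro rfl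
    rw [map_zero, eq_comm] at hz
    have := ((isUnit_two_twoIntegers (⊤ : IntermediateField ℚ F)).pow k).mul_right_eq_zero.1 hz
    exact hx0 this
  have hIz : I ^ 2 = Ideal.span {toTwoIntegers F z} := by
    rw [hI, hz, Ideal.span_singleton_mul_left_unit
      ((isUnit_two_twoIntegers (⊤ : IntermediateField ℚ F)).pow k)]
  obtain ⟨a, ha, hza⟩ := H.norm_eq_sq_of_sq_eq_span hpq h4 hp hz0 hIz
  clear hz hI hx0 x
  set x := toTwoIntegers F z
  have haF : (a : F) ≠ 0 := Int.cast_ne_zero.2 ha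
  have hxa : (x : F) * J x = (a : F) ^ 2 := hza
  have hsq : ∀ i ∈ I, ∃ r : twoIntegers (⊤ : IntermediateField ℚ F), (i : F) ^ 2 = x * r := by
    intro i hi
    have : i ^ 2 ∈ Ideal.span {x} := hIz ▸ Ideal.pow_mem_pow hi 2
    obtain ⟨r, hr⟩ := Ideal.mem_span_singleton.1 this
    exact ⟨r, congrArg Subtype.val hr⟩
  have hR : ∀ i ∈ I, ∀ j ∈ I, (i : F) * J j / a ∈ twoIntegers (⊤ : IntermediateField ℚ F) := by
    intro i hi j hj
    obtain ⟨r, hr⟩ := hsq i hi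
    obtain ⟨r', hr'⟩ := hsq j hj
    refine mem_twoIntegers_of_sq_mem IntermediateField.mem_top ?_
    have h := congrArg J hr'
    rw [map_pow, map_mul] at h
    have : ((i : F) * J j / a) ^ 2 = r * conjTwoIntegers J r' := by
      rw [div_pow, mul_pow, hr, h, ← hxa]
      change _ = r * J r'
      have hx1 : (x : F) ≠ 0 := fun h0 => by
        rw [h0, zero_mul] at hxa; exact pow_ne_zero 2 haF hxa.symm
      have hx2 : J (x : F) ≠ 0 := (map_ne_zero J).2 hx1
      field_simp
    rw [this]
    exact (r * conjTwoIntegers J r').2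
  have hI2 : ∀ i ∈ I, ∀ y ∈ I ^ 2, ∃ w ∈ I, (w : F) = y * J i / a := by
    intro i hi y hy
    rw [pow_two] at hy
    induction hy using Submodule.mul_induction_on' with
    | mem_mul_mem m hm n hn =>
      refine ⟨m * ⟨_, hR n hn i hi⟩, I.mul_mem_right _ hm, ?_⟩
      push_cast; ring
    | add u _ v _ hu hv =>
      obtain ⟨w, hw, h⟩ := hu
      obtain ⟨w', hw', h'⟩ := hv
      refine ⟨w + w', I.add_mem hw hw', ?_⟩
      push_cast; rw [h, h']; ring
  have hIx : ∀ i ∈ I, ∃ w ∈ I, (w : F) = x * J i / a := fun i hi =>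
    hI2 i hi x (hIz ▸ Ideal.mem_span_singleton_self x)
  by_cases hxa0 : (x : F) = -a
  · refine H.exists_span_of_conj_mem hpq h4 hy I fun i hi => ?_
    obtain ⟨w, hw, h⟩ := hIx i hi
    have : conjTwoIntegers J i = -w := Subtype.ext (by
      change J i = -(w : F)
      rw [h, hxa0]; field_simp)
    rw [this]
    exact I.neg_mem hw
  let zz : twoIntegers (⊤ : IntermediateField ℚ F) := a + x
  let zb := conjTwoIntegers J zz
  have hzb : (zb : F) = a + J x := by
    change J ((zz : _) : F) = _
    change J (((a + x : twoIntegers (⊤ : IntermediateField ℚ F))) : F) = _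
    push_cast
    rw [map_add, map_intCast]
  have hzb0 : zb ≠ 0 := by
    intro h
    have h1 := congrArg Subtype.val h
    rw [hzb] at h1
    have h2 := congrArg J h1
    rw [map_add, map_intCast, H.conj_conj] at h2
    apply hxa0
    have h3 : (a : F) + x = 0 := by rw [h2]; exact map_zero J
    linear_combination h3
  obtain ⟨w, hw⟩ := H.exists_span_of_conj_mem hpq h4 hy (Ideal.span {zb} * I) (by
    intro v hv
    obtain ⟨i, hi, rfl⟩ := Ideal.mem_span_singleton_mul.1 hv
    obtain ⟨w, hw, h⟩ := hIx i hi
    refine Ideal.mem_span_singleton_mul.2 ⟨w, hw, Subtype.ext ?_⟩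
    change (zb : F) * w = J ((zb : F) * i)
    rw [hzb, h, map_mul, map_add, map_intCast, H.conj_conj]
    field_simp
    linear_combination J i * hxa)
  have hwm : w ∈ Ideal.span {zb} * I := by rw [hw]; exact Ideal.mem_span_singleton_self w
  obtain ⟨i, hi, rfl⟩ := Ideal.mem_span_singleton_mul.1 hwm
  refine ⟨i, le_antisymm (fun j hj => ?_) ((Ideal.span_singleton_le_iff_mem I).2 hi)⟩
  have : zb * j ∈ Ideal.span {zb * i} :=
    hw ▸ Ideal.mem_span_singleton_mul.2 ⟨j, hj, rfl⟩
  obtain ⟨r, hr⟩ := Ideal.mem_span_singleton.1 this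
  refine Ideal.mem_span_singleton.2 ⟨r, ?_⟩
  rw [mul_assoc] at hr
  exact mul_left_cancel₀ hzb0 hr

end ImaginaryQuadratic

end QuadraticBase

end

section

open NumberField IsDedekindDomain
open scoped nonZeroDivisors

section QuadraticClassNumber

theorem SquarePrincipal.of_ringEquiv {R S : Type*} [CommRing R] [CommRing S] (e : R ≃+* S)
    (h : SquarePrincipal R) : SquarePrincipal S := by
  intro I x hI
  obtain ⟨y, hy⟩ := h (I.comap e) (e.symm x) (by
    have h1 : I.comap e = I.map (e.symm : S →+* R) := (Ideal.map_symm e).symm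
    rw [h1, ← Ideal.map_pow, hI, Ideal.map_span, Set.image_singleton]; rfl)
  refine ⟨e y, ?_⟩
  have := congrArg (Ideal.map (e : R →+* S)) hy
  rw [Ideal.map_span, Set.image_singleton] at this
  exact (Ideal.map_comap_of_surjective (e : R →+* S) e.surjective I).symm.trans this

variable {F : Type*} [Field F] [NumberField F]

/-- The `2`-integers of `K ≤ L` computed inside `K` or inside `L`. -/
noncomputable def twoIntegersTopEquiv (K : IntermediateField ℚ F) :
    twoIntegers (⊤ : IntermediateField ℚ K) ≃+* twoIntegers K :=
  RingEquiv.ofBijective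
    ((K.val.toRingHom.comp (twoIntegers (⊤ : IntermediateField ℚ K)).subtype).codRestrict
      (twoIntegers K) (fun x => ⟨(x : K).2, by
        obtain ⟨-, N, hN⟩ := x.2
        exact ⟨N, hN.map (K.val.restrictScalars ℤ)⟩⟩))
    ⟨fun x y h => Subtype.ext (Subtype.ext (congrArg (fun t : twoIntegers K => (t : F)) h)),
      fun y => by
      obtain ⟨h, N, hN⟩ := y.2
      refine ⟨⟨⟨y, h⟩, IntermediateField.mem_top, N, ?_⟩, Subtype.ext rfl⟩
      exact (isIntegral_algHom_iff (K.val.restrictScalars ℤ) (x := (2 ^ N * ⟨y, h⟩ : K))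
        Subtype.val_injective).1 hN⟩

variable {p q : ℕ} [hpp : Fact p.Prime] [hqp : Fact q.Prime] {s : F}

theorem exists_imaginaryQuadratic (hs : s ^ 2 = -((p * q : ℕ) : F))
    (hall : ∀ x : F, ∃ u v : ℚ, x = u + v * s) : ∃ J, ImaginaryQuadratic p q s J := by
  have hpq : 0 < p * q := Nat.mul_pos hpp.out.pos hqp.out.pos
  have zero : ∀ u v : ℚ, (u : F) + v * s = 0 → u = 0 ∧ v = 0 := by
    intro u v h
    have h2 : ((u ^ 2 + (p * q : ℕ) * v ^ 2 : ℚ) : F) = 0 := by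
      push_cast at hs ⊢
      linear_combination (u - v * s) * h + v ^ 2 * hs
    have h3 : u ^ 2 + (p * q : ℕ) * v ^ 2 = 0 := by exact_mod_cast h2
    have hq : (0 : ℚ) < (p * q : ℕ) := by exact_mod_cast hpq
    have hv : v = 0 := by
      by_contra hv
      have : 0 < v ^ 2 := by positivity
      nlinarith [sq_nonneg u, mul_pos hq this]
    subst hv
    exact ⟨by simpa using h3, rfl⟩
  have uniq : ∀ u v u' v' : ℚ, (u : F) + v * s = u' + v' * s → u = u' ∧ v = v' := by
    intro u v u' v' h
    have := zero (u - u') (v - v') (by push_cast; linear_combination h)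
    exact ⟨sub_eq_zero.1 this.1, sub_eq_zero.1 this.2⟩
  choose U V hUV using hall
  have key : ∀ x (u v : ℚ), x = u + v * s → ((U x : F) - V x * s) = u - v * s := by
    intro x u v h
    obtain ⟨h1, h2⟩ := uniq _ _ _ _ ((hUV x).symm.trans h)
    rw [h1, h2]
  let φ : F →+* F :=
    { toFun := fun x => U x - V x * s
      map_one' := by rw [key 1 1 0 (by simp)]; simp
      map_zero' := by rw [key 0 0 0 (by simp)]; simp
      map_add' := fun x y => by
        rw [key (x + y) (U x + U y) (V x + V y) (by
          push_cast; linear_combination hUV x + hUV y)]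
        push_cast; ring
      map_mul' := fun x y => by
        rw [key (x * y) (U x * U y - (p * q : ℕ) * (V x * V y)) (U x * V y + U y * V x) (by
          push_cast at hs ⊢
          linear_combination y * hUV x + (U x + V x * s) * hUV y + V x * V y * hs)]
        push_cast at hs ⊢
        linear_combination (-(V x * V y : F)) * hs }
  let ψ : F →ₐ[ℚ] F := φ.toRatAlgHom
  refine ⟨AlgEquiv.ofBijective ψ ψ.bijective, hs, ?_, fun x => ⟨_, _, hUV x⟩⟩
  change (U s : F) - V s * s = -s
  rw [key s 0 1 (by simp)]
  simp

theorem ImaginaryQuadratic.exists_order {J : F ≃ₐ[ℚ] F} (H : ImaginaryQuadratic p q s J)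
    (hpq : p ≠ q) (h8 : p * q % 8 = 7) (hp : p % 8 = 5) :
    ∃ D : ℕ, 1 ≤ D ∧ TwoPowNorm (p * q) D ∧ (∀ t, 1 ≤ t → TwoPowNorm (p * q) t → D ∣ t) ∧
      (Nat.card (ClassGroup (𝓞 F))).factorization 2 = D.factorization 2 := by
  have h4 : p * q % 4 = 3 := by omega
  obtain ⟨A, B, hne, hAB, hA, hB⟩ := H.exists_primes_over_two hpq h8
  set c := ClassGroup.mk0 (heightOneIdeal A) with hc
  have hpow : ∀ (v : HeightOneSpectrum (𝓞 F)) t,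
      ClassGroup.mk0 (heightOneIdeal v) ^ t = 1 ↔ (v.asIdeal ^ t).IsPrincipal := by
    intro v t
    rw [← map_pow, ClassGroup.mk0_eq_one_iff (heightOneIdeal v ^ t).2]
    rfl
  have hcB : ClassGroup.mk0 (heightOneIdeal B) = c⁻¹ := by
    rw [eq_inv_iff_mul_eq_one, hc, mul_comm, ← map_mul]
    refine (ClassGroup.mk0_eq_one_iff (heightOneIdeal A * heightOneIdeal B).2).2 ⟨2, ?_⟩
    exact hAB
  have hD1 : 1 ≤ orderOf c := orderOf_pos c
  have hD : TwoPowNorm (p * q) (orderOf c) :=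
    H.twoPowNorm_of_isPrincipal hpq h8 hne hAB hA hD1 ((hpow A _).1 (pow_orderOf_eq_one c))
  have hmin : ∀ t, 1 ≤ t → TwoPowNorm (p * q) t → orderOf c ∣ t := by
    intro t _ ht
    rcases H.pow_eq_one_of_twoPowNorm hpq h8 hne hAB hA hB ht with h | h
    · exact orderOf_dvd_of_pow_eq_one ((hpow A t).2 h)
    · have := (hpow B t).2 h
      rw [hcB, inv_pow, inv_eq_one] at this
      exact orderOf_dvd_of_pow_eq_one this
  refine ⟨_, hD1, hD, hmin, ?_⟩
  obtain ⟨E, -, -, y₁, y₂, -, -, -, -, hy, -⟩ := exists_split hp hD1 hD hmin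
  refine (factorization_card_eq_of_forall_mem_zpowers fun x k hx => ?_).1
  refine mem_zpowers_of_pow_two_pow_eq_one (eq_or_eq_of_two_mem hAB) ?_
    (H.squarePrincipal hpq h4 hp hy) x k hx
  rw [hcB]
  exact Subgroup.inv_mem _ (Subgroup.mem_zpowers _)

theorem squarePrincipal_of_imaginaryQuadratic (hpq : p ≠ q) (h8 : p * q % 8 = 7) (hp : p % 8 = 5)
    {y₁ y₂ : ℤ} {t : ℕ} (hy : p * y₁ ^ 2 + q * y₂ ^ 2 = 2 ^ t) {K : IntermediateField ℚ F}
    (hsK : s ∈ K) (hs : s ^ 2 = -((p * q : ℕ) : F))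
    (hall : ∀ x ∈ K, ∃ u v : ℚ, x = u + v * s) : SquarePrincipal (twoIntegers K) := by
  obtain ⟨J, H⟩ := exists_imaginaryQuadratic (F := K) (s := ⟨s, hsK⟩) (p := p) (q := q)
    (Subtype.ext (by simpa using hs)) (fun x => by
      obtain ⟨u, v, h⟩ := hall x x.2
      exact ⟨u, v, Subtype.ext (by simpa using h)⟩)
  exact (H.squarePrincipal hpq (by omega) hp hy).of_ringEquiv (twoIntegersTopEquiv K)

end QuadraticClassNumber

end

section

open NumberField IsDedekindDomain Polynomial
open scoped nonZeroDivisors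

section CyclotomicLayer

variable {L : Type*} [Field L] [NumberField L]

/-- `L = ℚ(a, c, ζ)` where `a = √p`, `c = √(-q)` and `ζ` is a primitive `2 ^ (n + 2)`-th root of
unity. -/
structure CyclotomicLayer (p q n : ℕ) (a c ζ : L) : Prop where
  a_sq : a ^ 2 = (p : L)
  c_sq : c ^ 2 = -(q : L)
  prim : IsPrimitiveRoot ζ (2 ^ (n + 2))
  gen : IntermediateField.adjoin ℚ {a, c, ζ} = ⊤

namespace CyclotomicLayer

variable {p q n : ℕ} [hpp : Fact p.Prime] [hqp : Fact q.Prime] {a c ζ : L}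

theorem a_ne_zero (H : CyclotomicLayer p q n a c ζ) : a ≠ 0 := by
  rintro rfl
  have := H.a_sq
  rw [zero_pow two_ne_zero, eq_comm, Nat.cast_eq_zero] at this
  exact hpp.out.ne_zero this

theorem c_ne_zero (H : CyclotomicLayer p q n a c ζ) : c ≠ 0 := by
  rintro rfl
  have := H.c_sq
  rw [zero_pow two_ne_zero, eq_comm, neg_eq_zero, Nat.cast_eq_zero] at this
  exact hqp.out.ne_zero this

theorem algEquiv_ext (H : CyclotomicLayer p q n a c ζ) {g h : L ≃ₐ[ℚ] L} (ha : g a = h a)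
    (hc : g c = h c) (hζ : g ζ = h ζ) : g = h := by
  ext x
  have hx : x ∈ IntermediateField.adjoin ℚ {a, c, ζ} := by
    rw [H.gen]; exact IntermediateField.mem_top
  induction hx using IntermediateField.adjoin_induction with
  | mem x hx =>
    rcases hx with rfl | rfl | rfl
    · exact ha
    · exact hc
    · exact hζ
  | algebraMap x => rw [g.commutes, h.commutes]
  | add x y _ _ hx hy => rw [map_add, map_add, hx, hy]
  | inv x _ hx => rw [map_inv₀, map_inv₀, hx]
  | mul x y _ _ hx hy => rw [map_mul, map_mul, hx, hy]

theorem isGalois (H : CyclotomicLayer p q n a c ζ) : IsGalois ℚ L := by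
  let f : ℚ[X] := (X ^ 2 - C (p : ℚ)) * ((X ^ 2 + C (q : ℚ)) * (X ^ 2 ^ (n + 2) - C 1))
  have hf0 : f ≠ 0 := by
    refine mul_ne_zero (X_pow_sub_C_ne_zero two_pos _)
      (mul_ne_zero ?_ (X_pow_sub_C_ne_zero (by positivity) _))
    exact (monic_X_pow_add_C _ two_ne_zero).ne_zero
  have h1 : (X ^ 2 - C (p : L)) = (X - C a) * (X - C (-a)) := by
    rw [← H.a_sq, C_neg, C_pow]; ring
  have h2 : (X ^ 2 + C (q : L)) = (X - C c) * (X - C (-c)) := by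
    rw [← neg_neg (q : L), ← H.c_sq, C_neg, C_neg, C_pow]; ring
  have hmap : f.map (algebraMap ℚ L) =
      (X ^ 2 - C (p : L)) * ((X ^ 2 + C (q : L)) * (X ^ 2 ^ (n + 2) - C 1)) := by
    simp [f]
  have : IsSplittingField ℚ L f := by
    refine ⟨?_, ?_⟩
    · rw [hmap, h1, h2]
      exact ((Splits.X_sub_C _).mul (Splits.X_sub_C _)).mul
        (((Splits.X_sub_C _).mul (Splits.X_sub_C _)).mul (X_pow_sub_one_splits H.prim))
    · have halg : ∀ x ∈ ({a, c, ζ} : Set L), IsAlgebraic ℚ x := fun x _ =>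
        Algebra.IsAlgebraic.isAlgebraic x
      have h3 := IntermediateField.adjoin_toSubalgebra_of_isAlgebraic halg
      rw [H.gen, IntermediateField.top_toSubalgebra] at h3
      rw [eq_top_iff, h3]
      refine Algebra.adjoin_mono ?_
      have hroot : ∀ x : L, (f.map (algebraMap ℚ L)).eval x = 0 → x ∈ f.rootSet L := by
        intro x hx
        rw [mem_rootSet]
        exact ⟨hf0, by rwa [eval_map_algebraMap] at hx⟩
      rintro x (rfl | rfl | rfl) <;> apply hroot <;> rw [hmap]
      · simp [H.a_sq]
      · simp [H.c_sq]
      · simp [H.prim.pow_eq_one]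
  have := Normal.of_isSplittingField f (F := ℚ) (E := L)
  exact ⟨⟩

theorem map_a (H : CyclotomicLayer p q n a c ζ) (g : L ≃ₐ[ℚ] L) : g a = a ∨ g a = -a := by
  rw [← sq_eq_sq_iff_eq_or_eq_neg, ← map_pow, H.a_sq, map_natCast]

theorem map_c (H : CyclotomicLayer p q n a c ζ) (g : L ≃ₐ[ℚ] L) : g c = c ∨ g c = -c := by
  rw [← sq_eq_sq_iff_eq_or_eq_neg, ← map_pow, H.c_sq, map_neg, map_natCast]

open Classical in
/-- The signs on `a`, `c` and the cyclotomic character. -/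
noncomputable def signs (H : CyclotomicLayer p q n a c ζ) (g : L ≃ₐ[ℚ] L) :
    Bool × Bool × (ZMod (2 ^ (n + 2)))ˣ :=
  (decide (g a = a), decide (g c = c), H.prim.autToPow ℚ g)

theorem signs_injective (H : CyclotomicLayer p q n a c ζ) : Function.Injective H.signs := by
  intro g h hgh
  simp only [signs, Prod.mk.injEq, decide_eq_decide] at hgh
  obtain ⟨h1, h2, h3⟩ := hgh
  refine H.algEquiv_ext ?_ ?_ ?_
  · by_cases h0 : g a = a
    · rw [h0, h1.1 h0]
    · rw [(H.map_a g).resolve_left h0, (H.map_a h).resolve_left (mt h1.2 h0)]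
  · by_cases h0 : g c = c
    · rw [h0, h2.1 h0]
    · rw [(H.map_c g).resolve_left h0, (H.map_c h).resolve_left (mt h2.2 h0)]
  · rw [← H.prim.autToPow_spec ℚ g, ← H.prim.autToPow_spec ℚ h, h3]

theorem natCard_signs (n : ℕ) : Nat.card (Bool × Bool × (ZMod (2 ^ (n + 2)))ˣ) = 2 ^ (n + 3) := by
  rw [Nat.card_prod, Nat.card_prod, Nat.card_eq_fintype_card, Nat.card_eq_fintype_card,
    ZMod.card_units_eq_totient, Nat.totient_prime_pow Nat.prime_two (by omega)]
  simp
  ring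

theorem finrank_le (H : CyclotomicLayer p q n a c ζ) : Module.finrank ℚ L ≤ 2 ^ (n + 3) := by
  have := H.isGalois
  rw [← IsGalois.card_aut_eq_finrank, ← natCard_signs]
  exact Nat.card_le_card_of_injective _ H.signs_injective

theorem exists_algEquiv (H : CyclotomicLayer p q n a c ζ)
    (hL : Module.finrank ℚ L = 2 ^ (n + 3)) (x y : Bool) (u : (ZMod (2 ^ (n + 2)))ˣ) :
    ∃ g : L ≃ₐ[ℚ] L, g a = (bif x then a else -a) ∧ g c = (bif y then c else -c) ∧
      g ζ = ζ ^ (u : ZMod (2 ^ (n + 2))).val := by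
  have := H.isGalois
  obtain ⟨g, hg⟩ := (H.signs_injective.bijective_of_nat_card_le (by
    rw [natCard_signs, IsGalois.card_aut_eq_finrank, hL])).2 (x, y, u)
  simp only [signs, Prod.mk.injEq] at hg
  obtain ⟨h1, h2, h3⟩ := hg
  refine ⟨g, ?_, ?_, by rw [← h3, H.prim.autToPow_spec ℚ g]⟩
  · cases x
    · exact (H.map_a g).resolve_left (by simpa using h1)
    · simpa using h1
  · cases y
    · exact (H.map_c g).resolve_left (by simpa using h2)
    · simpa using h2

theorem exists_generators (H : CyclotomicLayer p q n a c ζ)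
    (hL : Module.finrank ℚ L = 2 ^ (n + 3)) (hn : 1 ≤ n) : ∃ σ τ ρ J : L ≃ₐ[ℚ] L,
      (σ a = -a ∧ σ c = -c ∧ σ ζ = ζ) ∧ (τ a = a ∧ τ c = c ∧ τ ζ = ζ ^ 5) ∧
      (ρ a = a ∧ ρ c = c ∧ ρ ζ = ζ⁻¹) ∧ (J a = a ∧ J c = -c ∧ J ζ = ζ⁻¹) := by
  have hN : 8 ≤ 2 ^ (n + 2) := by
    calc 8 = 2 ^ 3 := by norm_num
      _ ≤ 2 ^ (n + 2) := Nat.pow_le_pow_right two_pos (by omega)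
  have : Fact (1 < 2 ^ (n + 2)) := ⟨by omega⟩
  have h1 : ζ ^ ((1 : (ZMod (2 ^ (n + 2)))ˣ) : ZMod (2 ^ (n + 2))).val = ζ := by
    rw [Units.val_one, ZMod.val_one, pow_one]
  have hinv : ζ ^ ((-1 : (ZMod (2 ^ (n + 2)))ˣ) : ZMod (2 ^ (n + 2))).val = ζ⁻¹ := by
    refine eq_inv_of_mul_eq_one_left ?_
    rw [← pow_succ, H.prim.pow_eq_one_iff_dvd, ← ZMod.natCast_eq_zero_iff]
    push_cast
    rw [ZMod.natCast_zmod_val]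
    exact neg_add_cancel 1
  have h5 : ζ ^ ((ZMod.unitOfCoprime 5 (Nat.Coprime.pow_right (n + 2) (by norm_num)) :
      (ZMod (2 ^ (n + 2)))ˣ) : ZMod (2 ^ (n + 2))).val = ζ ^ 5 := by
    rw [ZMod.coe_unitOfCoprime, ZMod.val_natCast, Nat.mod_eq_of_lt (by omega)]
  obtain ⟨σ, hσ⟩ := H.exists_algEquiv hL false false 1
  obtain ⟨τ, hτ⟩ := H.exists_algEquiv hL true true (ZMod.unitOfCoprime 5
    (Nat.Coprime.pow_right (n + 2) (by norm_num)))
  obtain ⟨ρ, hρ⟩ := H.exists_algEquiv hL true true (-1)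
  obtain ⟨J, hJ⟩ := H.exists_algEquiv hL true false (-1)
  rw [h1] at hσ
  rw [h5] at hτ
  rw [hinv] at hρ hJ
  exact ⟨σ, τ, ρ, J, hσ, hτ, hρ, hJ⟩

end CyclotomicLayer

end CyclotomicLayer

end

section

open NumberField IsDedekindDomain
open scoped nonZeroDivisors

theorem exists_rat_of_mem_adjoin {F : Type*} [Field F] [CharZero F] {s : F} {d : ℕ} (hd : 0 < d)
    (hs : s ^ 2 = -(d : F)) {x : F} (hx : x ∈ IntermediateField.adjoin ℚ {s}) :
    ∃ u v : ℚ, x = u + v * s := by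
  induction hx using IntermediateField.adjoin_induction with
  | mem x hx => exact ⟨0, 1, by rw [Set.mem_singleton_iff.1 hx]; push_cast; ring⟩
  | algebraMap x => exact ⟨x, 0, by rw [eq_ratCast]; push_cast; ring⟩
  | add x y _ _ hx hy =>
    obtain ⟨u, v, rfl⟩ := hx
    obtain ⟨u', v', rfl⟩ := hy
    exact ⟨u + u', v + v', by push_cast; ring⟩
  | inv x _ hx =>
    obtain ⟨u, v, rfl⟩ := hx
    by_cases h0 : u ^ 2 + d * v ^ 2 = 0
    · have hd' : (0 : ℚ) < d := by exact_mod_cast hd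
      have hv : v = 0 := by
        by_contra hv
        nlinarith [sq_nonneg u, mul_pos hd' (sq_pos_of_ne_zero hv)]
      have hu : u = 0 := by simpa [hv] using h0
      exact ⟨0, 0, by simp [hu, hv]⟩
    · refine ⟨u / (u ^ 2 + d * v ^ 2), -v / (u ^ 2 + d * v ^ 2), ?_⟩
      have h0' : ((u : F) ^ 2 + d * (v : F) ^ 2) ≠ 0 := by exact_mod_cast h0
      refine inv_eq_of_mul_eq_one_right ?_
      push_cast
      rw [← div_self h0']
      linear_combination -(v : F) ^ 2 / ((u : F) ^ 2 + d * (v : F) ^ 2) * hs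
  | mul x y _ _ hx hy =>
    obtain ⟨u, v, rfl⟩ := hx
    obtain ⟨u', v', rfl⟩ := hy
    exact ⟨u * u' - d * v * v', u * v' + v * u', by
      push_cast; linear_combination (v : F) * v' * hs⟩

theorem IsPrimitiveRoot.associated_sq_sub_one {R : Type*} [CommRing R] [IsDomain R] {k : ℕ} {ζ : R}
    (hζ : IsPrimitiveRoot ζ (2 ^ (k + 2))) : Associated ((ζ - 1) ^ 2) (ζ ^ 2 - 1) := by
  have hhalf : ζ ^ 2 ^ (k + 1) = -1 := by
    refine (hζ.pow (a := 2 ^ (k + 1)) (b := 2) (by positivity) (by ring)).eq_neg_one_of_two_right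
  have hassoc : Associated (ζ - 1) (ζ ^ (1 + 2 ^ (k + 1)) - 1) := by
    refine hζ.associated_sub_one_pow_sub_one_of_coprime ?_
    refine Nat.Coprime.pow_right _ ((Nat.coprime_two_right).2 ?_)
    exact Odd.add_even odd_one (Nat.even_pow.2 ⟨even_two, by omega⟩)
  have h : ζ ^ (1 + 2 ^ (k + 1)) - 1 = -(ζ + 1) := by
    rw [pow_add, hhalf]; ring
  rw [h] at hassoc
  have : ζ ^ 2 - 1 = (ζ - 1) * (ζ + 1) := by ring
  rw [this, pow_two]
  exact (Associated.refl _).mul_mul (hassoc.trans (Associated.neg_left (Associated.refl _)))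

theorem IsPrimitiveRoot.associated_sub_one_pow_two {R : Type*} [CommRing R] [IsDomain R] {k : ℕ}
    {ζ : R} (hζ : IsPrimitiveRoot ζ (2 ^ (k + 1))) : Associated ((ζ - 1) ^ 2 ^ k) 2 := by
  induction k generalizing ζ with
  | zero =>
    have : ζ = -1 := IsPrimitiveRoot.eq_neg_one_of_two_right (by simpa using hζ)
    rw [this, pow_zero, pow_one, show (-1 - 1 : R) = -2 by ring]
    exact Associated.neg_left (Associated.refl _)
  | succ k ih =>
    have h := ih (hζ.pow (by positivity) (b := 2 ^ (k + 1)) (a := 2) (by ring))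
    rw [pow_succ', pow_mul]
    exact (hζ.associated_sq_sub_one.pow_pow).trans h

theorem absNorm_span_two {F : Type*} [Field F] [NumberField F] :
    Ideal.absNorm (Ideal.span {(2 : 𝓞 F)}) = 2 ^ Module.finrank ℚ F := by
  rw [Ideal.absNorm_span_singleton, show (2 : 𝓞 F) = algebraMap ℤ (𝓞 F) 2 by simp,
    Algebra.norm_algebraMap, RingOfIntegers.rank]
  simp [Int.natAbs_pow]

section

variable {L : Type*} [Field L] [NumberField L]
variable {p q : ℕ} [hpp : Fact p.Prime] [hqp : Fact q.Prime]

theorem not_isIntegral_quarter (hpq : p ≠ q) (h4 : p * q % 4 = 3) {s : L}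
    (hs : s ^ 2 = -((p * q : ℕ) : L)) {y : L} (h : 4 * y = 1 - s) : ¬IsIntegral ℤ y := by
  intro hy
  have hd : 0 < p * q := by rcases Nat.eq_zero_or_pos (p * q) with h | h <;> omega
  let K := IntermediateField.adjoin ℚ {s}
  have hsK : s ∈ K := IntermediateField.mem_adjoin_simple_self ℚ s
  have hyK : y ∈ K := by
    have : y = (1 - s) * (4 : L)⁻¹ := by
      rw [← h]; ring
    rw [this]
    exact K.mul_mem (K.sub_mem K.one_mem hsK) (K.inv_mem (ofNat_mem K 4))
  have hs' : (⟨s, hsK⟩ : K) ^ 2 = -((p * q : ℕ) : K) := Subtype.ext (by push_cast; exact_mod_cast hs)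
  obtain ⟨J, H⟩ := exists_imaginaryQuadratic (p := p) (q := q) hs' (fun x => by
    obtain ⟨u, v, h⟩ := exists_rat_of_mem_adjoin hd hs x.2
    exact ⟨u, v, Subtype.ext (by push_cast; exact h)⟩)
  have hy' : IsIntegral ℤ (⟨y, hyK⟩ : K) :=
    (isIntegral_algHom_iff (K.val.restrictScalars ℤ) K.val.injective).1 hy
  obtain ⟨X, Y, -, hXY⟩ := H.exists_int_repr hpq h4 hy'
  have h' : (4 : K) * ⟨y, hyK⟩ = 1 - ⟨s, hsK⟩ := Subtype.ext (by push_cast; exact h)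
  have := (H.ext (u := 1) (v := -1) (u' := 2 * X) (v' := 2 * Y) (by
    push_cast; linear_combination 2 * hXY - h')).1
  have : (1 : ℤ) = 2 * X := by exact_mod_cast this
  omega

theorem absNorm_ne_two_of_sq (hp : p % 8 = 5) {a : L} (ha : a ^ 2 = (p : L)) {P : Ideal (𝓞 L)}
    (hP : P.IsPrime) (h2 : (2 : 𝓞 L) ∈ P) : Ideal.absNorm P ≠ 2 := by
  intro hN
  obtain ⟨k, hk⟩ : ∃ k : ℕ, p = 8 * k + 5 := ⟨p / 8, by omega⟩
  have ha' : a ^ 2 = 8 * (k : L) + 5 := by rw [ha, hk]; push_cast; ring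
  let x : L := (1 + a) / 2
  have hx : x ^ 2 - x = ((2 * k + 1 : ℕ) : L) := by
    simp only [x]; push_cast; linear_combination ha' / 4
  have h_int : IsIntegral ℤ x := by
    refine ⟨Polynomial.X ^ 2 - Polynomial.X - Polynomial.C ((2 * k + 1 : ℕ) : ℤ), ?_, ?_⟩
    · monicity!
    · rw [Polynomial.eval₂_sub, Polynomial.eval₂_sub, Polynomial.eval₂_X_pow, Polynomial.eval₂_X,
        Polynomial.eval₂_C, hx]
      simp
  let z : 𝓞 L := ⟨x, h_int⟩
  have hz : z ^ 2 - z = 2 * (k : 𝓞 L) + 1 := by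
    apply RingOfIntegers.ext
    have : (x ^ 2 - x : L) = 2 * (k : L) + 1 := by rw [hx]; push_cast; ring
    change algebraMap (𝓞 L) L (z ^ 2 - z) = algebraMap (𝓞 L) L (2 * (k : 𝓞 L) + 1)
    rw [map_sub, map_pow, map_add, map_mul, map_ofNat, map_natCast, map_one]
    exact this
  have hcard : Nat.card (𝓞 L ⧸ P) = 2 := by
    rw [← hN, Ideal.absNorm_apply]; rfl
  have hnt : Nontrivial (𝓞 L ⧸ P) := Ideal.Quotient.nontrivial_iff.2 hP.ne_top
  have hdom : (Ideal.Quotient.mk P z) = 0 ∨ Ideal.Quotient.mk P z = 1 := by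
    obtain ⟨b, hb, hall⟩ := (Nat.card_eq_two_iff' (0 : 𝓞 L ⧸ P)).1 hcard
    by_cases h0 : Ideal.Quotient.mk P z = 0
    · exact Or.inl h0
    · exact Or.inr ((hall _ h0).trans (hall 1 one_ne_zero).symm)
  have hmem : z ^ 2 - z ∈ P := by
    rw [← Ideal.Quotient.eq_zero_iff_mem, map_sub, map_pow]
    rcases hdom with h | h <;> rw [h] <;> ring
  rw [hz] at hmem
  exact hP.ne_top ((Ideal.eq_top_iff_one _).2
    ((P.add_mem_iff_right (P.mul_mem_right _ h2)).1 hmem))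

end

end

section

open NumberField IsDedekindDomain
open scoped nonZeroDivisors

section

variable {L : Type*} [Field L] [NumberField L]
variable {p q : ℕ} [hpp : Fact p.Prime] [hqp : Fact q.Prime]

/-- The two places `v₁`, `v₂` of `L` above `2`: their product is generated by `π = 1 - ζ`. -/
structure PlacesOverTwo (n : ℕ) (s ζ : L) (π : 𝓞 L) (v₁ v₂ : HeightOneSpectrum (𝓞 L)) : Prop where
  coe_pi : (π : L) = 1 - ζ
  ne : v₁ ≠ v₂
  mul : v₁.asIdeal * v₂.asIdeal = Ideal.span {π}
  assoc : Associated (π ^ 2 ^ (n + 1)) 2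
  mem₁ : ∃ ω : 𝓞 L, 2 * (ω : L) = 1 + s ∧ ω ∈ v₁.asIdeal
  mem₂ : ∃ ω : 𝓞 L, 2 * (ω : L) = 1 - s ∧ ω ∈ v₂.asIdeal

theorem exists_half_in_place (hpq : p ≠ q) (h8 : p * q % 8 = 7) {s : L}
    (hs : s ^ 2 = -((p * q : ℕ) : L)) : ∃ ω : 𝓞 L, 2 * (ω : L) = 1 + s ∧
      ∃ v : HeightOneSpectrum (𝓞 L), ω ∈ v.asIdeal ∧ (2 : 𝓞 L) ∈ v.asIdeal := by
  obtain ⟨k, hk⟩ : ∃ k : ℕ, p * q = 8 * k + 7 := ⟨p * q / 8, by omega⟩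
  have hs' : s ^ 2 = -(8 * (k : L) + 7) := by rw [hs, hk]; push_cast; ring
  have h_int : IsIntegral ℤ ((1 + s) / 2) := by
    refine ⟨Polynomial.X ^ 2 - Polynomial.X + Polynomial.C ((2 * k + 2 : ℕ) : ℤ), ?_, ?_⟩
    · monicity!
    · rw [Polynomial.eval₂_add, Polynomial.eval₂_sub, Polynomial.eval₂_X_pow, Polynomial.eval₂_X,
        Polynomial.eval₂_C]
      simp only [eq_intCast, Int.cast_natCast]
      push_cast
      linear_combination hs' / 4
  let ω : 𝓞 L := ⟨(1 + s) / 2, h_int⟩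
  have hω : 2 * (ω : L) = 1 + s := mul_div_cancel₀ _ two_ne_zero
  have hprod : ω * (1 - ω) = 2 * ((k + 1 : ℕ) : 𝓞 L) := by
    apply RingOfIntegers.ext
    change algebraMap (𝓞 L) L (ω * (1 - ω)) = algebraMap (𝓞 L) L (2 * ((k + 1 : ℕ) : 𝓞 L))
    rw [map_mul, map_sub, map_mul, map_ofNat, map_natCast, map_one]
    push_cast
    linear_combination (-(ω : L) / 2 + (1 - s) / 4) * hω - hs' / 4
  have hne : Ideal.span {2, ω} ≠ ⊤ := by
    intro htop
    obtain ⟨α, β, h⟩ := Ideal.mem_span_pair.1 ((Ideal.eq_top_iff_one _).1 htop)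
    have h2 : 1 - ω = 2 * (α * (1 - ω) + β * ((k + 1 : ℕ) : 𝓞 L)) := by
      linear_combination β * hprod - (1 - ω) * h
    have h3 := congrArg (algebraMap (𝓞 L) L) h2
    rw [map_mul, map_sub, map_one, map_ofNat] at h3
    refine not_isIntegral_quarter hpq (by omega) hs (?_ : 4 * (algebraMap (𝓞 L) L
      (α * (1 - ω) + β * ((k + 1 : ℕ) : 𝓞 L))) = 1 - s) (RingOfIntegers.isIntegral_coe _)
    linear_combination -2 * h3 - hω
  obtain ⟨P, hP, hle⟩ := Ideal.exists_le_maximal _ hne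
  have h2 : (2 : 𝓞 L) ∈ P := hle (Ideal.subset_span (by simp))
  refine ⟨ω, hω, ⟨P, hP.isPrime, fun h => two_ne_zero (α := 𝓞 L) ?_⟩,
    hle (Ideal.subset_span (by simp)), h2⟩
  rw [h] at h2
  exact h2

theorem four_le_absNorm (hp : p % 8 = 5) {a : L} (ha : a ^ 2 = (p : L))
    (v : HeightOneSpectrum (𝓞 L)) (h2 : (2 : 𝓞 L) ∈ v.asIdeal) : 4 ≤ Ideal.absNorm v.asIdeal := by
  have h1 : Ideal.absNorm v.asIdeal ∣ 2 ^ Module.finrank ℚ L := by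
    rw [← absNorm_span_two]
    exact Ideal.absNorm_dvd_absNorm_of_le ((Ideal.span_singleton_le_iff_mem _).2 h2)
  obtain ⟨k, -, hk⟩ := (Nat.dvd_prime_pow Nat.prime_two).1 h1
  have h3 := absNorm_ne_two_of_sq hp ha v.isPrime h2
  have h4 : Ideal.absNorm v.asIdeal ≠ 1 := fun h => v.isPrime.ne_top (Ideal.absNorm_eq_one_iff.1 h)
  rw [hk] at h3 h4 ⊢
  match k with
  | 0 => simp at h4
  | 1 => simp at h3
  | k + 2 => rw [pow_add]; have := Nat.one_le_two_pow (n := k); omega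

theorem CyclotomicLayer.exists_placesOverTwo {n : ℕ} {a c ζ : L} (H : CyclotomicLayer p q n a c ζ)
    (hp : p % 8 = 5) (hq : q % 8 = 3) : Module.finrank ℚ L = 2 ^ (n + 3) ∧
      ∃ π v₁ v₂, PlacesOverTwo n (a * c) ζ π v₁ v₂ := by
  have hpq : p ≠ q := by rintro rfl; omega
  have h8 : p * q % 8 = 7 := by rw [Nat.mul_mod, hp, hq]
  have hs : (a * c) ^ 2 = -((p * q : ℕ) : L) := by
    rw [mul_pow, H.a_sq, H.c_sq]; push_cast; ring
  obtain ⟨ω, hω, v₁, hωv, h21⟩ := exists_half_in_place hpq h8 hs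
  obtain ⟨ω', hω', v₂, hωv', h22⟩ := exists_half_in_place hpq h8
    (s := -(a * c)) (by rw [neg_pow_two, hs])
  have hne : v₁ ≠ v₂ := by
    rintro rfl
    refine v₁.isPrime.ne_top ((Ideal.eq_top_iff_one _).2 ?_)
    have : ω + ω' = 1 := by
      apply RingOfIntegers.ext
      change algebraMap (𝓞 L) L (ω + ω') = algebraMap (𝓞 L) L 1
      rw [map_add, map_one]
      linear_combination hω / 2 + hω' / 2
    rw [← this]
    exact v₁.asIdeal.add_mem hωv hωv'
  let π : 𝓞 L := 1 - H.prim.toInteger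
  have hassoc : Associated (π ^ 2 ^ (n + 1)) 2 := by
    have := H.prim.toInteger_isPrimitiveRoot.associated_sub_one_pow_two
    have h : Associated π (H.prim.toInteger - 1) := by
      rw [← neg_sub (1 : 𝓞 L)]
      exact Associated.neg_right (Associated.refl _)
    exact h.pow_pow.trans this
  have hspan : Ideal.span {π} ^ 2 ^ (n + 1) = Ideal.span {2} := by
    rw [Ideal.span_singleton_pow]
    exact Ideal.span_singleton_eq_span_singleton.2 hassoc
  have hmem : ∀ v : HeightOneSpectrum (𝓞 L), (2 : 𝓞 L) ∈ v.asIdeal → v.asIdeal ∣ Ideal.span {π} := by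
    intro v hv
    have := v.isPrime
    rw [Ideal.dvd_span_singleton]
    refine this.mem_of_pow_mem (2 ^ (n + 1)) ?_
    obtain ⟨u, hu⟩ := hassoc.symm
    rw [← hu]
    exact v.asIdeal.mul_mem_right _ hv
  have hcop : IsCoprime v₁.asIdeal v₂.asIdeal := by
    rw [Ideal.isCoprime_iff_sup_eq]
    refine Ideal.IsMaximal.coprime_of_ne v₁.isMaximal v₂.isMaximal fun h => hne ?_
    exact HeightOneSpectrum.ext h
  obtain ⟨I, hI⟩ := hcop.mul_dvd (hmem v₁ h21) (hmem v₂ h22)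
  have hN : Ideal.absNorm (Ideal.span {π}) ^ 2 ^ (n + 1) = 2 ^ Module.finrank ℚ L := by
    rw [← map_pow, hspan, absNorm_span_two]
  have hle : Ideal.absNorm (Ideal.span {π}) ≤ 16 := by
    refine (Nat.pow_le_pow_iff_left (n := 2 ^ (n + 1)) (by positivity)).1 ?_
    rw [hN, show 16 = 2 ^ 4 by norm_num, ← pow_mul]
    refine Nat.pow_le_pow_right two_pos (H.finrank_le.trans (le_of_eq (by ring)))
  have hfac := congrArg Ideal.absNorm hI
  rw [map_mul, map_mul] at hfac
  have h41 := four_le_absNorm hp H.a_sq v₁ h21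
  have h42 := four_le_absNorm hp H.a_sq v₂ h22
  have hI0 : Ideal.absNorm I ≠ 0 := by
    intro h0
    rw [h0, mul_zero] at hfac
    rw [hfac, zero_pow (by positivity)] at hN
    exact absurd hN.symm (by positivity)
  have hI1 : Ideal.absNorm I = 1 := by
    by_contra h1
    have : 2 ≤ Ideal.absNorm I := by omega
    have := Nat.mul_le_mul (Nat.mul_le_mul h41 h42) this
    omega
  have h16 : Ideal.absNorm (Ideal.span {π}) = 2 ^ 4 := by
    have := Nat.mul_le_mul h41 h42
    rw [hI1, mul_one] at hfac
    omega
  refine ⟨?_, π, v₁, v₂, rfl, hne, ?_, hassoc, ⟨ω, hω, hωv⟩, ω', by rw [hω']; ring, hωv'⟩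
  · rw [h16, ← pow_mul] at hN
    rw [← Nat.pow_right_injective le_rfl hN]
    ring
  · rw [hI, Ideal.absNorm_eq_one_iff.1 hI1, Ideal.mul_top]

end

end

section

open NumberField IsDedekindDomain
open scoped nonZeroDivisors

section

variable {L : Type*} [Field L] [NumberField L]

/-- The action of an automorphism on the integers. -/
abbrev integersEquiv (g : L ≃ₐ[ℚ] L) : 𝓞 L ≃+* 𝓞 L := RingOfIntegers.mapRingEquiv g.toRingEquiv

theorem coe_integersEquiv (g : L ≃ₐ[ℚ] L) (z : 𝓞 L) : (integersEquiv g z : L) = g z := rfl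

theorem valuation_map_eq {v w : HeightOneSpectrum (𝓞 L)} {g : L ≃ₐ[ℚ] L}
    (h : w.asIdeal = v.asIdeal.map (integersEquiv g)) (x : L) :
    w.valuation L (g x) = v.valuation L x := by
  have h_int : ∀ z : 𝓞 L, w.intValuation (integersEquiv g z) = v.intValuation z := by
    intro z
    by_cases hz : z = 0
    · rw [hz, map_zero, map_zero, map_zero]
    have hz' : integersEquiv g z ≠ 0 := fun h0 => hz ((map_eq_zero_iff _ (integersEquiv g).injective).1 h0)
    rw [w.intValuation_eq_exp_neg_multiplicity hz', v.intValuation_eq_exp_neg_multiplicity hz]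
    congr 3
    refine multiplicity_eq_of_emultiplicity_eq (emultiplicity_eq_emultiplicity_iff.2 fun n => ?_)
    rw [Ideal.dvd_span_singleton, Ideal.dvd_span_singleton, h, ← Ideal.map_pow]
    constructor
    · intro hm
      obtain ⟨y, hy, hyz⟩ := (Ideal.mem_map_of_equiv _ _).1 hm
      rwa [← (integersEquiv g).injective hyz]
    · exact fun hm => Ideal.mem_map_of_mem _ hm
  obtain ⟨z, t, ht, rfl⟩ := IsFractionRing.div_surjective (A := 𝓞 L) x
  rw [map_div₀, map_div₀, map_div₀, v.valuation_of_algebraMap, v.valuation_of_algebraMap, ← h_int,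
    ← h_int, ← w.valuation_of_algebraMap (K := L), ← w.valuation_of_algebraMap (K := L)]
  rfl

/-- The difference of the orders at two places. -/
noncomputable def ordDiff (v₁ v₂ : HeightOneSpectrum (𝓞 L)) (x : L) : ℤ :=
  WithZero.log (v₂.valuation L x) - WithZero.log (v₁.valuation L x)

variable {v₁ v₂ : HeightOneSpectrum (𝓞 L)}

theorem ordDiff_mul {x y : L} (hx : x ≠ 0) (hy : y ≠ 0) :
    ordDiff v₁ v₂ (x * y) = ordDiff v₁ v₂ x + ordDiff v₁ v₂ y := by
  have h : ∀ (v : HeightOneSpectrum (𝓞 L)) {z : L}, z ≠ 0 → v.valuation L z ≠ 0 :=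
    fun v z hz => (Valuation.ne_zero_iff _).2 hz
  rw [ordDiff, map_mul, map_mul, WithZero.log_mul (h _ hx) (h _ hy),
    WithZero.log_mul (h _ hx) (h _ hy), ordDiff, ordDiff]
  ring

theorem ordDiff_inv (x : L) : ordDiff v₁ v₂ x⁻¹ = -ordDiff v₁ v₂ x := by
  rw [ordDiff, map_inv₀, map_inv₀, WithZero.log_inv, WithZero.log_inv, ordDiff]
  ring

theorem ordDiff_pow (x : L) (n : ℕ) : ordDiff v₁ v₂ (x ^ n) = n * ordDiff v₁ v₂ x := by
  rw [ordDiff, map_pow, map_pow, WithZero.log_pow, WithZero.log_pow, ordDiff, nsmul_eq_mul,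
    nsmul_eq_mul]
  ring

theorem ordDiff_one : ordDiff v₁ v₂ (1 : L) = 0 := by
  rw [ordDiff, map_one, map_one, WithZero.log_one, sub_zero]

theorem ordDiff_eq_zero_of_pow_eq_one {x : L} {n : ℕ} (hn : n ≠ 0) (h : x ^ n = 1) :
    ordDiff v₁ v₂ x = 0 := by
  have := ordDiff_pow (v₁ := v₁) (v₂ := v₂) x n
  rw [h, ordDiff_one] at this
  exact (mul_eq_zero.1 this.symm).resolve_left (by exact_mod_cast hn)

theorem ordDiff_map_eq {w₁ w₂ : HeightOneSpectrum (𝓞 L)} {g : L ≃ₐ[ℚ] L}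
    (h₁ : w₁.asIdeal = v₁.asIdeal.map (integersEquiv g))
    (h₂ : w₂.asIdeal = v₂.asIdeal.map (integersEquiv g)) (x : L) :
    ordDiff w₁ w₂ (g x) = ordDiff v₁ v₂ x := by
  rw [ordDiff, ordDiff, valuation_map_eq h₁, valuation_map_eq h₂]

theorem log_valuation_of_span_eq {v w : HeightOneSpectrum (𝓞 L)} (hvw : v ≠ w) {a b : ℕ}
    {x : 𝓞 L} (hx : Ideal.span {x} = v.asIdeal ^ a * w.asIdeal ^ b) :
    WithZero.log (v.valuation L (x : L)) = -a := by
  have hx0 : x ≠ 0 := by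
    rintro rfl
    rw [Ideal.span_singleton_zero, eq_comm] at hx
    exact mul_ne_zero (pow_ne_zero a v.ne_bot) (pow_ne_zero b w.ne_bot) hx
  have hcop : ¬ v.asIdeal ∣ w.asIdeal ^ b := by
    intro h
    have := (Ideal.prime_of_isPrime v.ne_bot v.isPrime).dvd_of_dvd_pow h
    rw [Ideal.dvd_iff_le] at this
    exact hvw (HeightOneSpectrum.ext (w.isMaximal.eq_of_le v.isPrime.ne_top this).symm)
  have hm : multiplicity v.asIdeal (Ideal.span {x}) = a := by
    refine multiplicity_eq_of_dvd_of_not_dvd (hx ▸ dvd_mul_right _ _) fun h => hcop ?_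
    rw [hx, pow_succ] at h
    exact (mul_dvd_mul_iff_left (pow_ne_zero a v.ne_bot)).1 h
  change WithZero.log (v.valuation L (algebraMap (𝓞 L) L x)) = -a
  rw [v.valuation_of_algebraMap, v.intValuation_eq_exp_neg_multiplicity hx0, hm, WithZero.log_exp]

theorem ordDiff_of_span_eq (hne : v₁ ≠ v₂) {a b : ℕ} {x : 𝓞 L}
    (hx : Ideal.span {x} = v₁.asIdeal ^ a * v₂.asIdeal ^ b) : ordDiff v₁ v₂ (x : L) = a - b := by
  rw [ordDiff, log_valuation_of_span_eq hne hx, log_valuation_of_span_eq hne.symm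
    (by rw [hx, mul_comm])]
  ring

end

end

section

open NumberField IsDedekindDomain
open scoped nonZeroDivisors

section

variable {L : Type*} [Field L] [NumberField L]

namespace PlacesOverTwo

variable {n : ℕ} {s ζ : L} {π : 𝓞 L} {v₁ v₂ : HeightOneSpectrum (𝓞 L)}

theorem symm (H : PlacesOverTwo n s ζ π v₁ v₂) : PlacesOverTwo n (-s) ζ π v₂ v₁ where
  coe_pi := H.coe_pi
  ne := H.ne.symm
  mul := by rw [mul_comm, H.mul]
  assoc := H.assoc
  mem₁ := by simpa [sub_eq_add_neg] using H.mem₂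
  mem₂ := by simpa using H.mem₁

theorem span_two (H : PlacesOverTwo n s ζ π v₁ v₂) :
    Ideal.span {(2 : 𝓞 L)} = (v₁.asIdeal * v₂.asIdeal) ^ 2 ^ (n + 1) := by
  rw [H.mul, Ideal.span_singleton_pow]
  exact Ideal.span_singleton_eq_span_singleton.2 H.assoc.symm

theorem two_mem₁ (H : PlacesOverTwo n s ζ π v₁ v₂) : (2 : 𝓞 L) ∈ v₁.asIdeal := by
  rw [← Ideal.span_singleton_le_iff_mem, H.span_two, ← Ideal.dvd_iff_le]
  exact (dvd_mul_right _ _).trans (dvd_pow_self _ (by positivity))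

theorem eq_or_eq (H : PlacesOverTwo n s ζ π v₁ v₂) (v : HeightOneSpectrum (𝓞 L))
    (hv : (2 : 𝓞 L) ∈ v.asIdeal) : v = v₁ ∨ v = v₂ := by
  rw [← Ideal.span_singleton_le_iff_mem, H.span_two] at hv
  have h := v.isPrime.le_of_pow_le hv
  rcases v.isPrime.mul_le.1 h with h | h
  · exact Or.inl (HeightOneSpectrum.ext (v₁.isMaximal.eq_of_le v.isPrime.ne_top h).symm)
  · exact Or.inr (HeightOneSpectrum.ext (v₂.isMaximal.eq_of_le v.isPrime.ne_top h).symm)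

theorem not_mem_of_add_eq_one (v : HeightOneSpectrum (𝓞 L)) {x y : 𝓞 L}
    (h : (x : L) + y = 1) (hx : x ∈ v.asIdeal) : y ∉ v.asIdeal := by
  intro hy
  refine v.isPrime.ne_top ((Ideal.eq_top_iff_one _).2 ?_)
  have : x + y = 1 := RingOfIntegers.ext h
  rw [← this]
  exact v.asIdeal.add_mem hx hy

theorem sq_ne (H : PlacesOverTwo n s ζ π v₁ v₂) (hζ : IsIntegral ℤ ζ) (ξ : L) : ξ ^ 2 ≠ ζ := by
  intro h
  let x : 𝓞 L := ⟨ξ, IsIntegral.of_pow two_pos (h ▸ hζ)⟩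
  have hπ : (1 - x) * (1 + x) = π := by
    apply RingOfIntegers.ext
    change (1 - ξ) * (1 + ξ) = (π : L)
    rw [H.coe_pi, ← h]; ring
  have hmem : (1 - x) * (1 + x) ∈ v₁.asIdeal := by
    rw [hπ, ← Ideal.span_singleton_le_iff_mem, ← H.mul]
    exact Ideal.mul_le_left
  have h2 : 2 * x ∈ v₁.asIdeal := v₁.asIdeal.mul_mem_right _ H.two_mem₁
  have hm : 1 - x ∈ v₁.asIdeal := by
    rcases v₁.isPrime.mem_or_mem hmem with h | h
    · exact h
    · have := v₁.asIdeal.sub_mem h h2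
      rwa [show 1 + x - 2 * x = 1 - x by ring] at this
  have hp : 1 + x ∈ v₁.asIdeal := by
    have := v₁.asIdeal.add_mem hm h2
    rwa [show 1 - x + 2 * x = 1 + x by ring] at this
  have hdvd : v₁.asIdeal * v₁.asIdeal ∣ v₁.asIdeal * v₂.asIdeal := by
    rw [H.mul, Ideal.dvd_span_singleton, ← hπ]
    exact Ideal.mul_mem_mul hm hp
  rw [mul_dvd_mul_iff_left (by exact v₁.ne_bot), Ideal.dvd_iff_le] at hdvd
  exact H.ne (HeightOneSpectrum.ext (v₂.isMaximal.eq_of_le v₁.isPrime.ne_top hdvd).symm)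

theorem map_eq_or_eq (H : PlacesOverTwo n s ζ π v₁ v₂) (g : L ≃ₐ[ℚ] L) :
    v₁.asIdeal = v₁.asIdeal.map (integersEquiv g) ∨
      v₂.asIdeal = v₁.asIdeal.map (integersEquiv g) := by
  have hmax : (v₁.asIdeal.map (integersEquiv g)).IsMaximal :=
    have := v₁.isMaximal
    Ideal.map_isMaximal_of_equiv (integersEquiv g)
  have h2 : (2 : 𝓞 L) ∈ v₁.asIdeal.map (integersEquiv g) := by
    have := Ideal.mem_map_of_mem (integersEquiv g) H.two_mem₁
    rwa [map_ofNat] at this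
  let w : HeightOneSpectrum (𝓞 L) := ⟨v₁.asIdeal.map (integersEquiv g), hmax.isPrime, fun h => by
    rw [h] at h2; exact two_ne_zero (α := 𝓞 L) h2⟩
  rcases H.eq_or_eq w h2 with h | h
  · exact Or.inl (congrArg HeightOneSpectrum.asIdeal h).symm
  · exact Or.inr (congrArg HeightOneSpectrum.asIdeal h).symm

theorem map_eq_of_map_eq (H : PlacesOverTwo n s ζ π v₁ v₂) {g : L ≃ₐ[ℚ] L} (hg : g s = s) :
    v₁.asIdeal = v₁.asIdeal.map (integersEquiv g) := by
  refine (H.map_eq_or_eq g).resolve_right fun h => ?_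
  obtain ⟨ω, hω, hm⟩ := H.mem₁
  obtain ⟨ω', hω', hm'⟩ := H.mem₂
  have h1 := h ▸ Ideal.mem_map_of_mem (integersEquiv g) hm
  refine not_mem_of_add_eq_one v₂ ?_ h1 hm'
  have h3 := congrArg g hω
  rw [map_mul, map_add, map_one, map_ofNat, hg] at h3
  rw [coe_integersEquiv]
  linear_combination h3 / 2 + hω' / 2

theorem map_eq_of_map_eq_neg (H : PlacesOverTwo n s ζ π v₁ v₂) {g : L ≃ₐ[ℚ] L} (hg : g s = -s) :
    v₂.asIdeal = v₁.asIdeal.map (integersEquiv g) := by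
  refine (H.map_eq_or_eq g).resolve_left fun h => ?_
  obtain ⟨ω, hω, hm⟩ := H.mem₁
  have h1 : integersEquiv g ω ∈ v₁.asIdeal := by
    rw [h]; exact Ideal.mem_map_of_mem (integersEquiv g) hm
  refine not_mem_of_add_eq_one v₁ ?_ h1 hm
  have h3 := congrArg g hω
  rw [map_mul, map_add, map_one, map_ofNat, hg] at h3
  rw [coe_integersEquiv]
  linear_combination h3 / 2 + hω / 2

theorem ordDiff_map (H : PlacesOverTwo n s ζ π v₁ v₂) {g : L ≃ₐ[ℚ] L} (hg : g s = s) (x : L) :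
    ordDiff v₁ v₂ (g x) = ordDiff v₁ v₂ x :=
  ordDiff_map_eq (H.map_eq_of_map_eq hg)
    (H.symm.map_eq_of_map_eq (by rw [map_neg, hg])) x

theorem ordDiff_map_neg (H : PlacesOverTwo n s ζ π v₁ v₂) {g : L ≃ₐ[ℚ] L} (hg : g s = -s) (x : L) :
    ordDiff v₁ v₂ (g x) = -ordDiff v₁ v₂ x := by
  have h := ordDiff_map_eq (w₁ := v₂) (w₂ := v₁) (H.map_eq_of_map_eq_neg hg)
    (H.symm.map_eq_of_map_eq_neg (by rw [map_neg, hg])) x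
  rw [ordDiff] at h ⊢
  linarith

theorem ordDiff_two (H : PlacesOverTwo n s ζ π v₁ v₂) : ordDiff v₁ v₂ (2 : L) = 0 := by
  have h := H.span_two
  rw [mul_pow] at h
  have := ordDiff_of_span_eq H.ne h
  rw [sub_self] at this
  exact this

theorem ordDiff_pi (H : PlacesOverTwo n s ζ π v₁ v₂) : ordDiff v₁ v₂ (1 - ζ) = 0 := by
  have h := H.mul
  rw [← pow_one v₁.asIdeal, ← pow_one v₂.asIdeal] at h
  have := ordDiff_of_span_eq H.ne h.symm
  rw [sub_self] at this
  rw [← H.coe_pi, this]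

theorem mk0_mul_mk0 (H : PlacesOverTwo n s ζ π v₁ v₂) :
    ClassGroup.mk0 (heightOneIdeal v₁) * ClassGroup.mk0 (heightOneIdeal v₂) = 1 := by
  rw [← map_mul, ClassGroup.mk0_eq_one_iff]
  exact ⟨⟨π, H.mul⟩⟩

theorem zpow_ordDiff_eq_one (H : PlacesOverTwo n s ζ π v₁ v₂) {x : L} (hx : x ∈ twoIntegers ⊤)
    (hx' : x⁻¹ ∈ twoIntegers ⊤) (hx0 : x ≠ 0) :
    ClassGroup.mk0 (heightOneIdeal v₁) ^ ordDiff v₁ v₂ x = 1 := by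
  obtain ⟨-, N, hN⟩ := hx
  obtain ⟨-, M, hM⟩ := hx'
  let y : 𝓞 L := ⟨_, hN⟩
  let z : 𝓞 L := ⟨_, hM⟩
  have hyz : y * z = 2 ^ (N + M) := by
    apply RingOfIntegers.ext
    rw [RingOfIntegers.coe_two_pow]
    change (2 ^ N * x) * (2 ^ M * x⁻¹) = 2 ^ (N + M)
    rw [pow_add]
    field_simp
  have hdvd : Ideal.span {y} ∣ v₁.asIdeal ^ (2 ^ (n + 1) * (N + M)) *
      v₂.asIdeal ^ (2 ^ (n + 1) * (N + M)) := by
    rw [← mul_pow, pow_mul, ← H.span_two, Ideal.span_singleton_pow, ← hyz,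
      ← Ideal.span_singleton_mul_span_singleton]
    exact dvd_mul_right _ _
  obtain ⟨I, I', hI, hI', hII⟩ := exists_dvd_and_dvd_of_dvd_mul hdvd
  obtain ⟨a, -, ha⟩ := (dvd_prime_pow (Ideal.prime_of_isPrime v₁.ne_bot v₁.isPrime) _).1 hI
  obtain ⟨b, -, hb⟩ := (dvd_prime_pow (Ideal.prime_of_isPrime v₂.ne_bot v₂.isPrime) _).1 hI'
  rw [associated_iff_eq] at ha hb
  rw [ha, hb] at hII
  have h1 : ordDiff v₁ v₂ x = a - b := by
    rw [← ordDiff_of_span_eq H.ne hII]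
    change _ = ordDiff v₁ v₂ (2 ^ N * x)
    rw [ordDiff_mul (pow_ne_zero N two_ne_zero) hx0, ordDiff_pow, H.ordDiff_two]
    ring
  have h2 : ClassGroup.mk0 (heightOneIdeal v₁) ^ a * ClassGroup.mk0 (heightOneIdeal v₂) ^ b = 1 := by
    rw [← map_pow, ← map_pow, ← map_mul, ClassGroup.mk0_eq_one_iff]
    exact ⟨⟨y, hII.symm⟩⟩
  rw [h1, zpow_sub, zpow_natCast, zpow_natCast, ← h2, eq_inv_of_mul_eq_one_right H.mk0_mul_mk0,
    inv_pow]

end PlacesOverTwo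

end

end

section

open NumberField IsDedekindDomain
open scoped nonZeroDivisors

theorem exists_five_pow (j : ℕ) : ∃ k : ℕ, 5 ^ 2 ^ j = 1 + 2 ^ (j + 2) * (2 * k + 1) := by
  induction j with
  | zero => exact ⟨0, by norm_num⟩
  | succ j ih =>
    obtain ⟨k, hk⟩ := ih
    refine ⟨k + 2 ^ j * (2 * k + 1) ^ 2, ?_⟩
    rw [pow_succ 2 j, pow_mul, hk]
    ring

theorem ZMod.mem_zpowers_five_or (n : ℕ) (u : (ZMod (2 ^ (n + 2)))ˣ) {f : (ZMod (2 ^ (n + 2)))ˣ}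
    (hf : (f : ZMod (2 ^ (n + 2))) = 5) :
    u ∈ Subgroup.zpowers f ∨ -u ∈ Subgroup.zpowers f := by
  have hcard : Nat.card (Subgroup.zpowers f) = 2 ^ n := by
    rw [Nat.card_zpowers, ← orderOf_units, hf, ZMod.orderOf_five]
  have hindex : (Subgroup.zpowers f).index = 2 := by
    have h := (Subgroup.zpowers f).card_mul_index
    rw [hcard, Nat.card_eq_fintype_card, ZMod.card_units_eq_totient,
      Nat.totient_prime_pow Nat.prime_two (by omega)] at h
    refine Nat.eq_of_mul_eq_mul_left (by positivity : 0 < 2 ^ n) (h.trans ?_)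
    rw [show n + 2 - 1 = n + 1 by omega, pow_succ]; ring
  have hneg : (-1 : (ZMod (2 ^ (n + 2)))ˣ) ∉ Subgroup.zpowers f := by
    have hdvd : 4 ∣ 2 ^ (n + 2) := ⟨2 ^ n, by ring⟩
    let φ := ZMod.unitsMap hdvd
    have hfφ : φ f = 1 := by
      apply Units.ext
      change ZMod.castHom hdvd (ZMod 4) (f : ZMod (2 ^ (n + 2))) = 1
      rw [hf, map_ofNat]; rfl
    rintro ⟨k, hk⟩
    have h := congrArg φ hk
    change φ (f ^ k) = φ (-1) at h
    rw [map_zpow, hfφ, one_zpow] at h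
    have h' : ((1 : (ZMod 4)ˣ) : ZMod 4) = ZMod.castHom hdvd (ZMod 4) (-1) :=
      congrArg Units.val h
    rw [map_neg, map_one] at h'
    revert h'
    decide
  by_cases hu : u ∈ Subgroup.zpowers f
  · exact Or.inl hu
  · refine Or.inr ?_
    rw [← neg_one_mul, Subgroup.mul_mem_iff_of_index_two hindex]
    exact ⟨fun h => absurd h hneg, fun h => absurd h hu⟩

section

variable {L : Type*} [Field L] [NumberField L]

/-- The subfield fixed by a set of automorphisms. -/
noncomputable def fixedBy (S : Set (L ≃ₐ[ℚ] L)) : IntermediateField ℚ L :=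
  IntermediateField.fixedField (Subgroup.closure S)

theorem mem_fixedBy {S : Set (L ≃ₐ[ℚ] L)} {x : L} : x ∈ fixedBy S ↔ ∀ g ∈ S, g x = x := by
  rw [fixedBy, IntermediateField.mem_fixedField_iff]
  refine ⟨fun h g hg => h g (Subgroup.subset_closure hg), fun h g hg => ?_⟩
  exact ((Subgroup.closure_le (MulAction.stabilizer (L ≃ₐ[ℚ] L) x)).2 h) hg

/-- Generators of the Galois group of `ℚ(a, c, ζ)`. -/
structure LayerGenerators (a c ζ : L) (σ τ ρ J : L ≃ₐ[ℚ] L) : Prop where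
  σ_a : σ a = -a
  σ_c : σ c = -c
  σ_ζ : σ ζ = ζ
  τ_a : τ a = a
  τ_c : τ c = c
  τ_ζ : τ ζ = ζ ^ 5
  ρ_a : ρ a = a
  ρ_c : ρ c = c
  ρ_ζ : ρ ζ = ζ⁻¹
  J_a : J a = a
  J_c : J c = -c
  J_ζ : J ζ = ζ⁻¹

variable {p q : ℕ} [hpp : Fact p.Prime] [hqp : Fact q.Prime] {n : ℕ} {a c ζ : L}

theorem CyclotomicLayer.comm (H : CyclotomicLayer p q n a c ζ) (g h : L ≃ₐ[ℚ] L) (x : L) :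
    g (h x) = h (g x) := by
  suffices e : g * h = h * g from congrArg (fun f : L ≃ₐ[ℚ] L => f x) e
  refine H.algEquiv_ext ?_ ?_ ?_ <;> rw [AlgEquiv.mul_apply, AlgEquiv.mul_apply]
  · rcases H.map_a g with h1 | h1 <;> rcases H.map_a h with h2 | h2 <;>
      simp only [h1, h2, map_neg]
  · rcases H.map_c g with h1 | h1 <;> rcases H.map_c h with h2 | h2 <;>
      simp only [h1, h2, map_neg]
  · rw [← H.prim.autToPow_spec ℚ g, ← H.prim.autToPow_spec ℚ h, map_pow, map_pow,
      ← H.prim.autToPow_spec ℚ g, ← H.prim.autToPow_spec ℚ h, pow_right_comm]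

namespace LayerGenerators

variable {σ τ ρ J : L ≃ₐ[ℚ] L}

theorem σ_s (G : LayerGenerators a c ζ σ τ ρ J) : σ (a * c) = a * c := by
  rw [map_mul, G.σ_a, G.σ_c, neg_mul_neg]

theorem τ_s (G : LayerGenerators a c ζ σ τ ρ J) : τ (a * c) = a * c := by
  rw [map_mul, G.τ_a, G.τ_c]

theorem ρ_s (G : LayerGenerators a c ζ σ τ ρ J) : ρ (a * c) = a * c := by
  rw [map_mul, G.ρ_a, G.ρ_c]

theorem J_s (G : LayerGenerators a c ζ σ τ ρ J) : J (a * c) = -(a * c) := by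
  rw [map_mul, G.J_a, G.J_c, mul_neg]

theorem σ_σ (G : LayerGenerators a c ζ σ τ ρ J) (H : CyclotomicLayer p q n a c ζ) (x : L) :
    σ (σ x) = x := by
  suffices e : σ * σ = 1 from congrArg (fun f : L ≃ₐ[ℚ] L => f x) e
  refine H.algEquiv_ext ?_ ?_ ?_ <;> rw [AlgEquiv.mul_apply, AlgEquiv.one_apply]
  · rw [G.σ_a, map_neg, G.σ_a, neg_neg]
  · rw [G.σ_c, map_neg, G.σ_c, neg_neg]
  · rw [G.σ_ζ, G.σ_ζ]

theorem ρ_ρ (G : LayerGenerators a c ζ σ τ ρ J) (H : CyclotomicLayer p q n a c ζ) (x : L) :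
    ρ (ρ x) = x := by
  suffices e : ρ * ρ = 1 from congrArg (fun f : L ≃ₐ[ℚ] L => f x) e
  refine H.algEquiv_ext ?_ ?_ ?_ <;> rw [AlgEquiv.mul_apply, AlgEquiv.one_apply]
  · rw [G.ρ_a, G.ρ_a]
  · rw [G.ρ_c, G.ρ_c]
  · rw [G.ρ_ζ, map_inv₀, G.ρ_ζ, inv_inv]

theorem J_J (G : LayerGenerators a c ζ σ τ ρ J) (H : CyclotomicLayer p q n a c ζ) (x : L) :
    J (J x) = x := by
  suffices e : J * J = 1 from congrArg (fun f : L ≃ₐ[ℚ] L => f x) e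
  refine H.algEquiv_ext ?_ ?_ ?_ <;> rw [AlgEquiv.mul_apply, AlgEquiv.one_apply]
  · rw [G.J_a, G.J_a]
  · rw [G.J_c, map_neg, G.J_c, neg_neg]
  · rw [G.J_ζ, map_inv₀, G.J_ζ, inv_inv]

theorem τ_pow_a (G : LayerGenerators a c ζ σ τ ρ J) (k : ℕ) : (τ ^ k) a = a := by
  induction k with
  | zero => rfl
  | succ k ih => rw [pow_succ, AlgEquiv.mul_apply, G.τ_a, ih]

theorem τ_pow_c (G : LayerGenerators a c ζ σ τ ρ J) (k : ℕ) : (τ ^ k) c = c := by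
  induction k with
  | zero => rfl
  | succ k ih => rw [pow_succ, AlgEquiv.mul_apply, G.τ_c, ih]

theorem τ_pow_ζ (G : LayerGenerators a c ζ σ τ ρ J) (k : ℕ) : (τ ^ k) ζ = ζ ^ 5 ^ k := by
  induction k with
  | zero => simp
  | succ k ih => rw [pow_succ, AlgEquiv.mul_apply, G.τ_ζ, map_pow, ih, ← pow_mul, pow_succ]

theorem τ_pow_eq_one (G : LayerGenerators a c ζ σ τ ρ J) (H : CyclotomicLayer p q n a c ζ) :
    τ ^ 2 ^ n = 1 := by
  refine H.algEquiv_ext (G.τ_pow_a _) (G.τ_pow_c _) ?_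
  obtain ⟨k, hk⟩ := exists_five_pow n
  rw [G.τ_pow_ζ, hk, pow_add, pow_mul, H.prim.pow_eq_one, one_pow, mul_one, pow_one]
  rfl

theorem apply_eq_self (G : LayerGenerators a c ζ σ τ ρ J) (H : CyclotomicLayer p q n a c ζ)
    {x : L} (hσ : σ x = x) (hτ : τ x = x) (hρ : ρ x = x) (hJ : J x = x) (g : L ≃ₐ[ℚ] L) :
    g x = x := by
  let S := MulAction.stabilizer (L ≃ₐ[ℚ] L) x
  have hσ' : σ ∈ S := hσ
  have hτ' : τ ∈ S := hτ
  have hρ' : ρ ∈ S := hρ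
  have hJ' : J ∈ S := hJ
  have hroot : ∃ h ∈ S, h a = a ∧ h c = c ∧ h ζ = g ζ := by
    let f : (ZMod (2 ^ (n + 2)))ˣ := ZMod.unitOfCoprime 5 (Nat.Coprime.pow_right (n + 2) (by norm_num))
    have key : ∀ m : ℤ, ∀ u : (ZMod (2 ^ (n + 2)))ˣ, f ^ m = u →
        ∃ k : ℕ, (τ ^ k) ζ = ζ ^ (u : ZMod (2 ^ (n + 2))).val := by
      intro m u hm
      obtain ⟨k, hk⟩ := (mem_powers_iff_mem_zpowers (x := f)).2 ⟨m, hm⟩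
      refine ⟨k, ?_⟩
      have e : 5 ^ k ≡ (u : ZMod (2 ^ (n + 2))).val [MOD orderOf ζ] := by
        rw [← H.prim.eq_orderOf, ← ZMod.natCast_eq_natCast_iff, ZMod.natCast_zmod_val, ← hk]
        simp [f]
      rw [G.τ_pow_ζ, ← pow_mod_orderOf, e, pow_mod_orderOf]
    let u := H.prim.autToPow ℚ g
    rcases ZMod.mem_zpowers_five_or n u (f := f) (by simp [f]) with ⟨m, hm⟩ | ⟨m, hm⟩
    · obtain ⟨k, hk⟩ := key m _ hm
      refine ⟨τ ^ k, S.pow_mem hτ' k, G.τ_pow_a k, G.τ_pow_c k, ?_⟩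
      rw [hk, H.prim.autToPow_spec ℚ g]
    · obtain ⟨k, hk⟩ := key m _ hm
      refine ⟨ρ * τ ^ k, S.mul_mem hρ' (S.pow_mem hτ' k), ?_, ?_, ?_⟩
      · rw [AlgEquiv.mul_apply, G.τ_pow_a, G.ρ_a]
      · rw [AlgEquiv.mul_apply, G.τ_pow_c, G.ρ_c]
      · rw [AlgEquiv.mul_apply, hk, map_pow, G.ρ_ζ, inv_pow, inv_eq_iff_eq_inv]
        refine eq_inv_of_mul_eq_one_left ?_
        rw [← H.prim.autToPow_spec ℚ g, ← pow_add, H.prim.pow_eq_one_iff_dvd,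
          ← ZMod.natCast_eq_zero_iff]
        push_cast
        rw [ZMod.natCast_zmod_val, ZMod.natCast_zmod_val]
        exact neg_add_cancel _
  obtain ⟨h, hS, ha, hc, hζ⟩ := hroot
  suffices g ∈ S from this
  have hJρ : J * ρ ∈ S := S.mul_mem hJ' hρ'
  have e : ∀ f ∈ S, g a = f a → g c = f c → f ζ = ζ → g ∈ S := by
    intro f hf h1 h2 h3
    have : g = f * h := by
      refine H.algEquiv_ext ?_ ?_ ?_ <;> rw [AlgEquiv.mul_apply]
      · rw [ha, h1]
      · rw [hc, h2]
      · rw [hζ, ← H.prim.autToPow_spec ℚ g, map_pow, h3]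
    rw [this]
    exact S.mul_mem hf hS
  have hJρζ : J (ρ ζ) = ζ := by rw [G.ρ_ζ, map_inv₀, G.J_ζ, inv_inv]
  rcases H.map_a g with h1 | h1 <;> rcases H.map_c g with h2 | h2
  · exact e 1 S.one_mem h1 h2 rfl
  · exact e _ hJρ (by rw [h1, AlgEquiv.mul_apply, G.ρ_a, G.J_a])
      (by rw [h2, AlgEquiv.mul_apply, G.ρ_c, G.J_c]) hJρζ
  · exact e _ (S.mul_mem hσ' hJρ) (by rw [h1, AlgEquiv.mul_apply, AlgEquiv.mul_apply, G.ρ_a, G.J_a, G.σ_a])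
      (by rw [h2, AlgEquiv.mul_apply, AlgEquiv.mul_apply, G.ρ_c, G.J_c, map_neg, G.σ_c, neg_neg])
      (by rw [AlgEquiv.mul_apply, AlgEquiv.mul_apply, hJρζ, G.σ_ζ])
  · exact e σ hσ' (h1.trans G.σ_a.symm) (h2.trans G.σ_c.symm) G.σ_ζ

theorem exists_rat (G : LayerGenerators a c ζ σ τ ρ J) (H : CyclotomicLayer p q n a c ζ)
    {x : L} (hσ : σ x = x) (hτ : τ x = x) (hρ : ρ x = x) (hJ : J x = x) : ∃ r : ℚ, x = r := by
  have := H.isGalois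
  obtain ⟨r, hr⟩ := (IsGalois.mem_range_algebraMap_iff_fixed x).2
    (fun g => G.apply_eq_self H hσ hτ hρ hJ g)
  exact ⟨r, by rw [← hr, eq_ratCast]⟩

theorem exists_rat_add_mul (G : LayerGenerators a c ζ σ τ ρ J) (H : CyclotomicLayer p q n a c ζ)
    {x : L} (hσ : σ x = x) (hτ : τ x = x) (hρ : ρ x = x) : ∃ u v : ℚ, x = u + v * (a * c) := by
  have hs0 : a * c ≠ 0 := mul_ne_zero H.a_ne_zero H.c_ne_zero
  obtain ⟨u, hu⟩ := G.exists_rat H (x := x + J x) (by rw [map_add, H.comm σ J, hσ])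
    (by rw [map_add, H.comm τ J, hτ]) (by rw [map_add, H.comm ρ J, hρ])
    (by rw [map_add, G.J_J H, add_comm])
  obtain ⟨v, hv⟩ := G.exists_rat H (x := (x - J x) / (a * c))
    (by rw [map_div₀, map_sub, H.comm σ J, hσ, G.σ_s])
    (by rw [map_div₀, map_sub, H.comm τ J, hτ, G.τ_s])
    (by rw [map_div₀, map_sub, H.comm ρ J, hρ, G.ρ_s])
    (by rw [map_div₀, map_sub, G.J_J H, G.J_s, div_neg, ← neg_div, neg_sub])
  rw [div_eq_iff hs0] at hv
  exact ⟨u / 2, v / 2, by push_cast; linear_combination hu / 2 + hv / 2⟩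

end LayerGenerators

end

end

section

open NumberField IsDedekindDomain
open scoped nonZeroDivisors

section

variable {L : Type*} [Field L] [NumberField L]

theorem QuadraticStep.of_root_of_unity {K M : IntermediateField ℚ L} {g : L ≃ₐ[ℚ] L}
    (h : ∀ x, x ∈ K ↔ x ∈ M ∧ g x = x) (map_mem : ∀ x ∈ M, g x ∈ M)
    (invol : ∀ x ∈ M, g (g x) = x) {y : L} (hy : y ∈ M) {N : ℕ} (hN : N ≠ 0) (hyN : y ^ N = 1)
    (hgy : g y = -y) : QuadraticStep K M g where
  le x hx := ((h x).1 hx).1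
  map_mem := map_mem
  invol := invol
  fixed x hx := ⟨fun e => (h x).2 ⟨hx, e⟩, fun e => ((h x).1 e).2⟩
  etale := by
    have hi : ∀ z : L, z ^ N = 1 → IsIntegral ℤ z := fun z hz =>
      IsIntegral.of_pow (Nat.pos_of_ne_zero hN) (by rw [hz]; exact isIntegral_one)
    have hy0 : y ≠ 0 := by
      rintro rfl
      rw [zero_pow hN] at hyN
      exact zero_ne_one hyN
    refine ⟨y, mem_twoIntegers_of_isIntegral hy (hi y hyN), 0, Subring.zero_mem _,
      2⁻¹ * y⁻¹, Subring.mul_mem _ (inv_two_mem_twoIntegers M)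
        (mem_twoIntegers_of_isIntegral (M.inv_mem hy) (hi _ (by rw [inv_pow, hyN, inv_one]))),
      0, Subring.zero_mem _, ?_⟩
    rw [hgy]
    field_simp
    ring

/-- The powers of `ζ` generating the layers of the tower. -/
def layerRoot (n : ℕ) (ζ : L) (j : ℕ) : L := ζ ^ 2 ^ (n - j)

/-- The layers of the tower below the top. -/
noncomputable def layer (σ τ : L ≃ₐ[ℚ] L) (j : ℕ) : IntermediateField ℚ L :=
  fixedBy {σ, τ ^ 2 ^ j}

/-- The imaginary quadratic field at the bottom of the tower. -/
noncomputable def baseLayer (σ τ ρ : L ≃ₐ[ℚ] L) : IntermediateField ℚ L :=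
  fixedBy {σ, τ, ρ}

theorem mem_layer {σ τ : L ≃ₐ[ℚ] L} {j : ℕ} {x : L} :
    x ∈ layer σ τ j ↔ σ x = x ∧ (τ ^ 2 ^ j) x = x := by
  simp [layer, mem_fixedBy]

theorem mem_baseLayer {σ τ ρ : L ≃ₐ[ℚ] L} {x : L} :
    x ∈ baseLayer σ τ ρ ↔ σ x = x ∧ τ x = x ∧ ρ x = x := by
  simp [baseLayer, mem_fixedBy]

variable {p q : ℕ} [hpp : Fact p.Prime] [hqp : Fact q.Prime] {n : ℕ} {a c ζ : L}

theorem layerRoot_self : layerRoot n ζ n = ζ := by simp [layerRoot]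

theorem layerRoot_succ_sq {j : ℕ} (hj : j + 1 ≤ n) :
    layerRoot n ζ (j + 1) ^ 2 = layerRoot n ζ j := by
  rw [layerRoot, layerRoot, ← pow_mul, ← pow_succ]
  congr 2; omega

namespace CyclotomicLayer

theorem ζ_ne_zero (H : CyclotomicLayer p q n a c ζ) : ζ ≠ 0 :=
  H.prim.ne_zero (pow_ne_zero _ two_ne_zero)

theorem layerRoot_ne_zero (H : CyclotomicLayer p q n a c ζ) (j : ℕ) : layerRoot n ζ j ≠ 0 :=
  pow_ne_zero _ H.ζ_ne_zero

theorem layerRoot_pow (H : CyclotomicLayer p q n a c ζ) {j : ℕ} (hj : j ≤ n) :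
    layerRoot n ζ j ^ 2 ^ (j + 2) = 1 := by
  rw [layerRoot, ← pow_mul, ← pow_add, show n - j + (j + 2) = n + 2 by omega, H.prim.pow_eq_one]

theorem layerRoot_pow_half (H : CyclotomicLayer p q n a c ζ) {j : ℕ} (hj : j ≤ n) :
    layerRoot n ζ j ^ 2 ^ (j + 1) = -1 := by
  rw [layerRoot, ← pow_mul, ← pow_add, show n - j + (j + 1) = n + 1 by omega]
  have h : (ζ ^ 2 ^ (n + 1)) ^ 2 = 1 := by
    rw [← pow_mul, ← pow_succ, H.prim.pow_eq_one]
  refine (mul_self_eq_one_iff.1 ((pow_two _).symm.trans h)).resolve_left ?_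
  exact H.prim.pow_ne_one_of_pos_of_lt (by positivity) (by gcongr <;> omega)

theorem layerRoot_zero_sq (H : CyclotomicLayer p q n a c ζ) : layerRoot n ζ 0 ^ 2 = -1 :=
  H.layerRoot_pow_half (Nat.zero_le n)

end CyclotomicLayer

namespace LayerGenerators

variable {σ τ ρ J : L ≃ₐ[ℚ] L}

theorem σ_layerRoot (G : LayerGenerators a c ζ σ τ ρ J) (j : ℕ) :
    σ (layerRoot n ζ j) = layerRoot n ζ j := by
  rw [layerRoot, map_pow, G.σ_ζ]

theorem τ_pow_layerRoot' (G : LayerGenerators a c ζ σ τ ρ J) (i j : ℕ) :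
    (τ ^ i) (layerRoot n ζ j) = layerRoot n ζ j ^ 5 ^ i := by
  rw [layerRoot, map_pow, G.τ_pow_ζ, pow_right_comm]

theorem τ_pow_layerRoot (G : LayerGenerators a c ζ σ τ ρ J) (H : CyclotomicLayer p q n a c ζ)
    {j : ℕ} (hj : j ≤ n) : (τ ^ 2 ^ j) (layerRoot n ζ j) = layerRoot n ζ j := by
  obtain ⟨k, hk⟩ := exists_five_pow j
  rw [G.τ_pow_layerRoot', hk, pow_add, pow_mul, H.layerRoot_pow hj, one_pow, mul_one, pow_one]

theorem τ_pow_layerRoot_succ (G : LayerGenerators a c ζ σ τ ρ J)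
    (H : CyclotomicLayer p q n a c ζ) {j : ℕ} (hj : j + 1 ≤ n) :
    (τ ^ 2 ^ j) (layerRoot n ζ (j + 1)) = -layerRoot n ζ (j + 1) := by
  obtain ⟨k, hk⟩ := exists_five_pow j
  rw [G.τ_pow_layerRoot', hk, pow_add, pow_mul, H.layerRoot_pow_half hj,
    Odd.neg_one_pow ⟨k, rfl⟩, pow_one, mul_neg_one]

theorem ρ_layerRoot_zero (G : LayerGenerators a c ζ σ τ ρ J) (H : CyclotomicLayer p q n a c ζ) :
    ρ (layerRoot n ζ 0) = -layerRoot n ζ 0 := by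
  have h := H.layerRoot_zero_sq
  have h0 := H.layerRoot_ne_zero 0
  rw [layerRoot] at *
  rw [map_pow, G.ρ_ζ, inv_pow, inv_eq_iff_eq_inv]
  refine eq_inv_of_mul_eq_one_left ?_
  rw [mul_neg, ← pow_two, h, neg_neg]

theorem mem_layer_iff (j : ℕ) (x : L) :
    x ∈ layer σ τ j ↔ x ∈ layer σ τ (j + 1) ∧ (τ ^ 2 ^ j) x = x := by
  have : (τ ^ 2 ^ (j + 1)) x = (τ ^ 2 ^ j) ((τ ^ 2 ^ j) x) := by
    rw [← AlgEquiv.mul_apply, ← pow_add, ← two_mul, ← pow_succ']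
  rw [mem_layer, mem_layer, this]
  constructor
  · rintro ⟨h1, h2⟩
    exact ⟨⟨h1, by rw [h2, h2]⟩, h2⟩
  · rintro ⟨⟨h1, -⟩, h2⟩
    exact ⟨h1, h2⟩

theorem quadraticStep_base (G : LayerGenerators a c ζ σ τ ρ J)
    (H : CyclotomicLayer p q n a c ζ) :
    QuadraticStep (baseLayer σ τ ρ) (layer σ τ 0) ρ := by
  refine QuadraticStep.of_root_of_unity (y := layerRoot n ζ 0) (N := 2 ^ 2) ?_ ?_
    (fun x _ => G.ρ_ρ H x) ?_ (by norm_num) (H.layerRoot_pow (Nat.zero_le n))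
    (G.ρ_layerRoot_zero H)
  · intro x
    rw [mem_baseLayer, mem_layer, pow_zero, pow_one, and_assoc]
  · intro x hx
    rw [mem_layer] at hx ⊢
    exact ⟨by rw [H.comm, hx.1], by rw [H.comm, hx.2]⟩
  · exact mem_layer.2 ⟨G.σ_layerRoot 0, G.τ_pow_layerRoot H (Nat.zero_le n)⟩

theorem quadraticStep_layer (G : LayerGenerators a c ζ σ τ ρ J)
    (H : CyclotomicLayer p q n a c ζ) {j : ℕ} (hj : j + 1 ≤ n) :
    QuadraticStep (layer σ τ j) (layer σ τ (j + 1)) (τ ^ 2 ^ j) := by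
  refine QuadraticStep.of_root_of_unity (y := layerRoot n ζ (j + 1)) (N := 2 ^ (j + 1 + 2))
    (mem_layer_iff j) ?_ ?_ ?_ (by positivity) (H.layerRoot_pow hj)
    (G.τ_pow_layerRoot_succ H hj)
  · intro x hx
    rw [mem_layer] at hx ⊢
    exact ⟨by rw [H.comm, hx.1], by rw [H.comm, hx.2]⟩
  · intro x hx
    rw [← AlgEquiv.mul_apply, ← pow_add, ← two_mul, ← pow_succ']
    exact (mem_layer.1 hx).2
  · exact mem_layer.2 ⟨G.σ_layerRoot _, G.τ_pow_layerRoot H hj⟩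

theorem quadraticStep_top (G : LayerGenerators a c ζ σ τ ρ J)
    (H : CyclotomicLayer p q n a c ζ) (hpq : p ≠ q) :
    QuadraticStep (layer σ τ n) ⊤ σ where
  le := le_top
  map_mem _ _ := IntermediateField.mem_top
  invol x _ := G.σ_σ H x
  fixed x _ := by
    rw [mem_layer, G.τ_pow_eq_one H]
    exact ⟨fun h => ⟨h, rfl⟩, fun h => h.1⟩
  etale := by
    have hnat : ∀ k : ℕ, IsIntegral ℤ (k : L) := fun k => by
      simpa using isIntegral_algebraMap (R := ℤ) (A := L) (x := (k : ℤ))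
    have ha : a ∈ twoIntegers (⊤ : IntermediateField ℚ L) :=
      mem_twoIntegers_of_isIntegral IntermediateField.mem_top
        (IsIntegral.of_pow two_pos (by rw [H.a_sq]; exact hnat p))
    have hc : c ∈ twoIntegers (⊤ : IntermediateField ℚ L) :=
      mem_twoIntegers_of_isIntegral IntermediateField.mem_top
        (IsIntegral.of_pow two_pos (by
          rw [H.c_sq]; exact (hnat q).neg))
    have hcop : IsCoprime (p : ℤ) q :=
      Nat.isCoprime_iff_coprime.2 ((Nat.coprime_primes hpp.out hqp.out).2 hpq)
    obtain ⟨u, v, huv⟩ := hcop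
    refine ⟨a, ha, c, hc, u * 2⁻¹ * a, Subring.mul_mem _ (Subring.mul_mem _ (intCast_mem _ u)
      (inv_two_mem_twoIntegers _)) ha, -v * 2⁻¹ * c, Subring.mul_mem _ (Subring.mul_mem _
      (Subring.neg_mem _ (intCast_mem _ v)) (inv_two_mem_twoIntegers _)) hc, ?_⟩
    have huv' : (u : L) * p + v * q = 1 := by exact_mod_cast congrArg (Int.cast : ℤ → L) huv
    rw [G.σ_a, G.σ_c]
    linear_combination (u : L) * H.a_sq - (v : L) * H.c_sq + huv'

/-- Elements whose norm to the base layer is `p` times a square up to sign. -/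
theorem sq_sub_mul_sq_ne_base (G : LayerGenerators a c ζ σ τ ρ J)
    (H : CyclotomicLayer p q n a c ζ) (hp : p % 8 = 5) (h8 : p * q % 8 = 7) {y₀ δ : L}
    (hδ : δ ∈ baseLayer σ τ ρ) (hy : p * (y₀ * ρ y₀) = δ ^ 2 ∨ p * (y₀ * ρ y₀) = -δ ^ 2)
    {ε : L} (hε : ε = 1 ∨ ε = -1) {X Y : L} (hX : X ∈ layer σ τ 0) (hY : Y ∈ layer σ τ 0) :
    X ^ 2 - y₀ * Y ^ 2 ≠ ε * layerRoot n ζ 0 := by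
  intro h
  have S := G.quadraticStep_base H
  set i := layerRoot n ζ 0 with hi
  have hi2 : i ^ 2 = -1 := H.layerRoot_zero_sq
  have hi0 : i ≠ 0 := H.layerRoot_ne_zero 0
  have hρi : ρ i = -i := G.ρ_layerRoot_zero H
  have himem : i ∈ layer σ τ 0 :=
    mem_layer.2 ⟨G.σ_layerRoot 0, G.τ_pow_layerRoot H (Nat.zero_le n)⟩
  have hs : (a * c) ^ 2 = -((p * q : ℕ) : L) := by
    push_cast; rw [mul_pow, H.a_sq, H.c_sq]; ring
  have hbase : ∀ x ∈ baseLayer σ τ ρ, ∃ u v : ℚ, x = u + v * (a * c) := fun x hx =>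
    G.exists_rat_add_mul H (mem_baseLayer.1 hx).1 (mem_baseLayer.1 hx).2.1 (mem_baseLayer.1 hx).2.2
  have hρε : ρ ε = ε := by rcases hε with rfl | rfl <;> simp
  have hεb : ε ∈ baseLayer σ τ ρ := by
    rcases hε with rfl | rfl
    exacts [one_mem _, neg_mem (one_mem _)]
  have hε2 : ε ^ 2 = 1 := by rcases hε with rfl | rfl <;> norm_num
  obtain ⟨x₁, hx₁⟩ : ∃ x, x = (X + ρ X) / 2 := ⟨_, rfl⟩
  obtain ⟨x₂, hx₂⟩ : ∃ x, x = (X - ρ X) / (2 * i) := ⟨_, rfl⟩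
  have e1 : X = x₁ + i * x₂ := by rw [hx₁, hx₂]; field_simp; ring
  have e2 : ρ X = x₁ - i * x₂ := by rw [hx₁, hx₂]; field_simp; ring
  have m1 : x₁ ∈ baseLayer σ τ ρ := by
    rw [hx₁]
    refine (S.fixed _ (div_mem (add_mem hX (S.map_mem _ hX)) (ofNat_mem _ 2))).1 ?_
    rw [map_div₀, map_add, S.invol _ hX, map_ofNat, add_comm]
  have m2 : x₂ ∈ baseLayer σ τ ρ := by
    rw [hx₂]
    refine (S.fixed _ (div_mem (sub_mem hX (S.map_mem _ hX))
      (mul_mem (ofNat_mem _ 2) himem))).1 ?_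
    rw [map_div₀, map_sub, S.invol _ hX, map_mul, map_ofNat, hρi]
    rw [mul_neg, div_neg, ← neg_div, neg_sub]
  have me : Y * ρ Y ∈ baseLayer σ τ ρ := S.norm_mem hY
  have h' : (ρ X) ^ 2 - ρ y₀ * (ρ Y) ^ 2 = -(ε * i) := by
    have := congrArg ρ h
    rw [map_sub, map_mul, map_pow, map_pow, map_mul, hρε, hρi] at this
    rw [this]; ring
  have key : y₀ * ρ y₀ * (Y * ρ Y) ^ 2
      = (x₁ ^ 2 + x₂ ^ 2 + 1) ^ 2 - 2 * (x₁ + ε * x₂) ^ 2 := by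
    have f1 : y₀ * Y ^ 2 = X ^ 2 - ε * i := by linear_combination -h
    have f2 : ρ y₀ * (ρ Y) ^ 2 = (ρ X) ^ 2 + ε * i := by linear_combination -h'
    calc y₀ * ρ y₀ * (Y * ρ Y) ^ 2 = (y₀ * Y ^ 2) * (ρ y₀ * (ρ Y) ^ 2) := by ring
      _ = (x₁ ^ 2 + x₂ ^ 2 + 1) ^ 2 - 2 * (x₁ + ε * x₂) ^ 2 := by
        rw [f1, f2, e2, e1]
        have hi4 : i ^ 4 = 1 := by linear_combination (i ^ 2 - 1) * hi2
        linear_combination (-2 * x₁ ^ 2 * x₂ ^ 2 + 4 * ε * x₁ * x₂ - ε ^ 2) * hi2 +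
          x₂ ^ 4 * hi4 + (2 * x₂ ^ 2 + 1) * hε2
  have mpA : (p : L) * (x₁ ^ 2 + x₂ ^ 2 + 1) ∈ baseLayer σ τ ρ :=
    mul_mem (natCast_mem _ p) (add_mem (add_mem (pow_mem m1 2) (pow_mem m2 2)) (one_mem _))
  have mpB : (p : L) * (x₁ + ε * x₂) ∈ baseLayer σ τ ρ :=
    mul_mem (natCast_mem _ p) (add_mem m1 (mul_mem hεb m2))
  have h0 := (sq_sub_two_mul_sq_eq_zero h8 hs hp (hbase _ mpA) (hbase _ mpB)
    (hbase _ (mul_mem hδ me)) (by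
      rcases hy with hy | hy
      · left; linear_combination -(p : L) ^ 2 * key + p * (Y * ρ Y) ^ 2 * hy
      · right; linear_combination -(p : L) ^ 2 * key + p * (Y * ρ Y) ^ 2 * hy)).1
  have hp0 : (p : L) ≠ 0 := by exact_mod_cast hpp.out.ne_zero
  have h1 := (mul_eq_zero.1 h0).resolve_left hp0
  have h2 := (sq_add_sq_add_sq_eq_zero h8 hs (hbase _ m1) (hbase _ m2) (hbase _ (one_mem _))
    (by rw [one_pow]; exact h1)).2.2
  exact one_ne_zero h2

theorem sq_sub_mul_sq_ne (G : LayerGenerators a c ζ σ τ ρ J)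
    (H : CyclotomicLayer p q n a c ζ) (hp : p % 8 = 5) (h8 : p * q % 8 = 7) {y₀ δ : L}
    (hδ : δ ∈ baseLayer σ τ ρ) (hy₀ : y₀ ∈ layer σ τ 0)
    (hy : p * (y₀ * ρ y₀) = δ ^ 2 ∨ p * (y₀ * ρ y₀) = -δ ^ 2) {j : ℕ} (hj : j ≤ n)
    {ε : L} (hε : ε = 1 ∨ ε = -1) {X Y : L} (hX : X ∈ layer σ τ j) (hY : Y ∈ layer σ τ j) :
    X ^ 2 - y₀ * Y ^ 2 ≠ ε * layerRoot n ζ j := by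
  induction j generalizing ε X Y with
  | zero => exact G.sq_sub_mul_sq_ne_base H hp h8 hδ hy hε hX hY
  | succ j ih =>
    intro h
    have S := G.quadraticStep_layer H hj
    have hgy : (τ ^ 2 ^ j) y₀ = y₀ := by
      have h1 := (mem_layer.1 hy₀).2
      rw [pow_zero, pow_one] at h1
      exact (MulAction.stabilizer (L ≃ₐ[ℚ] L) y₀).pow_mem (x := τ) h1 _
    have hyj : y₀ ∈ layer σ τ j := mem_layer.2 ⟨(mem_layer.1 hy₀).1, hgy⟩
    set g := τ ^ 2 ^ j with hg
    have hε2 : ε ^ 2 = 1 := by rcases hε with rfl | rfl <;> norm_num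
    have hgε : g ε = ε := by rcases hε with rfl | rfl <;> simp
    have h' := congrArg g h
    rw [map_sub, map_mul, map_pow, map_pow, map_mul, hgε, hgy, hg,
      G.τ_pow_layerRoot_succ H hj, ← hg] at h'
    have mem : X * g Y + Y * g X ∈ layer σ τ j := by
      refine (S.fixed _ (add_mem (mul_mem hX (S.map_mem _ hY)) (mul_mem hY (S.map_mem _ hX)))).1 ?_
      rw [map_add, map_mul, map_mul, S.invol _ hX, S.invol _ hY]
      ring
    refine ih (by omega) (Or.inr rfl)
      (add_mem (S.norm_mem hX) (mul_mem hyj (S.norm_mem hY))) mem ?_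
    have h2 := layerRoot_succ_sq (ζ := ζ) hj
    calc (X * g X + y₀ * (Y * g Y)) ^ 2 - y₀ * (X * g Y + Y * g X) ^ 2
        = (X ^ 2 - y₀ * Y ^ 2) * ((g X) ^ 2 - y₀ * (g Y) ^ 2) := by ring
      _ = -1 * layerRoot n ζ j := by
        rw [h, h', ← h2]; linear_combination -layerRoot n ζ (j + 1) ^ 2 * hε2

theorem mul_map_ne (G : LayerGenerators a c ζ σ τ ρ J)
    (H : CyclotomicLayer p q n a c ζ) (hp : p % 8 = 5) (h8 : p * q % 8 = 7) {y₀ δ : L}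
    (hδ : δ ∈ baseLayer σ τ ρ) (hδ0 : δ ≠ 0) (hy₀ : y₀ ∈ layer σ τ 0)
    (hy : p * (y₀ * ρ y₀) = δ ^ 2 ∨ p * (y₀ * ρ y₀) = -δ ^ 2) {j : ℕ} (hj : j + 1 ≤ n)
    {z : L} (hz : z ∈ layer σ τ (j + 1)) : z * (τ ^ 2 ^ j) z ≠ y₀ := by
  intro h
  have S := G.quadraticStep_layer H hj
  have hgr := G.τ_pow_layerRoot_succ H hj
  have hr0 := H.layerRoot_ne_zero (j + 1)
  have hr2 := layerRoot_succ_sq (ζ := ζ) hj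
  have hrmem : layerRoot n ζ (j + 1) ∈ layer σ τ (j + 1) :=
    mem_layer.2 ⟨G.σ_layerRoot _, G.τ_pow_layerRoot H hj⟩
  set g := τ ^ 2 ^ j with hg
  set r := layerRoot n ζ (j + 1) with hr
  obtain ⟨X, hX⟩ : ∃ x, x = (z + g z) / 2 := ⟨_, rfl⟩
  obtain ⟨Y, hY⟩ : ∃ x, x = (z - g z) / (2 * r) := ⟨_, rfl⟩
  have e1 : z = X + r * Y := by rw [hX, hY]; field_simp; ring
  have e2 : g z = X - r * Y := by rw [hX, hY]; field_simp; ring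
  have mX : X ∈ layer σ τ j := by
    rw [hX]
    refine (S.fixed _ (div_mem (add_mem hz (S.map_mem _ hz)) (ofNat_mem _ 2))).1 ?_
    rw [map_div₀, map_add, S.invol _ hz, map_ofNat, add_comm]
  have mY : Y ∈ layer σ τ j := by
    rw [hY]
    refine (S.fixed _ (div_mem (sub_mem hz (S.map_mem _ hz))
      (mul_mem (ofNat_mem _ 2) hrmem))).1 ?_
    rw [map_div₀, map_sub, S.invol _ hz, map_mul, map_ofNat, hgr]
    rw [mul_neg, div_neg, ← neg_div, neg_sub]
  rw [e2, e1] at h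
  have hXY : X ^ 2 - y₀ = layerRoot n ζ j * Y ^ 2 := by linear_combination h + Y ^ 2 * hr2
  by_cases hY0 : Y = 0
  · have hyX : y₀ = X ^ 2 := by rw [hY0] at hXY; linear_combination -hXY
    have hp0 : (p : L) ≠ 0 := by exact_mod_cast hpp.out.ne_zero
    have hN : X * ρ X ≠ 0 := by
      intro h0
      have : δ ^ 2 = 0 := by
        have e : (p : L) * (y₀ * ρ y₀) = p * (X * ρ X) ^ 2 := by rw [hyX, map_pow]; ring
        rw [e, h0] at hy
        rcases hy with hy | hy
        · linear_combination -hy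
        · linear_combination hy
      exact hδ0 (pow_eq_zero_iff two_ne_zero |>.1 this)
    have hσX : σ (X * ρ X) = X * ρ X := by
      rw [map_mul, H.comm σ ρ, (mem_layer.1 mX).1]
    have hσδ := (mem_baseLayer.1 hδ).1
    have hσi : σ (layerRoot n ζ 0) = layerRoot n ζ 0 := G.σ_layerRoot 0
    have hi2 := H.layerRoot_zero_sq
    have hsq : (a * (X * ρ X)) ^ 2 = δ ^ 2 ∨ (a * (X * ρ X)) ^ 2 = (layerRoot n ζ 0 * δ) ^ 2 := by
      rw [hyX, map_pow] at hy
      rcases hy with hy | hy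
      · left; linear_combination hy + (X * ρ X) ^ 2 * H.a_sq
      · right; linear_combination hy + (X * ρ X) ^ 2 * H.a_sq - δ ^ 2 * hi2
    have key : σ (a * (X * ρ X)) = a * (X * ρ X) := by
      rcases hsq with h1 | h1 <;> rcases sq_eq_sq_iff_eq_or_eq_neg.1 h1 with h2 | h2 <;> rw [h2] <;>
        simp only [map_neg, map_mul, hσδ, hσi]
    rw [map_mul, hσX, G.σ_a] at key
    have ha := H.a_ne_zero
    have : (2 : L) * (a * (X * ρ X)) = 0 := by linear_combination -key
    exact mul_ne_zero two_ne_zero (mul_ne_zero ha hN) this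
  · refine G.sq_sub_mul_sq_ne H hp h8 hδ hy₀ hy (j := j) (by omega) (Or.inl rfl)
      (div_mem mX mY) (inv_mem mY) ?_
    rw [div_pow, inv_pow, one_mul]
    field_simp
    linear_combination hXY

theorem mul_σ_ne (G : LayerGenerators a c ζ σ τ ρ J)
    (H : CyclotomicLayer p q n a c ζ) (hp : p % 8 = 5) (h8 : p * q % 8 = 7) {j : ℕ} (hj : j ≤ n)
    {w : L} (hw : (τ ^ 2 ^ j) w = w) : w * σ w ≠ 1 - layerRoot n ζ j := by
  induction j generalizing w with
  | zero =>
    intro h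
    rw [pow_zero, pow_one] at hw
    have hs : (a * c) ^ 2 = -((p * q : ℕ) : L) := by
      push_cast; rw [mul_pow, H.a_sq, H.c_sq]; ring
    have ha := H.a_ne_zero
    obtain ⟨z, hz⟩ : ∃ z, z = w * ρ w := ⟨_, rfl⟩
    have hτz : τ z = z := by rw [hz, map_mul, H.comm τ ρ, hw]
    have hρz : ρ z = z := by rw [hz, map_mul, G.ρ_ρ H, mul_comm]
    have hz2 : z * σ z = 2 := by
      have h' := congrArg ρ h
      rw [map_mul, map_sub, map_one, G.ρ_layerRoot_zero H, H.comm ρ σ] at h'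
      rw [hz, map_mul]
      calc w * ρ w * (σ w * σ (ρ w)) = (w * σ w) * (ρ w * σ (ρ w)) := by ring
        _ = 2 := by rw [h, h']; linear_combination -H.layerRoot_zero_sq
    refine two_ne_sq_sub_mul_sq h8 hs hp (x := (z + σ z) / 2) (y := (z - σ z) / (2 * a))
      (G.exists_rat_add_mul H ?_ ?_ ?_) (G.exists_rat_add_mul H ?_ ?_ ?_) ?_
    · rw [map_div₀, map_add, G.σ_σ H, map_ofNat, add_comm]
    · rw [map_div₀, map_add, H.comm τ σ, hτz, map_ofNat]
    · rw [map_div₀, map_add, H.comm ρ σ, hρz, map_ofNat]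
    · rw [map_div₀, map_sub, G.σ_σ H, map_mul, G.σ_a, map_ofNat, mul_neg, div_neg, ← neg_div,
        neg_sub]
    · rw [map_div₀, map_sub, H.comm τ σ, hτz, map_mul, G.τ_a, map_ofNat]
    · rw [map_div₀, map_sub, H.comm ρ σ, hρz, map_mul, G.ρ_a, map_ofNat]
    · have e : ((z + σ z) / 2) ^ 2 - a ^ 2 * ((z - σ z) / (2 * a)) ^ 2 = z * σ z := by
        field_simp; ring
      rw [← H.a_sq, e, hz2]
  | succ j ih =>
    intro h
    have h' := congrArg (τ ^ 2 ^ j : L ≃ₐ[ℚ] L) h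
    rw [map_mul, map_sub, map_one, G.τ_pow_layerRoot_succ H hj, H.comm _ σ] at h'
    refine ih (by omega) (w := w * (τ ^ 2 ^ j) w) ?_ ?_
    · rw [map_mul, ← AlgEquiv.mul_apply, ← pow_add, ← two_mul, ← pow_succ', hw, mul_comm]
    · rw [map_mul, ← layerRoot_succ_sq hj]
      calc _ = (w * σ w) * ((τ ^ 2 ^ j) w * σ ((τ ^ 2 ^ j) w)) := by ring
        _ = _ := by rw [h, h']; ring

end LayerGenerators

end

end

section

open NumberField IsDedekindDomain
open scoped nonZeroDivisors

section

variable {L : Type*} [Field L] [NumberField L]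
variable {n : ℕ} {s ζ : L} {π : 𝓞 L} {v₁ v₂ : HeightOneSpectrum (𝓞 L)}

namespace PlacesOverTwo

theorem log_valuation_two (P : PlacesOverTwo n s ζ π v₁ v₂) :
    WithZero.log (v₁.valuation L (2 : L)) = -(2 : ℤ) ^ (n + 1) := by
  have h := P.span_two
  rw [mul_pow] at h
  have := log_valuation_of_span_eq P.ne h
  push_cast at this
  exact this

theorem ordDiff_of_mem (P : PlacesOverTwo n s ζ π v₁ v₂) {γ γ' : 𝓞 L} {D : ℕ}
    (hmul : γ * γ' = 2 ^ D) (h₁ : γ' ∉ v₁.asIdeal) (h₂ : γ ∉ v₂.asIdeal) :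
    ordDiff v₁ v₂ (γ : L) = 2 ^ (n + 1) * D := by
  have one : ∀ (v : HeightOneSpectrum (𝓞 L)) {x : 𝓞 L}, x ∉ v.asIdeal →
      v.valuation L (x : L) = 1 := by
    intro v x hx
    refine le_antisymm (valuation_le_one_of_isIntegral v x.2) (not_lt.1 fun h => ?_)
    exact hx ((valuation_lt_one_iff_mem' v x).1 h)
  have hm : (γ : L) * γ' = 2 ^ D := by
    rw [← RingOfIntegers.coe_two_pow, ← hmul]; rfl
  have h := congrArg (v₁.valuation L) hm
  rw [map_mul, one v₁ h₁, mul_one, map_pow] at h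
  rw [ordDiff, h, one v₂ h₂, WithZero.log_one, WithZero.log_pow, P.log_valuation_two,
    nsmul_eq_mul]
  ring

theorem ordDiff_of_add_odd (P : PlacesOverTwo n s ζ π v₁ v₂) {γ γ' : 𝓞 L} {D : ℕ} (hD : 1 ≤ D)
    {x : ℤ} (hx : Odd x) (hadd : γ + γ' = x) (hmul : γ * γ' = 2 ^ D) {J : L ≃ₐ[ℚ] L}
    (hJ : J s = -s) (hγ : J γ = γ') (hγ' : J γ' = γ) :
    ordDiff v₁ v₂ (γ : L) = 2 ^ (n + 1) * D ∨ ordDiff v₁ v₂ (γ : L) = -(2 ^ (n + 1) * D) := by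
  have odd : ∀ v : HeightOneSpectrum (𝓞 L), (2 : 𝓞 L) ∈ v.asIdeal → γ ∈ v.asIdeal →
      γ' ∉ v.asIdeal := by
    intro v h2 h h'
    obtain ⟨k, rfl⟩ := hx
    refine v.isPrime.ne_top ((Ideal.eq_top_iff_one _).2 ?_)
    have e : (1 : 𝓞 L) = γ + γ' - 2 * k := by rw [hadd]; push_cast; ring
    rw [e]
    exact sub_mem (add_mem h h') (Ideal.mul_mem_right _ _ h2)
  have swap : ∀ {z z' : 𝓞 L}, J z = z' → z ∈ v₁.asIdeal → z' ∈ v₂.asIdeal := by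
    intro z z' h hz
    rw [P.map_eq_of_map_eq_neg hJ, show z' = integersEquiv J z from RingOfIntegers.ext h.symm]
    exact Ideal.mem_map_of_mem _ hz
  have h2 : γ * γ' ∈ v₁.asIdeal := by
    rw [hmul]; exact Ideal.pow_mem_of_mem _ P.two_mem₁ D hD
  rcases v₁.isPrime.mem_or_mem h2 with h | h
  · exact Or.inl (P.ordDiff_of_mem hmul (odd v₁ P.two_mem₁ h)
      fun h' => odd v₂ P.symm.two_mem₁ h' (swap hγ h))
  · right
    have h3 := P.symm.ordDiff_of_mem hmul (odd v₂ P.symm.two_mem₁ (swap hγ' h))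
      fun h' => odd v₁ P.two_mem₁ h' h
    rw [ordDiff] at h3 ⊢
    linarith

theorem pi_inv_mem (P : PlacesOverTwo n s ζ π v₁ v₂) : ∃ z : 𝓞 L, (1 - ζ) * (z : L) = 2 := by
  obtain ⟨u, hu⟩ := P.assoc
  refine ⟨π ^ (2 ^ (n + 1) - 1) * u, ?_⟩
  have h : π * (π ^ (2 ^ (n + 1) - 1) * u) = 2 := by
    rw [← mul_assoc, ← pow_succ', Nat.sub_add_cancel (Nat.one_le_two_pow), hu]
  rw [← P.coe_pi]
  exact congrArg (algebraMap (𝓞 L) L) h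

end PlacesOverTwo

/-- The half-integers `(x + y s) / 2` of norm `2 ^ D`. -/
theorem exists_integers_of_norm {d : ℕ} (hs : s ^ 2 = -(d : L)) {x y : ℤ} {D : ℕ}
    (h : x ^ 2 + d * y ^ 2 = 2 ^ (D + 2)) : ∃ γ γ' : 𝓞 L, (γ : L) = (x + y * s) / 2 ∧
      (γ' : L) = (x - y * s) / 2 ∧ γ + γ' = x ∧ γ * γ' = 2 ^ D := by
  have h' : (x : L) ^ 2 + d * y ^ 2 = 2 ^ (D + 2) := by exact_mod_cast congrArg (Int.cast : ℤ → L) h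
  have int : ∀ t : L, t ^ 2 = s ^ 2 → IsIntegral ℤ ((x + y * t) / 2) := by
    intro t ht
    refine ⟨Polynomial.X ^ 2 - Polynomial.C x * Polynomial.X + Polynomial.C (2 ^ D), ?_, ?_⟩
    · monicity!
    · simp only [Polynomial.eval₂_add, Polynomial.eval₂_sub, Polynomial.eval₂_mul,
        Polynomial.eval₂_pow, Polynomial.eval₂_X, Polynomial.eval₂_C]
      rw [eq_intCast, eq_intCast]
      push_cast
      rw [pow_add] at h'
      linear_combination (1 / 4 : L) * y ^ 2 * (ht + hs) - h' / 4
  refine ⟨⟨_, int s rfl⟩, ⟨_, int (-s) (by ring)⟩, rfl, ?_, RingOfIntegers.ext ?_,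
    RingOfIntegers.ext ?_⟩
  · change (x + y * (-s)) / 2 = _
    ring
  · have e : ((x : 𝓞 L) : L) = x := map_intCast (algebraMap (𝓞 L) L) x
    rw [e]
    change (x + y * s) / 2 + (x + y * (-s)) / 2 = (x : L)
    ring
  · rw [RingOfIntegers.coe_two_pow]
    change (x + y * s) / 2 * ((x + y * (-s)) / 2) = (2 : L) ^ D
    rw [pow_add] at h'
    linear_combination h' / 4 - (y : L) ^ 2 / 4 * hs

end

end

section

open NumberField IsDedekindDomain
open scoped nonZeroDivisors

section

variable {L : Type*} [Field L] [NumberField L]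
variable {p q : ℕ} [hpp : Fact p.Prime] [hqp : Fact q.Prime] {n : ℕ} {a c ζ : L}
variable {π : 𝓞 L} {v₁ v₂ : HeightOneSpectrum (𝓞 L)}

theorem CyclotomicLayer.s_sq (H : CyclotomicLayer p q n a c ζ) :
    (a * c) ^ 2 = -((p * q : ℕ) : L) := by
  push_cast; rw [mul_pow, H.a_sq, H.c_sq]; ring

namespace LayerGenerators

variable {σ τ ρ J : L ≃ₐ[ℚ] L}

theorem s_mem_base (G : LayerGenerators a c ζ σ τ ρ J) : a * c ∈ baseLayer σ τ ρ :=
  mem_baseLayer.2 ⟨G.σ_s, G.τ_s, G.ρ_s⟩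

theorem baseLayer_le_layer (j : ℕ) : baseLayer σ τ ρ ≤ layer σ τ j := by
  intro x hx
  obtain ⟨h1, h2, -⟩ := mem_baseLayer.1 hx
  exact mem_layer.2 ⟨h1, (MulAction.stabilizer (L ≃ₐ[ℚ] L) x).pow_mem (x := τ) h2 _⟩

theorem layer_zero_le_layer (j : ℕ) : layer σ τ 0 ≤ layer σ τ j := by
  intro x hx
  obtain ⟨h1, h2⟩ := mem_layer.1 hx
  rw [pow_zero, pow_one] at h2
  exact mem_layer.2 ⟨h1, (MulAction.stabilizer (L ≃ₐ[ℚ] L) x).pow_mem (x := τ) h2 _⟩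

theorem exists_rat_of_mem_base (G : LayerGenerators a c ζ σ τ ρ J)
    (H : CyclotomicLayer p q n a c ζ) :
    ∀ x ∈ baseLayer σ τ ρ, ∃ u v : ℚ, x = u + v * (a * c) := fun _ hx =>
  G.exists_rat_add_mul H (mem_baseLayer.1 hx).1 (mem_baseLayer.1 hx).2.1 (mem_baseLayer.1 hx).2.2

theorem mul_ρ_ne_neg_one (G : LayerGenerators a c ζ σ τ ρ J)
    (H : CyclotomicLayer p q n a c ζ) (h8 : p * q % 8 = 7) {X : L} (hX : X ∈ layer σ τ 0) :
    X * ρ X ≠ -1 := by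
  intro h
  have S := G.quadraticStep_base H
  have hρi : ρ (layerRoot n ζ 0) = -layerRoot n ζ 0 := G.ρ_layerRoot_zero H
  have hi2 := H.layerRoot_zero_sq
  have hi0 := H.layerRoot_ne_zero 0
  have himem : layerRoot n ζ 0 ∈ layer σ τ 0 :=
    mem_layer.2 ⟨G.σ_layerRoot 0, G.τ_pow_layerRoot H (Nat.zero_le n)⟩
  set i := layerRoot n ζ 0
  obtain ⟨x₁, hx₁⟩ : ∃ x, x = (X + ρ X) / 2 := ⟨_, rfl⟩
  obtain ⟨x₂, hx₂⟩ : ∃ x, x = (X - ρ X) / (2 * i) := ⟨_, rfl⟩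
  have e1 : X = x₁ + i * x₂ := by rw [hx₁, hx₂]; field_simp; ring
  have e2 : ρ X = x₁ - i * x₂ := by rw [hx₁, hx₂]; field_simp; ring
  have m1 : x₁ ∈ baseLayer σ τ ρ := by
    rw [hx₁]
    refine (S.fixed _ (div_mem (add_mem hX (S.map_mem _ hX)) (ofNat_mem _ 2))).1 ?_
    rw [map_div₀, map_add, S.invol _ hX, map_ofNat, add_comm]
  have m2 : x₂ ∈ baseLayer σ τ ρ := by
    rw [hx₂]
    refine (S.fixed _ (div_mem (sub_mem hX (S.map_mem _ hX))
      (mul_mem (ofNat_mem _ 2) himem))).1 ?_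
    rw [map_div₀, map_sub, S.invol _ hX, map_mul, map_ofNat, hρi]
    rw [mul_neg, div_neg, ← neg_div, neg_sub]
  rw [e2, e1] at h
  have hbase := G.exists_rat_of_mem_base H
  refine one_ne_zero (sq_add_sq_add_sq_eq_zero h8 H.s_sq (hbase _ m1) (hbase _ m2)
    (hbase _ (one_mem _)) ?_).2.2
  linear_combination h + x₂ ^ 2 * hi2

/-- Each layer has no square ideal class outside `2`, and the class of `v₁` is killed by
`2 ^ (n - 1) * D`. -/
theorem squarePrincipal_top (G : LayerGenerators a c ζ σ τ ρ J)
    (H : CyclotomicLayer p q n a c ζ) (P : PlacesOverTwo n (a * c) ζ π v₁ v₂)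
    (hp : p % 8 = 5) (hq : q % 8 = 3) (hn : 1 ≤ n) {D : ℕ} (hD : 1 ≤ D)
    (hT : TwoPowNorm (p * q) D) (hmin : ∀ t, 1 ≤ t → TwoPowNorm (p * q) t → D ∣ t) :
    SquarePrincipal (twoIntegers (⊤ : IntermediateField ℚ L)) ∧
      ClassGroup.mk0 (heightOneIdeal v₁) ^ (2 ^ (n - 1) * D) = 1 := by
  have hpq : p ≠ q := by omega
  have h8 : p * q % 8 = 7 := by rw [Nat.mul_mod, hp, hq]
  have hd : 0 < p * q := Nat.mul_pos hpp.out.pos hqp.out.pos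
  have hv := P.eq_or_eq
  obtain ⟨E, x, y, y₁, y₂, hE, rfl, hx, hxy, hsum, hdiff⟩ := exists_split hp hD hT hmin
  obtain ⟨γ, γ', hγ, hγ', hadd, hmul⟩ := exists_integers_of_norm (L := L) H.s_sq (x := x) (y := y)
    (D := 2 * E) (by push_cast; exact hxy)
  have hsb := G.s_mem_base
  have hγb : (γ : L) ∈ baseLayer σ τ ρ := by
    rw [hγ]
    exact div_mem (add_mem (intCast_mem _ x) (mul_mem (intCast_mem _ y) hsb)) (ofNat_mem _ 2)
  have hγb' : (γ' : L) ∈ baseLayer σ τ ρ := by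
    rw [hγ']
    exact div_mem (sub_mem (intCast_mem _ x) (mul_mem (intCast_mem _ y) hsb)) (ofNat_mem _ 2)
  have hmulL : (γ : L) * γ' = 2 ^ (2 * E) := by
    rw [← RingOfIntegers.coe_two_pow, ← hmul]; rfl
  have hγ0 : (γ : L) ≠ 0 := fun h => by
    rw [h, zero_mul] at hmulL
    exact pow_ne_zero _ two_ne_zero hmulL.symm
  have hγu : (γ : L) ∈ twoIntegers (baseLayer σ τ ρ) := mem_twoIntegers_of_isIntegral hγb γ.2
  have hγu' : (γ : L)⁻¹ ∈ twoIntegers (baseLayer σ τ ρ) := by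
    refine ⟨inv_mem hγb, 2 * E, ?_⟩
    rw [← hmulL, mul_comm, inv_mul_cancel_left₀ hγ0]
    exact γ'.2
  obtain ⟨δ, hδb, hδ⟩ : ∃ δ ∈ baseLayer σ τ ρ, p * (γ : L) = δ ^ 2 ∨ p * (γ : L) = -δ ^ 2 := by
    refine ⟨(p * y₁ + y₂ * (a * c)) / 2, div_mem (add_mem (mul_mem (natCast_mem _ p)
      (intCast_mem _ y₁)) (mul_mem (intCast_mem _ y₂) hsb)) (ofNat_mem _ 2), ?_⟩
    have hs := H.s_sq
    push_cast at hs
    rw [hγ]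
    rcases hdiff with ⟨h1, h2⟩ | ⟨h1, h2⟩
    · right
      have h1' : (p : L) * y₁ ^ 2 - q * y₂ ^ 2 = -2 * x := by
        exact_mod_cast congrArg (Int.cast : ℤ → L) h1
      have h2' : (y₁ : L) * y₂ = -y := by exact_mod_cast congrArg (Int.cast : ℤ → L) h2
      linear_combination (p : L) / 4 * h1' + (p : L) * (a * c) / 2 * h2' + (y₂ : L) ^ 2 / 4 * hs
    · left
      have h1' : (p : L) * y₁ ^ 2 - q * y₂ ^ 2 = 2 * x := by
        exact_mod_cast congrArg (Int.cast : ℤ → L) h1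
      have h2' : (y₁ : L) * y₂ = y := by exact_mod_cast congrArg (Int.cast : ℤ → L) h2
      linear_combination -(p : L) / 4 * h1' - (p : L) * (a * c) / 2 * h2' - (y₂ : L) ^ 2 / 4 * hs
  have hp0 : (p : L) ≠ 0 := by exact_mod_cast hpp.out.ne_zero
  have hδ0 : δ ≠ 0 := by
    rintro rfl
    refine mul_ne_zero hp0 hγ0 ?_
    rcases hδ with h | h <;> rw [h] <;> ring
  have P0 : SquarePrincipal (twoIntegers (baseLayer σ τ ρ)) :=
    squarePrincipal_of_imaginaryQuadratic hpq h8 hp hsum hsb H.s_sq (G.exists_rat_of_mem_base H)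
  have S0 := G.quadraticStep_base H
  have hnon0 : ∀ z ∈ layer σ τ 0, z * ρ z ≠ -1 := fun z hz => G.mul_ρ_ne_neg_one H h8 hz
  have hneg : (-1 : L) ∈ twoIntegers (baseLayer σ τ ρ) := neg_mem (one_mem _)
  have hneg' : (-1 : L)⁻¹ ∈ twoIntegers (baseLayer σ τ ρ) := by
    rw [inv_neg, inv_one]; exact hneg
  have hneg0 : (-1 : L) ≠ 0 := neg_ne_zero.2 one_ne_zero
  obtain ⟨y₀, hy₀, hy₀', hy₀0, hyγ⟩ := S0.exists_norm_eq hv hsb hd H.s_sq P0 hneg hneg' hneg0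
    hnon0 hγu hγu' hγ0
  have hyδ : p * (y₀ * ρ y₀) = δ ^ 2 ∨ p * (y₀ * ρ y₀) = -δ ^ 2 := by
    rcases hyγ with h | h <;> rw [h]
    · exact hδ
    · rcases hδ with h' | h'
      · right; linear_combination -h'
      · left; linear_combination -h'
  have Pj : ∀ j ≤ n, SquarePrincipal (twoIntegers (layer σ τ j)) := by
    intro j hj
    induction j with
    | zero => exact S0.squarePrincipal_top hv hsb hd H.s_sq P0 hneg hneg' hneg0 hnon0
    | succ j ih =>
      exact (G.quadraticStep_layer H hj).squarePrincipal_top hv (baseLayer_le_layer j hsb) hd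
        H.s_sq (ih (by omega)) (twoIntegers_mono (layer_zero_le_layer j) hy₀)
        (twoIntegers_mono (layer_zero_le_layer j) hy₀') hy₀0
        fun z hz => G.mul_map_ne H hp h8 hδb hδ0 hy₀.1 hyδ hj hz
  have St := G.quadraticStep_top H hpq
  have hζl : 1 - ζ ∈ layer σ τ n := by
    refine sub_mem (one_mem _) (mem_layer.2 ⟨G.σ_ζ, ?_⟩)
    rw [G.τ_pow_eq_one H]; rfl
  have hζu : 1 - ζ ∈ twoIntegers (layer σ τ n) :=
    mem_twoIntegers_of_isIntegral hζl (P.coe_pi ▸ π.2)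
  have hζ0 : 1 - ζ ≠ 0 := by
    obtain ⟨z, hz⟩ := P.pi_inv_mem
    exact left_ne_zero_of_mul (hz.trans_ne two_ne_zero)
  have hζu' : (1 - ζ)⁻¹ ∈ twoIntegers (layer σ τ n) := by
    obtain ⟨z, hz⟩ := P.pi_inv_mem
    refine ⟨inv_mem hζl, 1, ?_⟩
    rw [pow_one, ← hz, mul_comm, inv_mul_cancel_left₀ hζ0]
    exact z.2
  have hnont : ∀ z ∈ (⊤ : IntermediateField ℚ L), z * σ z ≠ 1 - ζ := by
    intro z _
    have := G.mul_σ_ne H hp h8 le_rfl (w := z) (by rw [G.τ_pow_eq_one H]; rfl)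
    rwa [layerRoot_self] at this
  refine ⟨St.squarePrincipal_top hv (baseLayer_le_layer n hsb) hd H.s_sq (Pj n le_rfl) hζu hζu' hζ0
    hnont, ?_⟩
  obtain ⟨w, hw, hw', hw0, hwy⟩ := St.exists_norm_eq hv (baseLayer_le_layer n hsb) hd H.s_sq
    (Pj n le_rfl) hζu hζu' hζ0 hnont (twoIntegers_mono (layer_zero_le_layer n) hy₀)
    (twoIntegers_mono (layer_zero_le_layer n) hy₀') hy₀0
  have h1 : 2 * ordDiff v₁ v₂ w = ordDiff v₁ v₂ y₀ := by
    have hσw : σ w ≠ 0 := (map_ne_zero σ).2 hw0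
    have h := ordDiff_mul (v₁ := v₁) (v₂ := v₂) hw0 hσw
    rw [P.ordDiff_map G.σ_s] at h
    rcases hwy with h' | h' <;> rw [h'] at h
    · omega
    · rw [ordDiff_mul hy₀0 hζ0, P.ordDiff_pi] at h; omega
  have h2 : 2 * ordDiff v₁ v₂ y₀ = ordDiff v₁ v₂ (γ : L) := by
    have hρy : ρ y₀ ≠ 0 := (map_ne_zero ρ).2 hy₀0
    have h := ordDiff_mul (v₁ := v₁) (v₂ := v₂) hy₀0 hρy
    rw [P.ordDiff_map G.ρ_s] at h
    rcases hyγ with h' | h' <;> rw [h'] at h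
    · omega
    · rw [ordDiff_mul hγ0 hneg0,
        ordDiff_eq_zero_of_pow_eq_one (x := (-1 : L)) two_ne_zero (neg_one_sq)] at h
      omega
  have hJγ : J (γ : L) = γ' := by
    rw [hγ, hγ', map_div₀, map_add, map_mul, map_intCast, map_intCast, map_ofNat, G.J_s]; ring
  have hJγ' : J (γ' : L) = γ := by rw [← hJγ, G.J_J H]
  have h3 := P.ordDiff_of_add_odd hD hx hadd hmul G.J_s hJγ hJγ'
  have hpow : (2 : ℤ) ^ (n + 1) = 4 * 2 ^ (n - 1) := by
    rw [show n + 1 = 2 + (n - 1) by omega, pow_add]; norm_num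
  have hfin := P.zpow_ordDiff_eq_one hw hw' hw0
  have e : ordDiff v₁ v₂ w = ((2 ^ (n - 1) * (2 * E) : ℕ) : ℤ) ∨
      ordDiff v₁ v₂ w = -((2 ^ (n - 1) * (2 * E) : ℕ) : ℤ) := by
    push_cast at h3 ⊢
    rw [← h2, ← h1, hpow] at h3
    rcases h3 with h3 | h3
    · left; linarith
    · right; linarith
  rcases e with e | e <;> rw [e] at hfin
  · rwa [zpow_natCast] at hfin
  · rwa [zpow_neg, inv_eq_one, zpow_natCast] at hfin

end LayerGenerators

end

end

section

open NumberField IsDedekindDomain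
open scoped nonZeroDivisors

section

variable {L : Type*} [Field L] [NumberField L]
variable {p q : ℕ} [hpp : Fact p.Prime] [hqp : Fact q.Prime] {n : ℕ} {a c ζ : L}
variable {π : 𝓞 L} {v₁ v₂ : HeightOneSpectrum (𝓞 L)}

namespace LayerGenerators

variable {σ τ ρ J : L ≃ₐ[ℚ] L}

/-- `J` is complex conjugation in every complex embedding. -/
theorem embedding_J (G : LayerGenerators a c ζ σ τ ρ J) (H : CyclotomicLayer p q n a c ζ)
    (φ : L →+* ℂ) (x : L) : φ (J x) = starRingEnd ℂ (φ x) := by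
  have hx : x ∈ IntermediateField.adjoin ℚ ({a, c, ζ} : Set L) := by
    rw [H.gen]; exact IntermediateField.mem_top
  induction hx using IntermediateField.adjoin_induction with
  | mem x hx =>
    rcases hx with rfl | rfl | rfl
    · rw [G.J_a]
      have h : (φ x) ^ 2 = (p : ℂ) := by rw [← map_pow, H.a_sq, map_natCast]
      have h' : (φ x) ^ 2 = ((Real.sqrt p : ℝ) : ℂ) ^ 2 := by
        rw [h, ← Complex.ofReal_pow, Real.sq_sqrt (Nat.cast_nonneg p), Complex.ofReal_natCast]
      rcases sq_eq_sq_iff_eq_or_eq_neg.1 h' with h' | h' <;> rw [h']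
      · rw [Complex.conj_ofReal]
      · rw [map_neg, Complex.conj_ofReal]
    · rw [G.J_c, map_neg]
      have h : (φ x) ^ 2 = -(q : ℂ) := by rw [← map_pow, H.c_sq, map_neg, map_natCast]
      have h' : (φ x) ^ 2 = (((Real.sqrt q : ℝ) : ℂ) * Complex.I) ^ 2 := by
        rw [h, mul_pow, ← Complex.ofReal_pow, Real.sq_sqrt (Nat.cast_nonneg q),
          Complex.ofReal_natCast, Complex.I_sq, mul_neg_one]
      rcases sq_eq_sq_iff_eq_or_eq_neg.1 h' with h' | h' <;> rw [h'] <;>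
        simp only [map_neg, map_mul, Complex.conj_ofReal, Complex.conj_I] <;> ring
    · rw [G.J_ζ, map_inv₀]
      have h1 : ‖φ x‖ = 1 := by
        refine (pow_eq_one_iff_of_nonneg (norm_nonneg _) (pow_ne_zero (n + 2) two_ne_zero)).1 ?_
        rw [← norm_pow, ← map_pow, H.prim.pow_eq_one, map_one, norm_one]
      exact Complex.inv_eq_conj h1
  | algebraMap x => simp
  | add x y _ _ hx hy => rw [map_add, map_add, hx, hy, map_add, map_add]
  | inv x _ hx => rw [map_inv₀, map_inv₀, hx, map_inv₀, map_inv₀]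
  | mul x y _ _ hx hy => rw [map_mul, map_mul, hx, hy, map_mul, map_mul]

theorem exists_div_J_pow_eq_one (G : LayerGenerators a c ζ σ τ ρ J)
    (H : CyclotomicLayer p q n a c ζ) {x : L} (hx : IsIntegral ℤ x) (hx' : IsIntegral ℤ x⁻¹)
    (hx0 : x ≠ 0) : ∃ N : ℕ, 0 < N ∧ (x / J x) ^ N = 1 := by
  have h_int : IsIntegral ℤ (x / J x) := by
    rw [div_eq_mul_inv, ← map_inv₀]
    exact hx.mul (isIntegral_map_algEquiv J hx')
  obtain ⟨N, hN, h⟩ := NumberField.Embeddings.pow_eq_one_of_norm_eq_one L ℂ h_int (fun φ => by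
    rw [map_div₀, G.embedding_J H, norm_div, Complex.norm_conj, div_self]
    exact norm_ne_zero_iff.2 ((map_ne_zero φ).2 hx0))
  exact ⟨N, hN, h⟩

theorem exists_eq_pow_of_pow_two_pow_eq_one (H : CyclotomicLayer p q n a c ζ) {s : L}
    (P : PlacesOverTwo n s ζ π v₁ v₂) (k : ℕ) {ξ : L} (h : ξ ^ 2 ^ k = 1) :
    ∃ i : ℕ, ξ = ζ ^ i := by
  have h_int : IsIntegral ℤ ζ := H.prim.isIntegral (by positivity)
  have hneg : ζ ^ 2 ^ (n + 1) = -1 := by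
    have := H.layerRoot_zero_sq
    rwa [layerRoot, ← pow_mul, ← pow_succ] at this
  induction k generalizing ξ with
  | zero => exact ⟨0, by simpa using h⟩
  | succ k ih =>
    obtain ⟨i, hi⟩ := ih (ξ := ξ ^ 2) (by rw [← pow_mul, ← pow_succ', h])
    obtain ⟨j, rfl | rfl⟩ := Nat.even_or_odd' i
    · have h' : ξ ^ 2 = (ζ ^ j) ^ 2 := by rw [hi, ← pow_mul, mul_comm]
      rcases sq_eq_sq_iff_eq_or_eq_neg.1 h' with h' | h'
      · exact ⟨j, h'⟩
      · exact ⟨2 ^ (n + 1) + j, by rw [h', pow_add, hneg, neg_one_mul]⟩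
    · refine absurd ?_ (P.sq_ne h_int (ξ * (ζ ^ j)⁻¹))
      have := pow_ne_zero j H.ζ_ne_zero
      rw [mul_pow, hi, inv_pow]
      field_simp
      ring

end LayerGenerators

end

end

section

open NumberField IsDedekindDomain
open scoped nonZeroDivisors

section

variable {L : Type*} [Field L] [NumberField L]
variable {p q : ℕ} [hpp : Fact p.Prime] [hqp : Fact q.Prime] {n : ℕ} {a c ζ : L}
variable {π : 𝓞 L} {v₁ v₂ : HeightOneSpectrum (𝓞 L)}

theorem exists_int_repr_of_mem (hpq : p ≠ q) (h8 : p * q % 8 = 7) {s : L}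
    (hs : s ^ 2 = -((p * q : ℕ) : L)) {K : IntermediateField ℚ L} (hsK : s ∈ K)
    (hall : ∀ x ∈ K, ∃ u v : ℚ, x = u + v * s) {x : L} (hxK : x ∈ K) (hx : IsIntegral ℤ x) :
    ∃ X Y : ℤ, 2 ∣ X - Y ∧ 2 * x = X + Y * s := by
  obtain ⟨J, H⟩ := exists_imaginaryQuadratic (F := K) (s := ⟨s, hsK⟩) (p := p) (q := q)
    (Subtype.ext (by simpa using hs)) (fun x => by
      obtain ⟨u, v, h⟩ := hall x x.2
      exact ⟨u, v, Subtype.ext (by simpa using h)⟩)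
  have hx' : IsIntegral ℤ (⟨x, hxK⟩ : K) :=
    (isIntegral_algHom_iff (K.val.restrictScalars ℤ) K.val.injective).1 hx
  obtain ⟨X, Y, h, h'⟩ := H.exists_int_repr hpq (by omega) hx'
  exact ⟨X, Y, h, congrArg Subtype.val h'⟩

/-- An element of the imaginary quadratic field, integral outside `2` and of norm `1` or `2`, is
`±1` or comes from a representation of a power of `2` by the norm form. -/
theorem eq_one_or_exists_odd_repr (hpq : p ≠ q) (h8 : p * q % 8 = 7) {s : L}
    (hs : s ^ 2 = -((p * q : ℕ) : L)) {K : IntermediateField ℚ L} (hsK : s ∈ K)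
    (hall : ∀ x ∈ K, ∃ u v : ℚ, x = u + v * s) {J : L ≃ₐ[ℚ] L} (hJ : J s = -s) {g : L}
    (hg : g ∈ twoIntegers K) {e : ℕ} (he : e ≤ 1) (hgJ : g * J g = 2 ^ e) :
    (e = 0 ∧ (g = 1 ∨ g = -1)) ∨ ∃ (N : ℕ) (X Y : ℤ), Odd X ∧
      X ^ 2 + (p * q : ℕ) * Y ^ 2 = 2 ^ (2 * N + e + 2) ∧ 2 * (2 ^ N * g) = X + Y * s := by
  classical
  obtain ⟨hgK, hex⟩ := hg
  obtain ⟨N, hN, hmin⟩ : ∃ N, IsIntegral ℤ (2 ^ N * g) ∧ ∀ M < N, ¬ IsIntegral ℤ (2 ^ M * g) :=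
    ⟨Nat.find hex, Nat.find_spec hex, fun M hM => Nat.find_min hex hM⟩
  obtain ⟨X, Y, hXY, hrep⟩ := exists_int_repr_of_mem hpq h8 hs hsK hall
    (mul_mem (pow_mem (ofNat_mem K 2) N) hgK) hN
  have hnorm : X ^ 2 + (p * q : ℕ) * Y ^ 2 = 2 ^ (2 * N + e + 2) := by
    have hrep' := congrArg J hrep
    simp only [map_mul, map_add, map_pow, map_ofNat, map_intCast, hJ] at hrep'
    have : (X : L) ^ 2 + (p * q : ℕ) * Y ^ 2 = 2 ^ (2 * N + e + 2) := by
      calc (X : L) ^ 2 + (p * q : ℕ) * Y ^ 2 = (X + Y * s) * (X + Y * -s) := by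
            linear_combination (Y : L) ^ 2 * hs
        _ = (2 * (2 ^ N * g)) * (2 * (2 ^ N * J g)) := by rw [hrep, hrep']
        _ = 4 * 2 ^ (2 * N) * (g * J g) := by rw [pow_mul']; ring
        _ = _ := by rw [hgJ, pow_add, pow_add]; ring
    exact_mod_cast this
  rcases Int.even_or_odd X with hX | hX
  swap
  · exact Or.inr ⟨N, X, Y, hX, hnorm, hrep⟩
  left
  obtain ⟨X', rfl⟩ := hX.two_dvd
  obtain ⟨Y', rfl⟩ : (2 : ℤ) ∣ Y := by omega
  have hnorm' : X' ^ 2 + (p * q : ℕ) * Y' ^ 2 = 2 ^ (2 * N + e) := by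
    rw [pow_add 2 (2 * N + e)] at hnorm
    linarith
  have hrep' : 2 ^ N * g = X' + Y' * s := by
    push_cast at hrep
    refine mul_left_cancel₀ (two_ne_zero (α := L)) ?_
    linear_combination hrep
  cases N with
  | zero =>
    have hd : (7 : ℤ) ≤ (p * q : ℕ) := by exact_mod_cast (show 7 ≤ p * q by omega)
    have h2 : (2 : ℤ) ^ (2 * 0 + e) ≤ 2 := by interval_cases e <;> norm_num
    have hY : Y' = 0 := by
      by_contra hY
      have : 1 ≤ Y' ^ 2 := by
        have := sq_pos_of_ne_zero hY
        omega
      nlinarith [sq_nonneg X']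
    subst hY
    rw [pow_zero, one_mul, Int.cast_zero, zero_mul, add_zero] at hrep'
    interval_cases e
    · refine ⟨rfl, ?_⟩
      have : X' ^ 2 = 1 := by simpa using hnorm'
      rcases mul_self_eq_one_iff.1 ((pow_two X').symm.trans this) with h | h
      · left; rw [hrep', h, Int.cast_one]
      · right; rw [hrep', h, Int.cast_neg, Int.cast_one]
    · exfalso
      have h : X' ^ 2 = 2 := by simpa using hnorm'
      have h1 : X' < 2 := by nlinarith
      have h2 : -2 < X' := by nlinarith
      interval_cases X' <;> omega
  | succ M =>
    exfalso
    obtain ⟨γ, -, hγ, -⟩ := exists_integers_of_norm (L := L) hs (x := X') (y := Y')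
      (D := 2 * M + e) (by rw [hnorm']; ring)
    refine hmin M M.lt_succ_self ?_
    have : 2 ^ M * g = (γ : L) := by
      rw [hγ, ← hrep', pow_succ]; ring
    rw [this]
    exact γ.2

theorem PlacesOverTwo.dvd_ordDiff_of_norm (hpq : p ≠ q) (h8 : p * q % 8 = 7) (hp : p % 8 = 5)
    {D : ℕ} (hmin : ∀ t, 1 ≤ t → TwoPowNorm (p * q) t → D ∣ t) {s : L}
    (P : PlacesOverTwo n s ζ π v₁ v₂)
    (hs : s ^ 2 = -((p * q : ℕ) : L)) {K : IntermediateField ℚ L} (hsK : s ∈ K)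
    (hall : ∀ x ∈ K, ∃ u v : ℚ, x = u + v * s) {J : L ≃ₐ[ℚ] L} (hJ : J s = -s) {g : L}
    (hg : g ∈ twoIntegers K) {e : ℕ} (he : e ≤ 1) (hgJ : g * J g = 2 ^ e) :
    e = 0 ∧ (2 ^ (n + 1) * D : ℤ) ∣ ordDiff v₁ v₂ g := by
  rcases eq_one_or_exists_odd_repr hpq h8 hs hsK hall hJ hg he hgJ with
    ⟨he, h | h⟩ | ⟨N, X, Y, hX, hnorm, hrep⟩
  · exact ⟨he, by rw [h, ordDiff_one]; exact dvd_zero _⟩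
  · refine ⟨he, ?_⟩
    rw [h, ordDiff_eq_zero_of_pow_eq_one two_ne_zero (neg_one_sq)]
    exact dvd_zero _
  have hT : TwoPowNorm (p * q) (2 * N + e) := ⟨X, Y, hX, hnorm⟩
  obtain rfl : e = 0 := by
    obtain ⟨k, hk⟩ := hT.even hp
    omega
  refine ⟨rfl, ?_⟩
  rw [add_zero] at hnorm hT
  have hN : 1 ≤ 2 * N := by
    by_contra hN
    obtain rfl : N = 0 := by omega
    have hd : (7 : ℤ) ≤ (p * q : ℕ) := by exact_mod_cast (show 7 ≤ p * q by omega)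
    have hY : Y = 0 := by
      by_contra hY
      have : 1 ≤ Y ^ 2 := by
        have := sq_pos_of_ne_zero hY
        omega
      rw [show (2 : ℤ) ^ (2 * 0 + 2) = 4 by norm_num] at hnorm
      nlinarith [sq_nonneg X]
    subst hY
    have h : X ^ 2 = 4 := by simpa using hnorm
    have := hX.pow (n := 2)
    rw [h] at this
    exact absurd this (by decide)
  obtain ⟨E, hE⟩ := hmin _ hN hT
  obtain ⟨γ, γ', hγ, hγ', hadd, hmul⟩ := exists_integers_of_norm hs hnorm
  have hgγ : 2 ^ N * g = (γ : L) := by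
    rw [hγ, ← hrep]; ring
  have hg0 : g ≠ 0 := by
    rintro rfl
    rw [zero_mul, pow_zero] at hgJ
    exact zero_ne_one hgJ
  have key := P.ordDiff_of_add_odd hN hX hadd hmul hJ
    (by rw [hγ, hγ']; simp only [map_div₀, map_add, map_mul, map_intCast, map_ofNat, hJ]; ring)
    (by rw [hγ, hγ']; simp only [map_div₀, map_sub, map_mul, map_intCast, map_ofNat, hJ]; ring)
  rw [← hgγ, ordDiff_mul (pow_ne_zero _ two_ne_zero) hg0, ordDiff_pow, P.ordDiff_two, mul_zero,
    zero_add, hE] at key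
  rcases key with h | h <;> rw [h]
  · exact ⟨E, by push_cast; ring⟩
  · exact ⟨-E, by push_cast; ring⟩

end

end

section

open NumberField IsDedekindDomain
open scoped nonZeroDivisors

section

variable {L : Type*} [Field L] [NumberField L]
variable {p q : ℕ} [hpp : Fact p.Prime] [hqp : Fact q.Prime] {n : ℕ} {a c ζ : L}
variable {π : 𝓞 L} {v₁ v₂ : HeightOneSpectrum (𝓞 L)}

namespace LayerGenerators

variable {σ τ ρ J : L ≃ₐ[ℚ] L}

theorem J_layerRoot_zero (G : LayerGenerators a c ζ σ τ ρ J) (H : CyclotomicLayer p q n a c ζ) :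
    J (layerRoot n ζ 0) = -layerRoot n ζ 0 := by
  have h : J (layerRoot n ζ 0) = (layerRoot n ζ 0)⁻¹ := by
    rw [layerRoot, map_pow, G.J_ζ, inv_pow]
  rw [h]
  refine (eq_inv_of_mul_eq_one_left ?_).symm
  linear_combination -H.layerRoot_zero_sq

/-- An element fixed by `σ` and `τ`, multiplied by a fourth root of unity under `ρ` and with
inverse complex conjugate, comes from the imaginary quadratic field up to a root of unity. -/
theorem dvd_ordDiff_of_ρ (G : LayerGenerators a c ζ σ τ ρ J)
    (H : CyclotomicLayer p q n a c ζ) (P : PlacesOverTwo n (a * c) ζ π v₁ v₂)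
    (hp : p % 8 = 5) (hq : q % 8 = 3) {D : ℕ}
    (hmin : ∀ t, 1 ≤ t → TwoPowNorm (p * q) t → D ∣ t) {b : L}
    (hb : b ∈ twoIntegers (⊤ : IntermediateField ℚ L)) (hb0 : b ≠ 0) (hσ : σ b = b) (hτ : τ b = b)
    (hJ : J b = b⁻¹) {k : ℕ} (hρ : ρ b = layerRoot n ζ 0 ^ k * b) :
    (2 ^ (n + 1) * D : ℤ) ∣ ordDiff v₁ v₂ b := by
  have hpq : p ≠ q := by omega
  have h8 : p * q % 8 = 7 := by rw [Nat.mul_mod, hp, hq]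
  have hi2 := H.layerRoot_zero_sq
  have hi0 := H.layerRoot_ne_zero 0
  have hσi : σ (layerRoot n ζ 0) = layerRoot n ζ 0 := G.σ_layerRoot 0
  have hτi : τ (layerRoot n ζ 0) = layerRoot n ζ 0 := G.τ_pow_layerRoot H (Nat.zero_le n)
  have hρi : ρ (layerRoot n ζ 0) = -layerRoot n ζ 0 := G.ρ_layerRoot_zero H
  have hJi := G.J_layerRoot_zero H
  set i := layerRoot n ζ 0
  have hi : i ∈ twoIntegers (⊤ : IntermediateField ℚ L) :=
    mem_twoIntegers_of_isIntegral IntermediateField.mem_top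
      (IsIntegral.of_pow two_pos (hi2 ▸ isIntegral_one.neg))
  have hoi : ordDiff v₁ v₂ i = 0 :=
    ordDiff_eq_zero_of_pow_eq_one (n := 4) (by decide) (by linear_combination (i ^ 2 - 1) * hi2)
  have key : ∀ {g : L} {e : ℕ}, g ∈ twoIntegers (⊤ : IntermediateField ℚ L) → e ≤ 1 →
      σ g = g → τ g = g → ρ g = g → g * J g = 2 ^ e →
      e = 0 ∧ (2 ^ (n + 1) * D : ℤ) ∣ ordDiff v₁ v₂ g := fun hg he h1 h2 h3 h4 =>
    P.dvd_ordDiff_of_norm hpq h8 hp hmin H.s_sq G.s_mem_base (G.exists_rat_of_mem_base H) G.J_s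
      ⟨mem_baseLayer.2 ⟨h1, h2, h3⟩, hg.2⟩ he h4
  have hik : i ^ k = 1 ∨ i ^ k = -1 ∨ i ^ k = i ∨ i ^ k = -i := by
    obtain ⟨j, rfl | rfl⟩ := Nat.even_or_odd' k
    · rw [pow_mul, hi2]
      rcases neg_one_pow_eq_or L j with h | h <;> simp [h]
    · rw [pow_succ, pow_mul, hi2]
      rcases neg_one_pow_eq_or L j with h | h <;> simp [h]
  rcases hik with h | h | h | h <;> rw [h] at hρ
  · exact (key hb zero_le_one hσ hτ (by rw [hρ, one_mul])
      (by rw [hJ, mul_inv_cancel₀ hb0, pow_zero])).2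
  · have := (key (g := i * b) (e := 0) (mul_mem hi hb) zero_le_one (by rw [map_mul, hσi, hσ])
      (by rw [map_mul, hτi, hτ]) (by rw [map_mul, hρi, hρ]; ring)
      (by rw [map_mul, hJi, hJ]; field_simp; linear_combination -hi2)).2
    rwa [ordDiff_mul hi0 hb0, hoi, zero_add] at this
  · refine absurd (key (g := (1 + i) * b) (e := 1) (mul_mem (add_mem (one_mem _) hi) hb) le_rfl
      (by rw [map_mul, map_add, map_one, hσi, hσ]) (by rw [map_mul, map_add, map_one, hτi, hτ])
      (by rw [map_mul, map_add, map_one, hρi, hρ]; linear_combination -b * hi2)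
      (by rw [map_mul, map_add, map_one, hJi, hJ]; field_simp; linear_combination -hi2)).1
      one_ne_zero
  · refine absurd (key (g := (1 - i) * b) (e := 1) (mul_mem (sub_mem (one_mem _) hi) hb) le_rfl
      (by rw [map_mul, map_sub, map_one, hσi, hσ]) (by rw [map_mul, map_sub, map_one, hτi, hτ])
      (by rw [map_mul, map_sub, map_one, hρi, hρ]; linear_combination -b * hi2)
      (by rw [map_mul, map_sub, map_one, hJi, hJ]; field_simp; linear_combination -hi2)).1
      one_ne_zero

theorem four_dvd_of_τ (G : LayerGenerators a c ζ σ τ ρ J)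
    (H : CyclotomicLayer p q n a c ζ) {b : L} (hb0 : b ≠ 0) {r : ℕ} (hτ : τ b = ζ ^ r * b) :
    4 ∣ r := by
  have hk : ∀ k : ℕ, ∃ S : ℕ, 4 * S + 1 = 5 ^ k ∧ (τ ^ k) b = ζ ^ (r * S) * b := by
    intro k
    induction k with
    | zero => exact ⟨0, rfl, by simp⟩
    | succ k ih =>
      obtain ⟨S, hS, h⟩ := ih
      refine ⟨5 * S + 1, by rw [pow_succ, ← hS]; ring, ?_⟩
      rw [pow_succ', AlgEquiv.mul_apply, h, map_mul, map_pow, G.τ_ζ, hτ, ← pow_mul]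
      ring
  obtain ⟨S, hS, h⟩ := hk (2 ^ n)
  rw [G.τ_pow_eq_one H, AlgEquiv.one_apply] at h
  have h1 : ζ ^ (r * S) = 1 := mul_right_cancel₀ hb0 (by rw [one_mul, ← h])
  obtain ⟨k, hk⟩ := exists_five_pow n
  have hS' : S = 2 ^ n * (2 * k + 1) := by
    rw [hk, pow_add] at hS
    have : 2 ^ n * 2 ^ 2 * (2 * k + 1) = 4 * (2 ^ n * (2 * k + 1)) := by ring
    omega
  have hd := H.prim.dvd_of_pow_eq_one _ h1
  rw [hS', pow_add, mul_left_comm] at hd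
  have h4 : 4 ∣ r * (2 * k + 1) := (Nat.mul_dvd_mul_iff_left (by positivity)).1 hd
  refine Nat.Coprime.dvd_of_dvd_mul_right ?_ h4
  exact Nat.Coprime.pow_left 2 (Nat.coprime_two_left.2 ⟨k, rfl⟩)

theorem dvd_ordDiff_of_τ_ρ (G : LayerGenerators a c ζ σ τ ρ J)
    (H : CyclotomicLayer p q n a c ζ) (P : PlacesOverTwo n (a * c) ζ π v₁ v₂)
    (hp : p % 8 = 5) (hq : q % 8 = 3) {D : ℕ}
    (hmin : ∀ t, 1 ≤ t → TwoPowNorm (p * q) t → D ∣ t) {b : L}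
    (hb : b ∈ twoIntegers (⊤ : IntermediateField ℚ L)) (hb0 : b ≠ 0) (hσ : σ b = b)
    (hJ : J b = b⁻¹) {r j : ℕ} (hτ : τ b = ζ ^ r * b) (hρ : ρ b = ζ ^ j * b) :
    (2 ^ (n + 1) * D : ℤ) ∣ ordDiff v₁ v₂ b := by
  obtain ⟨r, rfl⟩ := G.four_dvd_of_τ H hb0 hτ
  have hζ0 := H.ζ_ne_zero
  have hN : ζ ^ 2 ^ (n + 2) = 1 := H.prim.pow_eq_one
  obtain ⟨b', hb'⟩ : ∃ b', b = ζ ^ r * b' := ⟨b / ζ ^ r, by field_simp⟩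
  have hb'0 : b' ≠ 0 := by
    rintro rfl
    exact hb0 (by rw [hb', mul_zero])
  have hζr : ζ ^ r ≠ 0 := pow_ne_zero _ hζ0
  have hord : ordDiff v₁ v₂ b = ordDiff v₁ v₂ b' := by
    rw [hb', ordDiff_mul hζr hb'0, ordDiff_pow,
      ordDiff_eq_zero_of_pow_eq_one (pow_ne_zero _ two_ne_zero) hN, mul_zero, zero_add]
  have hb'm : b' ∈ twoIntegers (⊤ : IntermediateField ℚ L) := by
    have : b' = (ζ ^ r)⁻¹ * b := by rw [hb', inv_mul_cancel_left₀ hζr]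
    rw [this]
    refine mul_mem (mem_twoIntegers_of_isIntegral IntermediateField.mem_top ?_) hb
    refine IsIntegral.of_pow (n := 2 ^ (n + 2)) (by positivity) ?_
    rw [inv_pow, ← pow_mul, mul_comm r, pow_mul, hN, one_pow, inv_one]
    exact isIntegral_one
  rw [hb'] at hσ hJ hτ hρ
  rw [map_mul, map_pow] at hσ hJ hτ hρ
  rw [G.σ_ζ] at hσ
  rw [G.J_ζ, inv_pow, mul_inv] at hJ
  rw [G.τ_ζ] at hτ
  rw [G.ρ_ζ, inv_pow] at hρ
  have hσ' : σ b' = b' := mul_left_cancel₀ hζr hσ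
  have hJ' : J b' = b'⁻¹ := mul_left_cancel₀ (inv_ne_zero hζr) hJ
  have hτ' : τ b' = b' := by
    refine mul_left_cancel₀ (pow_ne_zero r (pow_ne_zero 5 hζ0)) (hτ.trans ?_)
    ring
  have hρ' : ρ b' = ζ ^ (j + 2 * r) * b' := by
    refine mul_left_cancel₀ (inv_ne_zero hζr) (hρ.trans ?_)
    field_simp
    ring
  have h5 : ζ ^ (4 * (j + 2 * r)) = 1 := by
    have h := H.comm τ ρ b'
    rw [hτ', hρ', map_mul, hτ', map_pow, G.τ_ζ] at h
    refine mul_left_cancel₀ (pow_ne_zero (j + 2 * r) hζ0) (mul_right_cancel₀ hb'0 ?_)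
    rw [mul_one, ← h]
    ring
  obtain ⟨k, hk⟩ : 2 ^ n ∣ j + 2 * r := by
    have hd := H.prim.dvd_of_pow_eq_one _ h5
    rw [pow_add, mul_comm (2 ^ n)] at hd
    exact (Nat.mul_dvd_mul_iff_left (by norm_num)).1 hd
  rw [hk, pow_mul] at hρ'
  rw [hord]
  exact G.dvd_ordDiff_of_ρ H P hp hq hmin hb'm hb'0 hσ' hτ' hJ' hρ'

end LayerGenerators

end

end

section

open NumberField IsDedekindDomain
open scoped nonZeroDivisors

section

variable {L : Type*} [Field L] [NumberField L]
variable {p q : ℕ} [hpp : Fact p.Prime] [hqp : Fact q.Prime] {n : ℕ} {a c ζ : L}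
variable {π : 𝓞 L} {v₁ v₂ : HeightOneSpectrum (𝓞 L)}

namespace LayerGenerators

variable {σ τ ρ J : L ≃ₐ[ℚ] L}

theorem exists_map_div_pow_eq_one (G : LayerGenerators a c ζ σ τ ρ J)
    (H : CyclotomicLayer p q n a c ζ) (P : PlacesOverTwo n (a * c) ζ π v₁ v₂)
    {g : L ≃ₐ[ℚ] L} (hg : g (a * c) = a * c) {t : ℕ} {x : 𝓞 L} (hx0 : (x : L) ≠ 0)
    (hx : v₁.asIdeal ^ t = Ideal.span {x}) {y : L} (hy : y = x / J x) :
    ∃ N : ℕ, 0 < N ∧ (g y / y) ^ N = 1 := by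
  have hspan : Ideal.span {integersEquiv g x} = Ideal.span {x} := by
    rw [← hx, ← Set.image_singleton, ← Ideal.map_span (integersEquiv g), ← hx, Ideal.map_pow,
      ← P.map_eq_of_map_eq hg]
  obtain ⟨u, hu⟩ := Ideal.span_singleton_eq_span_singleton.1 hspan.symm
  have hu' : (x : L) * ((u : 𝓞 L) : L) = g x := congrArg (algebraMap (𝓞 L) L) hu
  have huinv : ((u : 𝓞 L) : L)⁻¹ = ((u⁻¹ : (𝓞 L)ˣ) : 𝓞 L) := by
    refine (eq_inv_of_mul_eq_one_left ?_).symm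
    exact congrArg (algebraMap (𝓞 L) L) u.inv_mul
  have hu0 : ((u : 𝓞 L) : L) ≠ 0 := fun h => by
    rw [h, mul_zero] at hu'
    exact hx0 ((map_eq_zero g).1 hu'.symm)
  obtain ⟨N, hN, h⟩ := G.exists_div_J_pow_eq_one H (RingOfIntegers.isIntegral_coe _)
    (huinv ▸ RingOfIntegers.isIntegral_coe _) hu0
  refine ⟨N, hN, ?_⟩
  have hJx : J (x : L) ≠ 0 := (map_ne_zero J).2 hx0
  have hJu : J ((u : 𝓞 L) : L) ≠ 0 := (map_ne_zero J).2 hu0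
  have e : g y / y = (u : 𝓞 L) / J (u : 𝓞 L) := by
    rw [hy, map_div₀, H.comm g J, ← hu', map_mul]
    field_simp
  rw [e, h]

/-- Up to an odd factor, the order of the class of `v₁` is at least `2 ^ (n - 1) * D`. -/
theorem exists_odd_dvd_mul (G : LayerGenerators a c ζ σ τ ρ J)
    (H : CyclotomicLayer p q n a c ζ) (P : PlacesOverTwo n (a * c) ζ π v₁ v₂)
    (hp : p % 8 = 5) (hq : q % 8 = 3) (hn : 1 ≤ n) {D : ℕ}
    (hmin : ∀ t, 1 ≤ t → TwoPowNorm (p * q) t → D ∣ t) {t : ℕ}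
    (ht : ClassGroup.mk0 (heightOneIdeal v₁) ^ t = 1) :
    ∃ w, Odd w ∧ 2 ^ (n - 1) * D ∣ t * w := by
  rw [← map_pow, ClassGroup.mk0_eq_one_iff] at ht
  obtain ⟨x, hx⟩ : ∃ x : 𝓞 L, v₁.asIdeal ^ t = Ideal.span {x} := ht.principal
  have hx0' : x ≠ 0 := by
    rintro rfl
    rw [Ideal.span_singleton_zero] at hx
    exact pow_ne_zero t v₁.ne_bot hx
  have hx0 : (x : L) ≠ 0 := fun h => hx0' (RingOfIntegers.ext h)
  have hJx0 : J (x : L) ≠ 0 := (map_ne_zero J).2 hx0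
  have hordx : ordDiff v₁ v₂ (x : L) = t := by
    have := ordDiff_of_span_eq P.ne (a := t) (b := 0) (x := x) (by rw [pow_zero, mul_one, hx])
    simpa using this
  obtain ⟨z, hz⟩ : x ∣ 2 ^ t := by
    rw [← Ideal.mem_span_singleton, ← hx]
    exact Ideal.pow_mem_pow P.two_mem₁ t
  have hz' : (2 : L) ^ t = x * z := by rw [← RingOfIntegers.coe_two_pow, hz]; rfl
  have hxinv : (x : L)⁻¹ ∈ twoIntegers (⊤ : IntermediateField ℚ L) := by
    refine ⟨IntermediateField.mem_top, t, ?_⟩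
    rw [hz', mul_comm, inv_mul_cancel_left₀ hx0]
    exact RingOfIntegers.isIntegral_coe z
  obtain ⟨y, hy⟩ : ∃ y : L, y = x / J x := ⟨_, rfl⟩
  have hy0 : y ≠ 0 := by rw [hy]; exact div_ne_zero hx0 hJx0
  have hym : y ∈ twoIntegers (⊤ : IntermediateField ℚ L) := by
    rw [hy, div_eq_mul_inv, ← map_inv₀]
    exact mul_mem (mem_twoIntegers_of_isIntegral IntermediateField.mem_top
      (RingOfIntegers.isIntegral_coe x)) (map_mem_twoIntegers J IntermediateField.mem_top hxinv)
  have hJy : J y = y⁻¹ := by rw [hy, map_div₀, G.J_J H, inv_div]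
  have hordy : ordDiff v₁ v₂ y = 2 * t := by
    rw [hy, div_eq_mul_inv, ordDiff_mul hx0 (inv_ne_zero hJx0), ordDiff_inv,
      P.ordDiff_map_neg G.J_s, hordx]
    ring
  obtain ⟨N₁, hN₁, h₁⟩ := G.exists_map_div_pow_eq_one H P G.τ_s hx0 hx hy
  obtain ⟨N₂, hN₂, h₂⟩ := G.exists_map_div_pow_eq_one H P G.ρ_s hx0 hx hy
  obtain ⟨k, w, hw, hNw⟩ := Nat.exists_eq_two_pow_mul_odd (n := N₁ * N₂) (by positivity)
  refine ⟨w, hw, ?_⟩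
  have hσy0 : σ y ≠ 0 := (map_ne_zero σ).2 hy0
  have root : ∀ (g : L ≃ₐ[ℚ] L), (g y / y) ^ (N₁ * N₂) = 1 →
      ∃ i, g ((y * σ y) ^ w) = ζ ^ i * (y * σ y) ^ w := by
    intro g h
    have h' : (g (y * σ y) / (y * σ y)) ^ (N₁ * N₂) = 1 := by
      rw [map_mul, mul_div_mul_comm, mul_pow, h, one_mul, H.comm g σ, ← map_div₀, ← map_pow, h,
        map_one]
    rw [hNw, mul_comm (2 ^ k), pow_mul] at h'
    obtain ⟨i, hi⟩ := exists_eq_pow_of_pow_two_pow_eq_one H P k h'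
    refine ⟨i, ?_⟩
    rw [← hi, map_pow, div_pow, div_mul_cancel₀]
    exact pow_ne_zero _ (mul_ne_zero hy0 hσy0)
  obtain ⟨r, hr⟩ := root τ (by rw [pow_mul, h₁, one_pow])
  obtain ⟨j, hj⟩ := root ρ (by rw [mul_comm, pow_mul, h₂, one_pow])
  have key := G.dvd_ordDiff_of_τ_ρ H P hp hq hmin
    (pow_mem (mul_mem hym (map_mem_twoIntegers σ IntermediateField.mem_top hym)) w)
    (pow_ne_zero w (mul_ne_zero hy0 hσy0))
    (by rw [map_pow, map_mul, G.σ_σ H, mul_comm])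
    (by rw [map_pow, map_mul, H.comm J σ, hJy, map_inv₀, ← mul_inv, inv_pow]) hr hj
  rw [ordDiff_pow, ordDiff_mul hy0 hσy0, P.ordDiff_map G.σ_s, hordy] at key
  obtain ⟨n, rfl⟩ : ∃ l, n = l + 1 := ⟨n - 1, by omega⟩
  rw [Nat.add_sub_cancel]
  have e1 : ((2 : ℤ) ^ (n + 1 + 1) * D) = 4 * (2 ^ n * D : ℕ) := by push_cast; ring
  have e2 : (w : ℤ) * (2 * t + 2 * t) = 4 * (t * w : ℕ) := by push_cast; ring
  rw [e1, e2] at key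
  exact_mod_cast Int.dvd_of_mul_dvd_mul_left (by norm_num) key

/-- The class of `v₁` has order with the same `2`-part as `2 ^ (n - 1) * D`. -/
theorem factorization_orderOf (G : LayerGenerators a c ζ σ τ ρ J)
    (H : CyclotomicLayer p q n a c ζ) (P : PlacesOverTwo n (a * c) ζ π v₁ v₂)
    (hp : p % 8 = 5) (hq : q % 8 = 3) (hn : 1 ≤ n) {D : ℕ} (hD : 1 ≤ D)
    (hmin : ∀ t, 1 ≤ t → TwoPowNorm (p * q) t → D ∣ t)
    (h : ClassGroup.mk0 (heightOneIdeal v₁) ^ (2 ^ (n - 1) * D) = 1) :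
    (orderOf (ClassGroup.mk0 (heightOneIdeal v₁))).factorization 2 =
      n - 1 + D.factorization 2 := by
  obtain ⟨w, hw, hdvd⟩ := G.exists_odd_dvd_mul H P hp hq hn hmin (pow_orderOf_eq_one _)
  have hdvd' := orderOf_dvd_of_pow_eq_one h
  have ho : orderOf (ClassGroup.mk0 (heightOneIdeal v₁)) ≠ 0 :=
    ne_zero_of_dvd_ne_zero (by positivity) hdvd'
  have hw0 : w ≠ 0 := by rintro rfl; exact absurd hw (by decide)
  have e : (2 ^ (n - 1) * D).factorization 2 = n - 1 + D.factorization 2 := by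
    rw [Nat.factorization_mul (by positivity) (by omega), Finsupp.add_apply,
      Nat.prime_two.factorization_pow, Finsupp.single_eq_same]
  have hw2 : w.factorization 2 = 0 :=
    Nat.factorization_eq_zero_of_not_dvd hw.not_two_dvd_nat
  refine le_antisymm ?_ ?_
  · rw [← e]
    exact (Nat.factorization_le_iff_dvd ho (by positivity)).2 hdvd' 2
  · have := (Nat.factorization_le_iff_dvd (by positivity) (mul_ne_zero ho hw0)).2 hdvd 2
    rwa [e, Nat.factorization_mul ho hw0, Finsupp.add_apply, hw2, add_zero] at this

end LayerGenerators

end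

end

section

open NumberField IsDedekindDomain

variable {p q : ℕ} [hpp : Fact p.Prime] [hqp : Fact q.Prime]

/-- The `2`-class number of `ℚ(√-pq)` is the `2`-part of the least exponent of a power of `2`
primitively represented by the norm form. -/
theorem exists_order_of_twoClassNum (hp : p % 8 = 5) (hq : q % 8 = 3) {m : ℕ}
    (hm : 2 ^ m = twoClassNum (IntermediateField.adjoin ℚ
      {((Real.sqrt (p * q) : ℝ) : ℂ) * Complex.I})) :
    ∃ D, 1 ≤ D ∧ TwoPowNorm (p * q) D ∧ (∀ t, 1 ≤ t → TwoPowNorm (p * q) t → D ∣ t) ∧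
      D.factorization 2 = m := by
  obtain ⟨s, hs⟩ : ∃ s, s = ((Real.sqrt (p * q) : ℝ) : ℂ) * Complex.I := ⟨_, rfl⟩
  rw [← hs] at hm
  have hs2 : s ^ 2 = -((p * q : ℕ) : ℂ) := by
    rw [hs, mul_pow, Complex.I_sq, ← Complex.ofReal_pow, Real.sq_sqrt (by positivity)]
    push_cast
    ring
  have h_int : IsIntegral ℚ s := by
    refine IsIntegral.of_pow two_pos ?_
    rw [hs2]
    simpa using (isIntegral_algebraMap (R := ℚ) (A := ℂ) (x := -((p * q : ℕ) : ℚ)))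
  set κ := IntermediateField.adjoin ℚ {s}
  have : FiniteDimensional ℚ κ := IntermediateField.adjoin.finiteDimensional h_int
  have : NumberField κ := ⟨⟩
  obtain ⟨J, H⟩ := exists_imaginaryQuadratic (F := κ) (p := p) (q := q)
    (s := ⟨s, IntermediateField.mem_adjoin_simple_self ℚ s⟩)
    (Subtype.ext (by simpa using hs2)) (fun x => by
      obtain ⟨u, v, h⟩ := exists_rat_of_mem_adjoin
        (Nat.mul_pos hpp.out.pos hqp.out.pos) hs2 x.2
      exact ⟨u, v, Subtype.ext (by simpa using h)⟩)
  obtain ⟨D, hD, hT, hmin, h⟩ := H.exists_order (by omega) (by rw [Nat.mul_mod, hp, hq]) hp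
  refine ⟨D, hD, hT, hmin, ?_⟩
  rw [← h]
  exact (Nat.pow_right_injective le_rfl hm).symm

theorem numberField_adjoin_sqrt_sqrt (p q : ℕ) {n : ℕ} {ζ : ℂ}
    (hζ : IsPrimitiveRoot ζ (2 ^ (n + 2))) : NumberField (IntermediateField.adjoin ℚ
      {((Real.sqrt p : ℝ) : ℂ), ((Real.sqrt q : ℝ) : ℂ), ζ}) := by
  have h_int : ∀ x ∈ ({((Real.sqrt p : ℝ) : ℂ), ((Real.sqrt q : ℝ) : ℂ), ζ} : Set ℂ),
      IsIntegral ℚ x := by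
    have hsqrt : ∀ k : ℕ, IsIntegral ℚ ((Real.sqrt k : ℝ) : ℂ) := fun k => by
      refine IsIntegral.of_pow two_pos ?_
      rw [← Complex.ofReal_pow, Real.sq_sqrt (Nat.cast_nonneg k)]
      simpa using (isIntegral_algebraMap (R := ℚ) (A := ℂ) (x := (k : ℚ)))
    rintro x (rfl | rfl | rfl)
    · exact hsqrt p
    · exact hsqrt q
    · exact IsIntegral.of_pow (n := 2 ^ (n + 2)) (by positivity)
        (hζ.pow_eq_one ▸ isIntegral_one)
  have := IntermediateField.finiteDimensional_adjoin h_int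
  exact ⟨⟩

theorem CyclotomicLayer.of_adjoin {n : ℕ} {ζ : ℂ} [NumberField (IntermediateField.adjoin ℚ
      {((Real.sqrt p : ℝ) : ℂ), ((Real.sqrt q : ℝ) : ℂ), ζ})] (hζ : IsPrimitiveRoot ζ (2 ^ (n + 2))) :
    ∃ a c z : IntermediateField.adjoin ℚ
      {((Real.sqrt p : ℝ) : ℂ), ((Real.sqrt q : ℝ) : ℂ), ζ}, CyclotomicLayer p q n a c z := by
  set A : ℂ := ((Real.sqrt p : ℝ) : ℂ) with hA
  set B : ℂ := ((Real.sqrt q : ℝ) : ℂ) with hB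
  set L := IntermediateField.adjoin ℚ {A, B, ζ}
  have hAL : A ∈ L := IntermediateField.subset_adjoin _ _ (by simp)
  have hBL : B ∈ L := IntermediateField.subset_adjoin _ _ (by simp)
  have hζL : ζ ∈ L := IntermediateField.subset_adjoin _ _ (by simp)
  have hA2 : A ^ 2 = p := by
    rw [hA, ← Complex.ofReal_pow, Real.sq_sqrt (Nat.cast_nonneg p), Complex.ofReal_natCast]
  have hB2 : B ^ 2 = q := by
    rw [hB, ← Complex.ofReal_pow, Real.sq_sqrt (Nat.cast_nonneg q), Complex.ofReal_natCast]
  have hi : (ζ ^ 2 ^ n) ^ 2 = -1 := by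
    have h := hζ.pow (by positivity) (show 2 ^ (n + 2) = 2 ^ n * 2 ^ 2 by ring)
    have h2 := h.pow (by positivity) (show 2 ^ 2 = 2 * 2 by norm_num)
    exact h2.eq_neg_one_of_two_right
  refine ⟨⟨A, hAL⟩, ⟨B * ζ ^ 2 ^ n, mul_mem hBL (pow_mem hζL _)⟩, ⟨ζ, hζL⟩, ?_, ?_, ?_, ?_⟩
  · exact Subtype.ext (by simpa using hA2)
  · exact Subtype.ext (by
      change (B * ζ ^ 2 ^ n) ^ 2 = -(q : ℂ)
      rw [mul_pow, hi, hB2, mul_neg_one])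
  · exact IsPrimitiveRoot.of_map_of_injective (f := L.val) hζ L.val.injective
  · set K := IntermediateField.adjoin ℚ
      ({⟨A, hAL⟩, ⟨B * ζ ^ 2 ^ n, mul_mem hBL (pow_mem hζL _)⟩, ⟨ζ, hζL⟩} : Set L)
    have hz : (⟨ζ, hζL⟩ : L) ∈ K := IntermediateField.subset_adjoin _ _ (by simp)
    have hc : (⟨B * ζ ^ 2 ^ n, mul_mem hBL (pow_mem hζL _)⟩ : L) ∈ K :=
      IntermediateField.subset_adjoin _ _ (by simp)
    have hle : L ≤ K.map L.val := by
      refine IntermediateField.adjoin_le_iff.2 ?_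
      rintro x (rfl | rfl | rfl)
      · exact ⟨⟨A, hAL⟩, IntermediateField.subset_adjoin _ _ (by simp), rfl⟩
      · refine ⟨_, K.div_mem hc (K.pow_mem hz (2 ^ n)), ?_⟩
        change B * ζ ^ 2 ^ n / ζ ^ 2 ^ n = B
        exact mul_div_cancel_right₀ _ (pow_ne_zero _ (hζ.ne_zero (by positivity)))
      · exact ⟨_, hz, rfl⟩
    refine eq_top_iff.2 fun x _ => ?_
    obtain ⟨y, hy, hxy⟩ := hle x.2
    have : y = x := Subtype.ext hxy
    exact this ▸ hy

end

theorem twoClassGroup_cyclotomic_layers_cyclic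
    (p q : ℕ) [Fact (Nat.Prime p)] [Fact (Nat.Prime q)]
    (hp : p % 8 = 5) (hq : q % 8 = 3)
    (m : ℕ)
    (hm : 2 ^ m = twoClassNum (IntermediateField.adjoin ℚ
      {((Real.sqrt (p * q) : ℝ) : ℂ) * Complex.I})) :
    ∀ n : ℕ, 1 ≤ n → ∀ ζ : ℂ, IsPrimitiveRoot ζ (2 ^ (n + 2)) →
      TwoClassGroupIsCyclicOfOrder
        (IntermediateField.adjoin ℚ
          {((Real.sqrt p : ℝ) : ℂ), ((Real.sqrt q : ℝ) : ℂ), ζ})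
        (2 ^ (n + m - 1)) := by
  intro n hn ζ hζ
  obtain ⟨D, hD, hT, hmin, rfl⟩ := exists_order_of_twoClassNum hp hq hm
  have := numberField_adjoin_sqrt_sqrt p q hζ
  obtain ⟨a, c, z, H⟩ := CyclotomicLayer.of_adjoin (p := p) (q := q) hζ
  obtain ⟨hfin, π, v₁, v₂, P⟩ := H.exists_placesOverTwo hp hq
  obtain ⟨σ, τ, ρ, J, ⟨h1, h2, h3⟩, ⟨h4, h5, h6⟩, ⟨h7, h8, h9⟩, h10, h11, h12⟩ :=
    H.exists_generators hfin hn
  have G : LayerGenerators a c z σ τ ρ J := ⟨h1, h2, h3, h4, h5, h6, h7, h8, h9, h10, h11, h12⟩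
  obtain ⟨hsq, hpow⟩ := G.squarePrincipal_top H P hp hq hn hD hT hmin
  have hcl : ClassGroup.mk0 (heightOneIdeal v₂) ∈
      Subgroup.zpowers (ClassGroup.mk0 (heightOneIdeal v₁)) := by
    rw [eq_inv_of_mul_eq_one_right P.mk0_mul_mk0]
    exact inv_mem (Subgroup.mem_zpowers _)
  obtain ⟨-, h⟩ := factorization_card_eq_of_forall_mem_zpowers
    (mem_zpowers_of_pow_two_pow_eq_one P.eq_or_eq hcl hsq)
  rw [G.factorization_orderOf H P hp hq hn hD hmin hpow, ← Nat.sub_add_comm hn] at h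
  exact h
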